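/- Let f ∈ C⁰([0,∞)) ∩ C²((0,∞)) be nondecreasing and convex with f > 0 on (0,∞), and set q̄₀ = limsup_{u→0⁺} q(u) and q̲₀ = liminf_{u→0⁺} q(u). Let u ∈ C²(ℝ^N) be a bounded, nonnegative, stable solution of −Δu = f(u) in ℝ^N. Then u ≡ 0 if either (1) N ≥ 3 and q̲₀ > N/2, or (2) 1 ≤ N ≤ 6 and q̄₀ < +∞, or (3) N ≥ 1 and (4/(N−2))·(1 + 1/√(q̄₀)) > 1/q̲₀. -/

import Mathlib

open MeasureTheory Filter Topology
open scoped ENNReal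

/-- The Laplacian of `u : ℝ^N → ℝ`. -/
noncomputable def lap {N : ℕ} (u : EuclideanSpace ℝ (Fin N) → ℝ)
    (x : EuclideanSpace ℝ (Fin N)) : ℝ :=
  ∑ i : Fin N, iteratedFDeriv ℝ 2 u x ![EuclideanSpace.single i 1, EuclideanSpace.single i 1]

/-- `u` is a stable solution w.r.t. the linearized weight `g = f'`:
`∫ f'(u) φ² ≤ ∫ |∇φ|²` for all `φ ∈ C¹_c(ℝ^N)`. -/
def Stable {N : ℕ} (g : ℝ → ℝ) (u : EuclideanSpace ℝ (Fin N) → ℝ) : Prop :=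
  ∀ φ : EuclideanSpace ℝ (Fin N) → ℝ, ContDiff ℝ 1 φ → HasCompactSupport φ →
    ∫ x, g (u x) * (φ x) ^ 2 ≤ ∫ x, ‖gradient φ x‖ ^ 2

/-- `u` is stable outside the set `K` : the stability inequality holds for all
`φ ∈ C¹_c(ℝ^N \ K)`. -/
def StableOutside {N : ℕ} (g : ℝ → ℝ) (u : EuclideanSpace ℝ (Fin N) → ℝ)
    (K : Set (EuclideanSpace ℝ (Fin N))) : Prop :=
  ∀ φ : EuclideanSpace ℝ (Fin N) → ℝ, ContDiff ℝ 1 φ → HasCompactSupport φ →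
    tsupport φ ⊆ Kᶜ →
    ∫ x, g (u x) * (φ x) ^ 2 ≤ ∫ x, ‖gradient φ x‖ ^ 2

/-- The quantity `q(u) = f'(u)²/(f(u) f''(u)) ∈ [0,∞]`, with the convention
`q(u) = +∞` when `f(u) f''(u) = 0`. -/
noncomputable def qfun (f : ℝ → ℝ) (t : ℝ) : ℝ≥0∞ :=
  if f t * deriv (deriv f) t = 0 then ⊤
  else ENNReal.ofReal ((deriv f t) ^ 2 / (f t * deriv (deriv f) t))

/-- The Joseph–Lundgren exponent `p_c(N)` (for `N ≥ 11`). -/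
noncomputable def pc (N : ℕ) : ℝ :=
  (((N : ℝ) - 2) ^ 2 - 4 * N + 8 * Real.sqrt ((N : ℝ) - 1)) / (((N : ℝ) - 2) * ((N : ℝ) - 10))

/-- The `i`-th partial derivative. -/
noncomputable def pd {N : ℕ} (g : EuclideanSpace ℝ (Fin N) → ℝ) (i : Fin N)
    (x : EuclideanSpace ℝ (Fin N)) : ℝ :=
  fderiv ℝ g x (EuclideanSpace.single i 1)

section PartialDerivatives

variable {N : ℕ} {g h : EuclideanSpace ℝ (Fin N) → ℝ}

theorem ContDiff.pd {n m : WithTop ℕ∞} (hg : ContDiff ℝ n g) (hmn : m + 1 ≤ n) (i : Fin N) :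
    ContDiff ℝ m (pd g i) :=
  (hg.fderiv_right hmn).clm_apply contDiff_const

theorem continuous_pd (hg : ContDiff ℝ 1 g) (i : Fin N) : Continuous (pd g i) :=
  (hg.continuous_fderiv one_ne_zero).clm_apply continuous_const

theorem HasCompactSupport.pd (hg : HasCompactSupport g) (i : Fin N) :
    HasCompactSupport (pd g i) :=
  hg.fderiv_apply (𝕜 := ℝ) _

theorem pd_mul (hg : ContDiff ℝ 1 g) (hh : ContDiff ℝ 1 h) (i : Fin N)
    (x : EuclideanSpace ℝ (Fin N)) :
    pd (fun y => g y * h y) i x = pd g i x * h x + g x * pd h i x := by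
  unfold pd
  rw [fderiv_fun_mul (hg.differentiable one_ne_zero x) (hh.differentiable one_ne_zero x)]
  simp
  ring

theorem pd_sq (hg : ContDiff ℝ 1 g) (i : Fin N) (x : EuclideanSpace ℝ (Fin N)) :
    pd (fun y => g y ^ 2) i x = 2 * g x * pd g i x := by
  have := pd_mul hg hg i x
  simp only [← sq] at this
  rw [this]; ring

theorem pd_sum {ι : Type*} (s : Finset ι) {G : ι → EuclideanSpace ℝ (Fin N) → ℝ}
    (hG : ∀ k, ContDiff ℝ 1 (G k)) (i : Fin N) (x : EuclideanSpace ℝ (Fin N)) :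
    pd (fun y => ∑ k ∈ s, G k y) i x = ∑ k ∈ s, pd (G k) i x := by
  unfold pd
  rw [fderiv_fun_sum fun k _ => (hG k).differentiable one_ne_zero x]
  simp

theorem pd_coord (j i : Fin N) (x : EuclideanSpace ℝ (Fin N)) :
    pd (fun y => y j) i x = if j = i then 1 else 0 := by
  unfold pd
  have : (fun y : EuclideanSpace ℝ (Fin N) => y j) = (EuclideanSpace.proj j : _ →L[ℝ] ℝ) := rfl
  rw [this, ContinuousLinearMap.fderiv]
  simp

theorem pd_comp {F : ℝ → ℝ} {F' : ℝ} (hg : ContDiff ℝ 1 g) (i : Fin N)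
    (x : EuclideanSpace ℝ (Fin N)) (hF : HasDerivAt F F' (g x)) :
    pd (fun y => F (g y)) i x = F' * pd g i x := by
  unfold pd
  have := hF.comp_hasFDerivAt x (hg.differentiable one_ne_zero x).hasFDerivAt
  rw [show (fun y => F (g y)) = F ∘ g from rfl, this.fderiv]
  simp

theorem pd_const_mul (c : ℝ) (hg : ContDiff ℝ 1 g) (i : Fin N) (x : EuclideanSpace ℝ (Fin N)) :
    pd (fun y => c * g y) i x = c * pd g i x := by
  unfold pd
  rw [fderiv_const_mul (hg.differentiable one_ne_zero x)]
  simp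

theorem pd_pd_comm (hg : ContDiff ℝ 2 g) (i j : Fin N) (x : EuclideanSpace ℝ (Fin N)) :
    pd (pd g i) j x = pd (pd g j) i x := by
  have hd : DifferentiableAt ℝ (fderiv ℝ g) x :=
    (hg.fderiv_right (m := 1) le_rfl).differentiable one_ne_zero x
  have key (a b : Fin N) : pd (pd g a) b x =
      fderiv ℝ (fderiv ℝ g) x (EuclideanSpace.single b 1) (EuclideanSpace.single a 1) := by
    unfold pd
    rw [fderiv_clm_apply hd (differentiableAt_const _)]
    simp
  rw [key, key]
  exact (hg.contDiffAt.isSymmSndFDerivAt (by simp)) _ _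

theorem lap_eq_sum_pd (hg : ContDiff ℝ 2 g) (x : EuclideanSpace ℝ (Fin N)) :
    lap g x = ∑ i, pd (pd g i) i x := by
  unfold lap
  refine Finset.sum_congr rfl fun i _ => ?_
  have hd : DifferentiableAt ℝ (fderiv ℝ g) x :=
    (hg.fderiv_right (m := 1) le_rfl).differentiable one_ne_zero x
  unfold pd
  rw [iteratedFDeriv_two_apply, fderiv_clm_apply hd (differentiableAt_const _)]
  simp

theorem norm_sq_eq_sum (x : EuclideanSpace ℝ (Fin N)) : ‖x‖ ^ 2 = ∑ i, x i ^ 2 := by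
  rw [EuclideanSpace.norm_eq, Real.sq_sqrt (by positivity)]
  simp

theorem norm_gradient_sq (hg : ContDiff ℝ 1 g) (x : EuclideanSpace ℝ (Fin N)) :
    ‖gradient g x‖ ^ 2 = ∑ i, pd g i x ^ 2 := by
  have hgrad := (hg.differentiable one_ne_zero x).hasGradientAt
  rw [norm_sq_eq_sum]
  refine Finset.sum_congr rfl fun i _ => ?_
  congr 1
  unfold pd
  rw [hgrad.hasFDerivAt.fderiv, InnerProductSpace.toDual_apply_apply,
    EuclideanSpace.inner_single_right]
  simp

theorem HasCompactSupport.fun_sq (hc : HasCompactSupport g) :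
    HasCompactSupport fun x => g x ^ 2 :=
  hc.comp_left (g := fun t : ℝ => t ^ 2) (by simp)

theorem integrable_of_cc (hg : Continuous g) (hc : HasCompactSupport g) : Integrable g :=
  hg.integrable_of_hasCompactSupport hc

theorem integral_pd_eq_zero (hg : ContDiff ℝ 1 g) (hc : HasCompactSupport g) (i : Fin N) :
    ∫ x, pd g i x = 0 := by
  have := integral_mul_fderiv_eq_neg_fderiv_mul_of_integrable (𝕜 := ℝ) (μ := volume)
    (f := fun _ : EuclideanSpace ℝ (Fin N) => (1 : ℝ)) (g := g)
    (v := EuclideanSpace.single i 1) (by simp)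
    (by simp only [one_mul]; exact integrable_of_cc (continuous_pd hg i) (hc.pd i))
    (by simpa using integrable_of_cc hg.continuous hc)
    (fun x _ => differentiableAt_const _) (fun x _ => hg.differentiable one_ne_zero x)
  simpa [pd] using this

/-- The divergence theorem for compactly supported fields. -/
theorem integral_div_eq_zero {V : Fin N → EuclideanSpace ℝ (Fin N) → ℝ}
    (hV : ∀ i, ContDiff ℝ 1 (V i)) (hc : ∀ i, HasCompactSupport (V i)) :
    ∫ x, ∑ i, pd (V i) i x = 0 := by
  rw [integral_finsetSum _ fun i _ => integrable_of_cc (continuous_pd (hV i) i) ((hc i).pd i)]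
  exact Finset.sum_eq_zero fun i _ => integral_pd_eq_zero (hV i) (hc i) i

end PartialDerivatives

section WeakFormulations

variable {N : ℕ} {u φ ψ F G : EuclideanSpace ℝ (Fin N) → ℝ}

theorem continuous_pd_pd (hu : ContDiff ℝ 2 u) (i j : Fin N) : Continuous (pd (pd u i) j) :=
  continuous_pd (hu.pd (m := 1) le_rfl i) j

theorem continuous_lap (hu : ContDiff ℝ 2 u) : Continuous (lap u) := by
  rw [funext (lap_eq_sum_pd hu)]
  exact continuous_finsetSum _ fun i _ => continuous_pd_pd hu i i

theorem integral_grad_mul_grad (hu : ContDiff ℝ 2 u) (hφ : ContDiff ℝ 1 φ)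
    (hc : HasCompactSupport φ) :
    ∫ x, ∑ j, pd u j x * pd φ j x = ∫ x, -lap u x * φ x := by
  have h1 (j : Fin N) : ContDiff ℝ 1 (pd u j) := hu.pd le_rfl j
  have h0 := integral_div_eq_zero (V := fun j x => pd u j x * φ x) (fun j => (h1 j).mul hφ)
    (fun j => hc.mul_left)
  have hi : Integrable fun x => ∑ j, pd u j x * pd φ j x :=
    integrable_finsetSum _ fun j _ => integrable_of_cc
      ((h1 j).continuous.mul (continuous_pd hφ j)) (hc.pd j).mul_left
  have hl : Integrable fun x => -lap u x * φ x :=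
    integrable_of_cc ((continuous_lap hu).neg.mul hφ.continuous) hc.mul_left
  rw [← sub_eq_zero, ← integral_sub hi hl, ← h0]
  refine integral_congr_ae (.of_forall fun x => ?_)
  simp only [pd_mul (h1 _) hφ, Finset.sum_add_distrib, lap_eq_sum_pd hu, Finset.sum_mul, neg_mul]
  ring

theorem integral_lap_mul (hu : ContDiff ℝ 2 u) (hψ : ContDiff ℝ 2 ψ) (hc : HasCompactSupport ψ) :
    ∫ x, -lap u x * ψ x = -∫ x, u x * lap ψ x := by
  have hu1 : ContDiff ℝ 1 u := hu.of_le (by norm_num)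
  rw [← integral_grad_mul_grad hu (hψ.of_le (by norm_num)) hc]
  have h1 (j : Fin N) : ContDiff ℝ 1 (pd ψ j) := hψ.pd le_rfl j
  have h0 := integral_div_eq_zero (V := fun j x => u x * pd ψ j x) (fun j => hu1.mul (h1 j))
    (fun j => (hc.pd j).mul_left)
  have hi : Integrable fun x => ∑ j, pd u j x * pd ψ j x :=
    integrable_finsetSum _ fun j _ => integrable_of_cc
      ((continuous_pd hu1 j).mul (h1 j).continuous) (hc.pd j).mul_left
  have hl : Integrable fun x => u x * lap ψ x := by
    simp only [lap_eq_sum_pd hψ, Finset.mul_sum]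
    exact integrable_finsetSum _ fun j _ => integrable_of_cc
      (hu.continuous.mul (continuous_pd_pd hψ j j)) ((hc.pd j).pd j).mul_left
  rw [← sub_eq_zero, sub_neg_eq_add, ← integral_add hi hl, ← h0]
  refine integral_congr_ae (.of_forall fun x => ?_)
  simp only [pd_mul hu1 (h1 _), Finset.sum_add_distrib, lap_eq_sum_pd hψ, Finset.mul_sum]

theorem hasDerivAt_integral_translate (hG : ContDiff ℝ 1 G) (hφ : Continuous φ)
    (hc : HasCompactSupport φ) (i : Fin N) :
    HasDerivAt (fun t : ℝ => ∫ x, G (x + t • EuclideanSpace.single i 1) * φ x)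
      (∫ x, pd G i x * φ x) 0 := by
  set e : EuclideanSpace ℝ (Fin N) := EuclideanSpace.single i 1
  obtain ⟨C, hC⟩ := (IsCompact.prod hc (isCompact_closedBall (0 : ℝ) 1)).exists_bound_of_continuousOn
    (f := fun p : EuclideanSpace ℝ (Fin N) × ℝ => pd G i (p.1 + p.2 • e))
    ((continuous_pd hG i).comp (by fun_prop)).continuousOn
  have := hasDerivAt_integral_of_dominated_loc_of_deriv_le (μ := volume) (x₀ := (0 : ℝ))
    (F := fun t x => G (x + t • e) * φ x) (F' := fun t x => pd G i (x + t • e) * φ x)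
    (bound := fun x => C * |φ x|) (s := Metric.ball 0 1) (Metric.ball_mem_nhds _ one_pos)
    (.of_forall fun t => ((hG.continuous.comp (by fun_prop)).mul hφ).aestronglyMeasurable)
    (integrable_of_cc ((hG.continuous.comp (by fun_prop)).mul hφ) hc.mul_left)
    ((((continuous_pd hG i).comp (by fun_prop)).mul hφ).aestronglyMeasurable)
    (.of_forall fun x t ht => ?_) ((integrable_of_cc hφ hc).abs.const_mul C)
    (.of_forall fun x t _ => ?_)
  · simpa using this.2
  · rw [norm_mul, Real.norm_eq_abs (φ x)]
    by_cases hx : x ∈ tsupport φ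
    · exact mul_le_mul_of_nonneg_right (hC (x, t) ⟨hx, Metric.ball_subset_closedBall ht⟩)
        (abs_nonneg _)
    · simp [image_eq_zero_of_notMem_tsupport hx]
  · refine HasDerivAt.mul_const ?_ _
    have h1 : HasDerivAt (fun t : ℝ => x + t • e) e t := by
      simpa using ((hasDerivAt_id t).smul_const e).const_add x
    exact (hG.differentiable one_ne_zero _).hasFDerivAt.comp_hasDerivAt t h1

theorem pd_translate (j : Fin N) (a x : EuclideanSpace ℝ (Fin N)) :
    pd (fun y => φ (y - a)) j x = pd φ j (x - a) := by
  unfold pd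
  simp only [sub_eq_add_neg, fderiv_comp_add_right]

/-- The weak form of the linearised equation satisfied by a partial derivative of `u`. -/
theorem integral_linearized (hu : ContDiff ℝ 2 u) (hF : ContDiff ℝ 1 F)
    (hsol : ∀ x, -lap u x = F x) (hφ : ContDiff ℝ 1 φ) (hc : HasCompactSupport φ) (i : Fin N) :
    ∫ x, ∑ j, pd (pd u i) j x * pd φ j x = ∫ x, pd F i x * φ x := by
  set e : EuclideanSpace ℝ (Fin N) := EuclideanSpace.single i 1 with he
  have h1 (j : Fin N) : ContDiff ℝ 1 (pd u j) := hu.pd le_rfl j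
  have hL : HasDerivAt (fun t : ℝ => ∑ j, ∫ x, pd u j (x + t • e) * pd φ j x)
      (∑ j, ∫ x, pd (pd u j) i x * pd φ j x) 0 :=
    HasDerivAt.fun_sum fun j _ =>
      hasDerivAt_integral_translate (h1 j) (continuous_pd hφ j) (hc.pd j) i
  have hR := hasDerivAt_integral_translate hF hφ.continuous hc i
  have heq : (fun t : ℝ => ∑ j, ∫ x, pd u j (x + t • e) * pd φ j x) =
      fun t : ℝ => ∫ x, F (x + t • e) * φ x := by
    funext t
    have hφt : ContDiff ℝ 1 fun y => φ (y - t • e) := hφ.comp (contDiff_id.sub contDiff_const)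
    have hct : HasCompactSupport fun y => φ (y - t • e) :=
      hc.comp_homeomorph (Homeomorph.subRight (t • e))
    have := integral_grad_mul_grad hu hφt hct
    simp only [hsol, pd_translate] at this
    rw [← integral_add_right_eq_self (fun x => ∑ j, pd u j x * pd φ j (x - t • e)) (t • e),
      ← integral_add_right_eq_self (fun x => F x * φ (x - t • e)) (t • e)] at this
    simp only [add_sub_cancel_right] at this
    rw [← this, integral_finsetSum]
    exact fun j _ => integrable_of_cc (((h1 j).continuous.comp (by fun_prop)).mul
      (continuous_pd hφ j)) (hc.pd j).mul_left
  rw [heq] at hL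
  rw [← hL.unique hR, ← integral_finsetSum]
  · simp only [pd_pd_comm hu]
  · exact fun j _ => integrable_of_cc ((continuous_pd_pd hu j i).mul
      (continuous_pd hφ j)) (hc.pd j).mul_left

end WeakFormulations

/-- `u` solves `-Δu = F` with a weight `P` such that `∇F = P ∇u`, and is stable with respect to
the nonnegative weight `P`. -/
structure IsStableSolution {N : ℕ} (u F P : EuclideanSpace ℝ (Fin N) → ℝ) : Prop where
  contDiff : ContDiff ℝ 2 u
  contDiff_source : ContDiff ℝ 1 F
  continuous_weight : Continuous P
  weight_nonneg : ∀ x, 0 ≤ P x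
  neg_lap_eq : ∀ x, -lap u x = F x
  pd_source : ∀ i x, pd F i x = P x * pd u i x
  stable : ∀ φ : EuclideanSpace ℝ (Fin N) → ℝ, ContDiff ℝ 1 φ → HasCompactSupport φ →
    ∫ x, P x * φ x ^ 2 ≤ ∫ x, ∑ j, pd φ j x ^ 2

/-- The radial derivative `x ↦ ∑ xᵢ ∂ᵢu(x)`. -/
noncomputable def radial {N : ℕ} (u : EuclideanSpace ℝ (Fin N) → ℝ)
    (x : EuclideanSpace ℝ (Fin N)) : ℝ :=
  ∑ i, x i * pd u i x

/-- The squared norm of the gradient. -/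
noncomputable def gradSq {N : ℕ} (u : EuclideanSpace ℝ (Fin N) → ℝ)
    (x : EuclideanSpace ℝ (Fin N)) : ℝ :=
  ∑ i, pd u i x ^ 2

section StableSolutions

variable {N : ℕ} {u F P η : EuclideanSpace ℝ (Fin N) → ℝ}

theorem contDiff_coord {n : WithTop ℕ∞} (i : Fin N) :
    ContDiff ℝ n fun x : EuclideanSpace ℝ (Fin N) => x i :=
  (EuclideanSpace.proj i : EuclideanSpace ℝ (Fin N) →L[ℝ] ℝ).contDiff

theorem ContDiff.radial (hu : ContDiff ℝ 2 u) : ContDiff ℝ 1 (radial u) :=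
  ContDiff.sum fun i _ => (contDiff_coord i).mul (hu.pd le_rfl i)

theorem ContDiff.gradSq (hu : ContDiff ℝ 2 u) : ContDiff ℝ 1 (gradSq u) :=
  ContDiff.sum fun i _ => (hu.pd (m := 1) le_rfl i).pow 2

theorem continuous_gradSq (hu : ContDiff ℝ 1 u) : Continuous (gradSq u) :=
  continuous_finsetSum _ fun i _ => (continuous_pd hu i).pow 2

theorem HasCompactSupport.gradSq (hc : HasCompactSupport η) : HasCompactSupport (gradSq η) :=
  HasCompactSupport.intro hc fun x hx => Finset.sum_eq_zero fun i _ => by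
    rw [_root_.pd, image_eq_zero_of_notMem_tsupport fun hh => hx (tsupport_fderiv_subset ℝ hh)]
    simp

theorem gradSq_nonneg (x : EuclideanSpace ℝ (Fin N)) : 0 ≤ gradSq u x :=
  Finset.sum_nonneg fun _ _ => sq_nonneg _

theorem pd_radial (hu : ContDiff ℝ 2 u) (j : Fin N) (x : EuclideanSpace ℝ (Fin N)) :
    pd (radial u) j x = pd u j x + ∑ i, x i * pd (pd u i) j x := by
  have h1 (i : Fin N) : ContDiff ℝ 1 (pd u i) := hu.pd le_rfl i
  unfold radial
  rw [pd_sum _ fun i => (contDiff_coord i).mul (h1 i)]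
  simp only [pd_mul (contDiff_coord _) (h1 _), pd_coord, Finset.sum_add_distrib, ite_mul, one_mul,
    zero_mul]
  simp

theorem pd_gradSq (hu : ContDiff ℝ 2 u) (j : Fin N) (x : EuclideanSpace ℝ (Fin N)) :
    pd (gradSq u) j x = ∑ i, 2 * pd u i x * pd (pd u i) j x := by
  have h1 (i : Fin N) : ContDiff ℝ 1 (pd u i) := hu.pd le_rfl i
  unfold gradSq
  rw [pd_sum _ fun i => (h1 i).pow 2]
  simp only [pd_sq (h1 _)]

theorem integral_sub_add_sub {A B C D : EuclideanSpace ℝ (Fin N) → ℝ} (hA : Integrable A)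
    (hB : Integrable B) (hC : Integrable C) (hD : Integrable D) :
    ∫ x, (A x - B x + C x - D x) = (∫ x, A x) - (∫ x, B x) + (∫ x, C x) - ∫ x, D x := by
  have hAB : Integrable fun x => A x - B x := hA.sub hB
  have hABC : Integrable fun x => A x - B x + C x := hAB.add hC
  rw [integral_sub hABC hD, integral_add hAB hC, integral_sub hA hB]

/-- The stability inequality tested with the radial derivative. -/
theorem IsStableSolution.radial_inequality (h : IsStableSolution u F P) (hη : ContDiff ℝ 1 η)
    (hc : HasCompactSupport η) :
    0 ≤ ∫ x, (radial u x ^ 2 * ∑ j, pd η j x ^ 2 - (N - 2) * gradSq u x * η x ^ 2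
      + 4 * radial u x * η x * ∑ j, pd u j x * pd η j x
      - 2 * gradSq u x * η x * ∑ j, x j * pd η j x) := by
  have hu := h.contDiff
  have h1 (i : Fin N) : ContDiff ℝ 1 (pd u i) := hu.pd le_rfl i
  have hw : ContDiff ℝ 1 (radial u) := hu.radial
  have hg : ContDiff ℝ 1 (gradSq u) := hu.gradSq
  have hη2 : ContDiff ℝ 1 fun y => η y ^ 2 := hη.pow 2
  have hc2 : HasCompactSupport fun y => η y ^ 2 := hc.fun_sq
  have hwη : ContDiff ℝ 1 fun y => radial u y * η y ^ 2 := hw.mul hη2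
  have hcw : HasCompactSupport fun y => radial u y * η y ^ 2 := hc2.mul_left
  have hst := h.stable (fun y => radial u y * η y) (hw.mul hη) hc.mul_left
  have hlin (i : Fin N) := integral_linearized hu h.contDiff_source h.neg_lap_eq
    (φ := fun y => y i * (radial u y * η y ^ 2)) ((contDiff_coord i).mul hwη) hcw.mul_left i
  have hd1 := integral_div_eq_zero (V := fun j y => pd u j y * (radial u y * η y ^ 2))
    (fun j => (h1 j).mul hwη) (fun j => hcw.mul_left)
  have hd2 := integral_div_eq_zero (V := fun j y => gradSq u y * (y j * η y ^ 2))
    (fun j => hg.mul ((contDiff_coord j).mul hη2)) (fun j => hc2.mul_left.mul_left)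
  have i1 : Integrable fun x => ∑ j, pd (fun y => radial u y * η y) j x ^ 2 :=
    integrable_finsetSum _ fun j _ => integrable_of_cc ((continuous_pd (hw.mul hη) j).pow 2) 
      (HasCompactSupport.pd hc.mul_left j).fun_sq
  have i2 : Integrable fun x => ∑ i, ∑ j, pd (pd u i) j x *
      pd (fun y => y i * (radial u y * η y ^ 2)) j x :=
    integrable_finsetSum _ fun i _ => integrable_finsetSum _ fun j _ => integrable_of_cc
      ((continuous_pd (h1 i) j).mul (continuous_pd ((contDiff_coord i).mul hwη) j))
      (HasCompactSupport.pd hcw.mul_left j).mul_left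
  have i3 : Integrable fun x => ∑ j, pd (fun y => pd u j y * (radial u y * η y ^ 2)) j x :=
    integrable_finsetSum _ fun j _ => integrable_of_cc (continuous_pd ((h1 j).mul hwη) j)
      (HasCompactSupport.pd hcw.mul_left j)
  have i4 : Integrable fun x => ∑ j, pd (fun y => gradSq u y * (y j * η y ^ 2)) j x :=
    integrable_finsetSum _ fun j _ => integrable_of_cc
      (continuous_pd (hg.mul ((contDiff_coord j).mul hη2)) j)
      (HasCompactSupport.pd hc2.mul_left.mul_left j)
  have hsum : ∫ x, P x * (radial u x * η x) ^ 2 = ∫ x, ∑ i, ∑ j, pd (pd u i) j x *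
      pd (fun y => y i * (radial u y * η y ^ 2)) j x := by
    rw [integral_finsetSum]
    · simp only [hlin]
      rw [← integral_finsetSum]
      · refine integral_congr_ae (.of_forall fun x => ?_)
        simp only [h.pd_source, radial]
        rw [mul_pow, sq (∑ i, _), Finset.sum_mul, Finset.sum_mul, Finset.mul_sum]
        refine Finset.sum_congr rfl fun i _ => ?_
        ring
      · exact fun i _ => integrable_of_cc ((continuous_pd h.contDiff_source i).mul
          ((contDiff_coord i).mul hwη).continuous) hcw.mul_left.mul_left
    · exact fun i _ => integrable_finsetSum _ fun j _ => integrable_of_cc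
        ((continuous_pd (h1 i) j).mul (continuous_pd ((contDiff_coord i).mul hwη) j))
        (HasCompactSupport.pd hcw.mul_left j).mul_left
  have key : ∫ x, (radial u x ^ 2 * ∑ j, pd η j x ^ 2 - (N - 2) * gradSq u x * η x ^ 2
      + 4 * radial u x * η x * ∑ j, pd u j x * pd η j x
      - 2 * gradSq u x * η x * ∑ j, x j * pd η j x) =
      ∫ x, (∑ j, pd (fun y => radial u y * η y) j x ^ 2
        - ∑ i, ∑ j, pd (pd u i) j x * pd (fun y => y i * (radial u y * η y ^ 2)) j x
        + ∑ j, pd (fun y => pd u j y * (radial u y * η y ^ 2)) j x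
        - ∑ j, pd (fun y => gradSq u y * (y j * η y ^ 2)) j x) := by
    refine integral_congr_ae (.of_forall fun x => ?_)
    simp only [pd_mul hw hη, pd_mul (contDiff_coord _) hwη, pd_mul hw hη2, pd_mul (h1 _) hwη,
      pd_mul hg ((contDiff_coord _).mul hη2), pd_mul (contDiff_coord _) hη2, pd_sq hη, pd_coord,
      pd_gradSq hu, if_true]
    have e2 : ∑ i, ∑ j, pd (pd u i) j x * ((if i = j then 1 else 0) * (radial u x * η x ^ 2)
        + x i * (pd (radial u) j x * η x ^ 2 + radial u x * (2 * η x * pd η j x))) =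
        ∑ j, (pd (pd u j) j x * (radial u x * η x ^ 2) + (pd (radial u) j x - pd u j x) *
          (pd (radial u) j x * η x ^ 2 + radial u x * (2 * η x * pd η j x))) := by
      rw [Finset.sum_comm]
      refine Finset.sum_congr rfl fun j _ => ?_
      rw [pd_radial hu, add_sub_cancel_left, Finset.sum_mul]
      simp only [mul_add, Finset.sum_add_distrib, ite_mul, one_mul, zero_mul, mul_ite, mul_zero]
      congr 1
      · simp
      · congr 1 <;> refine Finset.sum_congr rfl fun i _ => ?_ <;> ring
    have e4 : ∑ j, ((∑ i, 2 * pd u i x * pd (pd u i) j x) * (x j * η x ^ 2) + gradSq u x *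
        (1 * η x ^ 2 + x j * (2 * η x * pd η j x))) =
        ∑ j, (2 * pd u j x * (pd (radial u) j x - pd u j x) * η x ^ 2)
         + N * gradSq u x * η x ^ 2 + 2 * gradSq u x * η x * ∑ j, x j * pd η j x := by
      rw [Finset.sum_add_distrib, add_assoc]
      congr 1
      · simp only [Finset.sum_mul, pd_radial hu, add_sub_cancel_left, Finset.mul_sum]
        rw [Finset.sum_comm]
        refine Finset.sum_congr rfl fun i _ => Finset.sum_congr rfl fun j _ => ?_
        rw [pd_pd_comm hu i j]
        ring
      · simp only [one_mul, mul_add, Finset.sum_add_distrib, Finset.mul_sum,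
          Finset.sum_const, Finset.card_univ, Fintype.card_fin, nsmul_eq_mul]
        congr 1
        · ring
        · refine Finset.sum_congr rfl fun i _ => ?_
          ring
    rw [e2, e4]
    have e5 : 2 * gradSq u x * η x ^ 2 = ∑ j, 2 * pd u j x ^ 2 * η x ^ 2 := by
      unfold gradSq
      rw [Finset.mul_sum, Finset.sum_mul]
    have e6 : radial u x ^ 2 * ∑ j, pd η j x ^ 2 + 2 * gradSq u x * η x ^ 2
        + 4 * radial u x * η x * ∑ j, pd u j x * pd η j x =
        ∑ j, (pd (radial u) j x * η x + radial u x * pd η j x) ^ 2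
        - ∑ j, (pd (pd u j) j x * (radial u x * η x ^ 2) + (pd (radial u) j x - pd u j x) *
          (pd (radial u) j x * η x ^ 2 + radial u x * (2 * η x * pd η j x)))
        + ∑ j, (pd (pd u j) j x * (radial u x * η x ^ 2) + pd u j x *
          (pd (radial u) j x * η x ^ 2 + radial u x * (2 * η x * pd η j x)))
        - ∑ j, (2 * pd u j x * (pd (radial u) j x - pd u j x) * η x ^ 2) := by
      rw [e5, Finset.mul_sum, Finset.mul_sum]
      simp only [← Finset.sum_add_distrib, ← Finset.sum_sub_distrib]
      refine Finset.sum_congr rfl fun i _ => ?_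
      ring
    linear_combination e6
  rw [key, integral_sub_add_sub i1 i2 i3 i4, hd1, hd2, ← hsum]
  linarith

end StableSolutions

/-- A smooth regularisation of the norm of the gradient. -/
noncomputable def gradReg {N : ℕ} (u : EuclideanSpace ℝ (Fin N) → ℝ) (τ : ℝ)
    (x : EuclideanSpace ℝ (Fin N)) : ℝ :=
  √(gradSq u x + τ ^ 2)

/-- The squared Hilbert–Schmidt norm of the Hessian minus the squared norm of `∇ (gradReg u τ)`. -/
noncomputable def hessDefect {N : ℕ} (u : EuclideanSpace ℝ (Fin N) → ℝ) (τ : ℝ)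
    (x : EuclideanSpace ℝ (Fin N)) : ℝ :=
  ∑ i, ∑ j, pd (pd u i) j x ^ 2 - ∑ j, pd (gradReg u τ) j x ^ 2

section HessianEstimates

variable {N : ℕ} {u F P η : EuclideanSpace ℝ (Fin N) → ℝ} {τ : ℝ}

theorem gradReg_pos (hτ : 0 < τ) (x : EuclideanSpace ℝ (Fin N)) : 0 < gradReg u τ x :=
  Real.sqrt_pos.2 (by have := gradSq_nonneg (u := u) x; positivity)

theorem gradReg_sq (x : EuclideanSpace ℝ (Fin N)) :
    gradReg u τ x ^ 2 = gradSq u x + τ ^ 2 :=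
  Real.sq_sqrt (by have := gradSq_nonneg (u := u) x; positivity)

theorem contDiff_gradReg (hu : ContDiff ℝ 2 u) (hτ : 0 < τ) : ContDiff ℝ 1 (gradReg u τ) :=
  (hu.gradSq.add contDiff_const).sqrt fun x => by
    have := gradSq_nonneg (u := u) x; positivity

theorem gradReg_mul_pd (hu : ContDiff ℝ 2 u) (hτ : 0 < τ) (j : Fin N)
    (x : EuclideanSpace ℝ (Fin N)) :
    gradReg u τ x * pd (gradReg u τ) j x = ∑ i, pd u i x * pd (pd u i) j x := by
  have h1 := pd_sq (contDiff_gradReg hu hτ) j x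
  have h2 : pd (fun y => gradReg u τ y ^ 2) j x = pd (gradSq u) j x := by
    simp only [gradReg_sq]
    unfold pd
    rw [fderiv_add_const]
  rw [h2, pd_gradSq hu] at h1
  simp only [mul_assoc, ← Finset.mul_sum] at h1
  linarith

theorem continuous_hessDefect (hu : ContDiff ℝ 2 u) (hτ : 0 < τ) :
    Continuous (hessDefect u τ) :=
  (continuous_finsetSum _ fun i _ => continuous_finsetSum _ fun j _ =>
    (continuous_pd_pd hu i j).pow 2).sub
    (continuous_finsetSum _ fun j _ => (continuous_pd (contDiff_gradReg hu hτ) j).pow 2)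

/-- The Sternberg–Zumbrun inequality. -/
theorem IsStableSolution.integral_hessDefect_le (h : IsStableSolution u F P) (hτ : 0 < τ)
    (hη : ContDiff ℝ 1 η) (hc : HasCompactSupport η) :
    ∫ x, hessDefect u τ x * η x ^ 2 ≤ ∫ x, gradReg u τ x ^ 2 * gradSq η x := by
  have hu := h.contDiff
  have h1 (i : Fin N) : ContDiff ℝ 1 (pd u i) := hu.pd le_rfl i
  have hv : ContDiff ℝ 1 (gradReg u τ) := contDiff_gradReg hu hτ
  have hη2 : ContDiff ℝ 1 fun y => η y ^ 2 := hη.pow 2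
  have hc2 : HasCompactSupport fun y => η y ^ 2 := hc.fun_sq
  have hst := h.stable (fun y => gradReg u τ y * η y) (hv.mul hη) hc.mul_left
  have hlin (i : Fin N) := integral_linearized hu h.contDiff_source h.neg_lap_eq
    (φ := fun y => pd u i y * η y ^ 2) ((h1 i).mul hη2) hc2.mul_left i
  have i1 : Integrable fun x => ∑ j, pd (fun y => gradReg u τ y * η y) j x ^ 2 :=
    integrable_finsetSum _ fun j _ => integrable_of_cc ((continuous_pd (hv.mul hη) j).pow 2)
      (HasCompactSupport.pd hc.mul_left j).fun_sq
  have i2' (i : Fin N) : Integrable fun x => ∑ j, pd (pd u i) j x *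
      pd (fun y => pd u i y * η y ^ 2) j x :=
    integrable_finsetSum _ fun j _ => integrable_of_cc
      ((continuous_pd (h1 i) j).mul (continuous_pd ((h1 i).mul hη2) j))
      (HasCompactSupport.pd hc2.mul_left j).mul_left
  have i2 : Integrable fun x => ∑ i, ∑ j, pd (pd u i) j x *
      pd (fun y => pd u i y * η y ^ 2) j x := integrable_finsetSum _ fun i _ => i2' i
  have hsum : ∫ x, ∑ i, ∑ j, pd (pd u i) j x * pd (fun y => pd u i y * η y ^ 2) j x ≤
      ∫ x, P x * (gradReg u τ x * η x) ^ 2 := by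
    rw [integral_finsetSum _ fun i _ => i2' i]
    simp only [hlin]
    have i3 (i : Fin N) : Integrable fun x => pd F i x * (pd u i x * η x ^ 2) :=
      integrable_of_cc ((continuous_pd h.contDiff_source i).mul
          ((h1 i).mul hη2).continuous) hc2.mul_left.mul_left
    rw [← integral_finsetSum _ fun i _ => i3 i]
    refine integral_mono (integrable_finsetSum _ fun i _ => i3 i) (integrable_of_cc
      (h.continuous_weight.mul ((hv.mul hη).continuous.pow 2))
      (HasCompactSupport.fun_sq hc.mul_left).mul_left) fun x => ?_
    have e : ∑ i, pd F i x * (pd u i x * η x ^ 2) = P x * (gradSq u x * η x ^ 2) := by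
      simp only [h.pd_source, gradSq, Finset.sum_mul, Finset.mul_sum]
      exact Finset.sum_congr rfl fun i _ => by ring
    simp only [e, mul_pow, gradReg_sq]
    have := h.weight_nonneg x
    gcongr
    linarith [sq_nonneg τ]
  have i5 : Integrable fun x => hessDefect u τ x * η x ^ 2 :=
    integrable_of_cc ((continuous_hessDefect hu hτ).mul hη2.continuous) hc2.mul_left
  have i6 : Integrable fun x => gradReg u τ x ^ 2 * gradSq η x :=
    integrable_of_cc ((hv.continuous.pow 2).mul (continuous_gradSq hη)) hc.gradSq.mul_left
  rw [← sub_nonneg, ← integral_sub i6 i5]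
  have key : ∫ x, (gradReg u τ x ^ 2 * gradSq η x - hessDefect u τ x * η x ^ 2) =
      ∫ x, (∑ j, pd (fun y => gradReg u τ y * η y) j x ^ 2
        - ∑ i, ∑ j, pd (pd u i) j x * pd (fun y => pd u i y * η y ^ 2) j x) := by
    refine integral_congr_ae (.of_forall fun x => ?_)
    simp only [pd_mul hv hη, pd_mul (h1 _) hη2, pd_sq hη]
    have e : ∑ i, ∑ j, pd (pd u i) j x * (pd (pd u i) j x * η x ^ 2
        + pd u i x * (2 * η x * pd η j x)) =
        (∑ i, ∑ j, pd (pd u i) j x ^ 2) * η x ^ 2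
        + ∑ j, 2 * gradReg u τ x * pd (gradReg u τ) j x * η x * pd η j x := by
      simp only [mul_add, Finset.sum_add_distrib, Finset.sum_mul]
      congr 1
      · exact Finset.sum_congr rfl fun i _ => Finset.sum_congr rfl fun j _ => by ring
      · rw [Finset.sum_comm]
        refine Finset.sum_congr rfl fun j _ => ?_
        rw [show 2 * gradReg u τ x * pd (gradReg u τ) j x * η x * pd η j x =
          gradReg u τ x * pd (gradReg u τ) j x * (2 * η x * pd η j x) by ring,
          gradReg_mul_pd hu hτ, Finset.sum_mul]
        exact Finset.sum_congr rfl fun i _ => by ring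
    rw [e, hessDefect, sub_mul, gradSq]
    have e2 : gradReg u τ x ^ 2 * ∑ i, pd η i x ^ 2
        + (∑ j, pd (gradReg u τ) j x ^ 2) * η x ^ 2 =
        ∑ j, (pd (gradReg u τ) j x * η x + gradReg u τ x * pd η j x) ^ 2
        - ∑ j, 2 * gradReg u τ x * pd (gradReg u τ) j x * η x * pd η j x := by
      rw [Finset.mul_sum, Finset.sum_mul, ← Finset.sum_add_distrib, ← Finset.sum_sub_distrib]
      exact Finset.sum_congr rfl fun i _ => by ring
    linear_combination e2
  rw [key, integral_sub i1 i2]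
  linarith

/-- A trace inequality for `A ↦ |A|² - |An|²` with `|n| ≤ 1`. -/
theorem sq_trace_sub_le {n : Fin N → ℝ} (hn : ∑ i, n i ^ 2 ≤ 1) (H : Fin N → Fin N → ℝ) :
    (∑ i, H i i - ∑ j, (∑ i, n i * H i j) * n j) ^ 2 ≤
      N * (∑ i, ∑ j, H i j ^ 2 - ∑ j, (∑ i, n i * H i j) ^ 2) := by
  rcases Nat.eq_zero_or_pos N with rfl | hN
  · simp
  have hN' : (0 : ℝ) < N := by exact_mod_cast hN
  set t := ∑ i, H i i - ∑ j, (∑ i, n i * H i j) * n j with ht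
  set l := t / N with hl
  have hcs : ∑ j, (∑ i, n i * (H i j - if i = j then l else 0)) ^ 2 ≤
      ∑ j, ∑ i, (H i j - if i = j then l else 0) ^ 2 := by
    refine Finset.sum_le_sum fun j _ => ?_
    calc _ ≤ (∑ i, n i ^ 2) * ∑ i, (H i j - if i = j then l else 0) ^ 2 :=
          Finset.sum_mul_sq_le_sq_mul_sq _ _ _
      _ ≤ 1 * _ := by gcongr
      _ = _ := one_mul _
  have e1 : ∑ j, (∑ i, n i * (H i j - if i = j then l else 0)) ^ 2 =
      ∑ j, (∑ i, n i * H i j) ^ 2 - 2 * l * ∑ j, (∑ i, n i * H i j) * n j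
        + l ^ 2 * ∑ j, n j ^ 2 := by
    simp only [mul_sub, Finset.sum_sub_distrib, mul_ite, mul_zero, Finset.sum_ite_eq',
      Finset.mem_univ, if_true]
    rw [Finset.mul_sum, Finset.mul_sum, ← Finset.sum_sub_distrib, ← Finset.sum_add_distrib]
    exact Finset.sum_congr rfl fun i _ => by ring
  have e2 : ∑ j, ∑ i, (H i j - if i = j then l else 0) ^ 2 =
      ∑ i, ∑ j, H i j ^ 2 - 2 * l * ∑ i, H i i + N * l ^ 2 := by
    have (i j : Fin N) : (H i j - if i = j then l else 0) ^ 2 =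
        H i j ^ 2 - (if i = j then 2 * l * H i j else 0) + if i = j then l ^ 2 else 0 := by
      split_ifs <;> ring
    simp only [this, Finset.sum_add_distrib, Finset.sum_sub_distrib, Finset.sum_ite_eq',
      Finset.mem_univ, if_true, Finset.sum_const, Finset.card_univ, Fintype.card_fin,
      nsmul_eq_mul, Finset.mul_sum]
    rw [Finset.sum_comm]
  rw [e1, e2] at hcs
  have htl : t = N * l := by rw [hl]; field_simp
  have h3 : l ^ 2 * ∑ j, n j ^ 2 ≥ 0 :=
    mul_nonneg (sq_nonneg _) (Finset.sum_nonneg fun _ _ => sq_nonneg _)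
  have h4 : N * l ^ 2 ≤ ∑ i, ∑ j, H i j ^ 2 - ∑ j, (∑ i, n i * H i j) ^ 2 := by
    have : 2 * l * t = 2 * l * (N * l) := by rw [htl]
    rw [ht] at this
    nlinarith
  calc t ^ 2 = N * (N * l ^ 2) := by rw [htl]; ring
    _ ≤ _ := by gcongr

theorem sq_lap_sub_le (hu : ContDiff ℝ 2 u) (hτ : 0 < τ) (x : EuclideanSpace ℝ (Fin N)) :
    (lap u x - (∑ j, pd u j x * pd (gradReg u τ) j x) / gradReg u τ x) ^ 2 ≤
      N * hessDefect u τ x := by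
  have hv := gradReg_pos (u := u) hτ x
  have hsq := gradReg_sq (u := u) (τ := τ) x
  have hn : ∑ i, (pd u i x / gradReg u τ x) ^ 2 ≤ 1 := by
    simp only [div_pow, ← Finset.sum_div]
    rw [div_le_one (by positivity), hsq, gradSq]
    linarith [sq_nonneg τ]
  have hm (j : Fin N) : ∑ i, pd u i x / gradReg u τ x * pd (pd u i) j x =
      pd (gradReg u τ) j x := by
    simp only [div_mul_eq_mul_div, ← Finset.sum_div]
    rw [← gradReg_mul_pd hu hτ]
    field_simp
  have := sq_trace_sub_le hn fun i j => pd (pd u i) j x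
  simp only [hm] at this
  rw [lap_eq_sum_pd hu, hessDefect, Finset.sum_div]
  convert this using 6
  ring

theorem IsStableSolution.integral_cubic_reg_le (h : IsStableSolution u F P)
    (hF0 : ∀ x, 0 ≤ F x) {G D : EuclideanSpace ℝ (Fin N) → ℝ} (hG : ContDiff ℝ 1 G)
    (hD : Continuous D) (hGD : ∀ j x, pd G j x = D x * pd u j x)
    (hG0 : ∀ x, G x ≤ 0) (hG1 : ∀ x, -1 ≤ G x) {R : ℝ} (hR : 0 < R) (hτ : 0 < τ)
    (hη : ContDiff ℝ 1 η) (hc : HasCompactSupport η) :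
    ∫ x, D x * gradSq u x * gradReg u τ x * η x ^ 2 ≤
      3 / (2 * R) * (∫ x, gradReg u τ x ^ 2 * η x ^ 2)
        + (N / 2 + 1) * R * ∫ x, gradReg u τ x ^ 2 * gradSq η x := by
  have hu := h.contDiff
  have h1 (i : Fin N) : ContDiff ℝ 1 (pd u i) := hu.pd le_rfl i
  have hv : ContDiff ℝ 1 (gradReg u τ) := contDiff_gradReg hu hτ
  have hη2 : ContDiff ℝ 1 fun y => η y ^ 2 := hη.pow 2
  have hc2 : HasCompactSupport fun y => η y ^ 2 := hc.fun_sq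
  have hV (j : Fin N) : ContDiff ℝ 1 fun y => G y * (gradReg u τ y * (pd u j y * η y ^ 2)) :=
    hG.mul (hv.mul ((h1 j).mul hη2))
  have hVc (j : Fin N) : HasCompactSupport fun y => G y * (gradReg u τ y * (pd u j y * η y ^ 2)) :=
    hc2.mul_left.mul_left.mul_left
  have hdiv := integral_div_eq_zero hV hVc
  have id : Integrable fun x => ∑ j,
      pd (fun y => G y * (gradReg u τ y * (pd u j y * η y ^ 2))) j x :=
    integrable_finsetSum _ fun j _ => integrable_of_cc (continuous_pd (hV j) j) ((hVc j).pd j)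
  have i1 : Integrable fun x => D x * gradSq u x * gradReg u τ x * η x ^ 2 :=
    integrable_of_cc (((hD.mul hu.gradSq.continuous).mul hv.continuous).mul hη2.continuous)
      hc2.mul_left
  have i2 : Integrable fun x => gradReg u τ x ^ 2 * η x ^ 2 :=
    integrable_of_cc ((hv.continuous.pow 2).mul hη2.continuous) hc2.mul_left
  have i3 : Integrable fun x => gradReg u τ x ^ 2 * gradSq η x :=
    integrable_of_cc ((hv.continuous.pow 2).mul (continuous_gradSq hη)) hc.gradSq.mul_left
  have i4 : Integrable fun x => hessDefect u τ x * η x ^ 2 :=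
    integrable_of_cc ((continuous_hessDefect hu hτ).mul hη2.continuous) hc2.mul_left
  have hSZ := h.integral_hessDefect_le hτ hη hc
  have hpt (x : EuclideanSpace ℝ (Fin N)) : D x * gradSq u x * gradReg u τ x * η x ^ 2 ≤
      ∑ j, pd (fun y => G y * (gradReg u τ y * (pd u j y * η y ^ 2))) j x +
      (3 / (2 * R) * (gradReg u τ x ^ 2 * η x ^ 2) + R * (gradReg u τ x ^ 2 * gradSq η x)
        + N / 2 * R * (hessDefect u τ x * η x ^ 2)) := by
    set v := gradReg u τ x with hvdef
    have hvpos : 0 < v := gradReg_pos hτ x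
    set t := lap u x - (∑ j, pd u j x * pd (gradReg u τ) j x) / v with ht
    have ht2 : t ^ 2 ≤ N * hessDefect u τ x := sq_lap_sub_le hu hτ x
    set s := ∑ j, pd u j x * pd η j x with hs
    have hs2 : s ^ 2 ≤ gradSq u x * gradSq η x := Finset.sum_mul_sq_le_sq_mul_sq _ _ _
    have hvs : v ^ 2 = gradSq u x + τ ^ 2 := gradReg_sq x
    have hηg : 0 ≤ gradSq η x := gradSq_nonneg x
    have hsv : |s| ≤ v * √(gradSq η x) := by
      refine abs_le_of_sq_le_sq ?_ (by positivity)
      rw [mul_pow, Real.sq_sqrt hηg, hvs]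
      nlinarith [sq_nonneg τ]
    have hdivx : ∑ j, pd (fun y => G y * (gradReg u τ y * (pd u j y * η y ^ 2))) j x =
        D x * gradSq u x * v * η x ^ 2 + G x * η x ^ 2 * (v * (2 * lap u x - t))
          + 2 * G x * v * η x * s := by
      have e1 : v * (2 * lap u x - t) = v * lap u x + ∑ j, pd u j x * pd (gradReg u τ) j x := by
        rw [ht]; field_simp; ring
      rw [e1, hs, gradSq, lap_eq_sum_pd hu]
      simp only [pd_mul hG (hv.mul ((h1 _).mul hη2)), pd_mul hv ((h1 _).mul hη2),
        pd_mul (h1 _) hη2, pd_sq hη, hGD, Finset.mul_sum, Finset.sum_mul, mul_add, ← hvdef]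
      simp only [← Finset.sum_add_distrib]
      exact Finset.sum_congr rfl fun i _ => by ring
    have hlap : lap u x ≤ 0 := by linarith [h.neg_lap_eq x, hF0 x]
    have hA : -(G x * η x ^ 2 * (v * (2 * lap u x - t))) ≤
        1 / (2 * R) * (v ^ 2 * η x ^ 2) + R / 2 * (t ^ 2 * η x ^ 2) := by
      have a1 : 0 ≤ G x * lap u x := mul_nonneg_of_nonpos_of_nonpos (hG0 x) hlap
      have a2 : G x * t ≤ |t| := by
        calc G x * t ≤ |G x * t| := le_abs_self _
          _ = |G x| * |t| := abs_mul _ _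
          _ ≤ 1 * |t| := by
            gcongr
            exact abs_le.2 ⟨hG1 x, (hG0 x).trans zero_le_one⟩
          _ = |t| := one_mul _
      have a3 : v * |t| ≤ 1 / (2 * R) * v ^ 2 + R / 2 * t ^ 2 := by
        have := sq_nonneg (v - R * |t|)
        rw [← sq_abs t]
        have e : 1 / (2 * R) * v ^ 2 + R / 2 * |t| ^ 2 - v * |t| =
          1 / (2 * R) * (v - R * |t|) ^ 2 := by field_simp; ring
        have : 0 ≤ 1 / (2 * R) * (v - R * |t|) ^ 2 := by positivity
        linarith
      have a4 : -(G x * (v * (2 * lap u x - t))) ≤ v * |t| := by nlinarith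
      nlinarith [sq_nonneg (η x)]
    have hB : -(2 * G x * v * η x * s) ≤
        1 / R * (v ^ 2 * η x ^ 2) + R * (v ^ 2 * gradSq η x) := by
      have b1 : -(2 * G x * v * η x * s) ≤ 2 * (v * |η x|) * (v * √(gradSq η x)) := by
        calc _ ≤ |-(2 * G x * v * η x * s)| := le_abs_self _
          _ = 2 * |G x| * v * |η x| * |s| := by
            simp only [abs_neg, abs_mul, abs_two, abs_of_pos hvpos]
          _ ≤ 2 * 1 * v * |η x| * (v * √(gradSq η x)) := by
            gcongr
            exact abs_le.2 ⟨hG1 x, (hG0 x).trans zero_le_one⟩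
          _ = _ := by ring
      have e : 1 / R * (v ^ 2 * |η x| ^ 2) + R * (v ^ 2 * √(gradSq η x) ^ 2)
          - 2 * (v * |η x|) * (v * √(gradSq η x)) =
          1 / R * (v * |η x| - R * (v * √(gradSq η x))) ^ 2 := by field_simp; ring
      have : 0 ≤ 1 / R * (v * |η x| - R * (v * √(gradSq η x))) ^ 2 := by positivity
      rw [sq_abs, Real.sq_sqrt hηg] at e
      linarith
    have hC : R / 2 * (t ^ 2 * η x ^ 2) ≤ N / 2 * R * (hessDefect u τ x * η x ^ 2) := by
      have : R / 2 * (t ^ 2 * η x ^ 2) ≤ R / 2 * (N * hessDefect u τ x * η x ^ 2) := by gcongr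
      linarith
    have e3 : 3 / (2 * R) = 1 / (2 * R) + 1 / R := by field_simp; norm_num
    rw [hdivx, e3]
    linarith
  have i5 : Integrable fun x =>
      3 / (2 * R) * (gradReg u τ x ^ 2 * η x ^ 2) + R * (gradReg u τ x ^ 2 * gradSq η x) :=
    (i2.const_mul _).add (i3.const_mul _)
  have i6 : Integrable fun x =>
      3 / (2 * R) * (gradReg u τ x ^ 2 * η x ^ 2) + R * (gradReg u τ x ^ 2 * gradSq η x)
        + N / 2 * R * (hessDefect u τ x * η x ^ 2) := i5.add (i4.const_mul _)
  have h_int := integral_mono i1 (id.add i6) hpt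
  simp only [Pi.add_apply] at h_int
  rw [integral_add id i6, hdiv, integral_add i5 (i4.const_mul _),
    integral_add (i2.const_mul _) (i3.const_mul _), integral_const_mul, integral_const_mul,
    integral_const_mul] at h_int
  have : N / 2 * R * ∫ x, hessDefect u τ x * η x ^ 2 ≤
    N / 2 * R * ∫ x, gradReg u τ x ^ 2 * gradSq η x := by gcongr
  linarith

/-- An integral estimate for the cube of the gradient. -/
theorem IsStableSolution.integral_cubic_le (h : IsStableSolution u F P)
    (hF0 : ∀ x, 0 ≤ F x) {G D : EuclideanSpace ℝ (Fin N) → ℝ} (hG : ContDiff ℝ 1 G)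
    (hD : Continuous D) (hD0 : ∀ x, 0 ≤ D x) (hGD : ∀ j x, pd G j x = D x * pd u j x)
    (hG0 : ∀ x, G x ≤ 0) (hG1 : ∀ x, -1 ≤ G x) {R : ℝ} (hR : 0 < R)
    (hη : ContDiff ℝ 1 η) (hc : HasCompactSupport η) :
    ∫ x, D x * √(gradSq u x) ^ 3 * η x ^ 2 ≤
      3 / (2 * R) * (∫ x, gradSq u x * η x ^ 2)
        + (N / 2 + 1) * R * ∫ x, gradSq u x * gradSq η x := by
  have hu := h.contDiff
  have hη2 : Continuous fun y => η y ^ 2 := hη.continuous.pow 2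
  have hc2 : HasCompactSupport fun y => η y ^ 2 := hc.fun_sq
  have hg : Continuous (gradSq u) := hu.gradSq.continuous
  have iη : Integrable fun x => η x ^ 2 := integrable_of_cc hη2 hc2
  have iη' : Integrable fun x => gradSq η x := integrable_of_cc (continuous_gradSq hη) hc.gradSq
  have i1 : Integrable fun x => gradSq u x * η x ^ 2 :=
    integrable_of_cc (hg.mul hη2) hc2.mul_left
  have i2 : Integrable fun x => gradSq u x * gradSq η x :=
    integrable_of_cc (hg.mul (continuous_gradSq hη)) hc.gradSq.mul_left
  have hτ (τ : ℝ) (hτ : 0 < τ) : ∫ x, D x * √(gradSq u x) ^ 3 * η x ^ 2 ≤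
      3 / (2 * R) * ((∫ x, gradSq u x * η x ^ 2) + τ ^ 2 * ∫ x, η x ^ 2)
        + (N / 2 + 1) * R * ((∫ x, gradSq u x * gradSq η x) + τ ^ 2 * ∫ x, gradSq η x) := by
    have hv : Continuous (gradReg u τ) := (contDiff_gradReg hu hτ).continuous
    refine le_trans (integral_mono ?_ ?_ fun x => ?_)
      ((h.integral_cubic_reg_le hF0 hG hD hGD hG0 hG1 hR hτ hη hc).trans_eq ?_)
    · exact integrable_of_cc ((hD.mul ((Real.continuous_sqrt.comp hg).pow 3)).mul hη2)
        hc2.mul_left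
    · exact integrable_of_cc (((hD.mul hg).mul hv).mul hη2) hc2.mul_left
    · have h3 : √(gradSq u x) ^ 3 = gradSq u x * √(gradSq u x) := by
        rw [pow_succ, Real.sq_sqrt (gradSq_nonneg x)]
      have h4 : √(gradSq u x) ≤ gradReg u τ x := Real.sqrt_le_sqrt (by linarith [sq_nonneg τ])
      have := hD0 x
      have := gradSq_nonneg (u := u) x
      simp only [h3, ← mul_assoc]
      gcongr
    · simp only [gradReg_sq, add_mul (gradSq u _)]
      rw [integral_add i1 (iη.const_mul _), integral_add i2 (iη'.const_mul _),
        integral_const_mul, integral_const_mul]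
  have hlim : Tendsto (fun τ : ℝ =>
      3 / (2 * R) * ((∫ x, gradSq u x * η x ^ 2) + τ ^ 2 * ∫ x, η x ^ 2)
        + (N / 2 + 1) * R * ((∫ x, gradSq u x * gradSq η x) + τ ^ 2 * ∫ x, gradSq η x))
      (𝓝[>] 0) (𝓝 (3 / (2 * R) * (∫ x, gradSq u x * η x ^ 2)
        + (N / 2 + 1) * R * ∫ x, gradSq u x * gradSq η x)) := by
    refine Tendsto.mono_left (Continuous.tendsto' (by fun_prop) _ _ (by simp)) nhdsWithin_le_nhds
  exact ge_of_tendsto hlim (eventually_nhdsWithin_of_forall hτ)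

end HessianEstimates

/-- A smooth cutoff equal to `1` on the ball of radius `R` and vanishing outside that of radius
`2 * R`. -/
noncomputable def cutoff {N : ℕ} (R : ℝ) (x : EuclideanSpace ℝ (Fin N)) : ℝ :=
  (⟨1, 2, one_pos, one_lt_two⟩ : ContDiffBump (0 : EuclideanSpace ℝ (Fin N))) (R⁻¹ • x)

section Cutoff

variable {N : ℕ} {R : ℝ} {g h : EuclideanSpace ℝ (Fin N) → ℝ}

theorem contDiff_cutoff {n : ℕ∞} : ContDiff ℝ n (cutoff R : EuclideanSpace ℝ (Fin N) → ℝ) :=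
  ContDiffBump.contDiff _ |>.comp (contDiff_const_smul _)

theorem cutoff_nonneg (x : EuclideanSpace ℝ (Fin N)) : 0 ≤ cutoff R x := ContDiffBump.nonneg _

theorem cutoff_le_one (x : EuclideanSpace ℝ (Fin N)) : cutoff R x ≤ 1 := ContDiffBump.le_one _

theorem cutoff_eq_one (hR : 0 < R) {x : EuclideanSpace ℝ (Fin N)} (hx : ‖x‖ ≤ R) :
    cutoff R x = 1 := by
  refine ContDiffBump.one_of_mem_closedBall _ ?_
  rw [mem_closedBall_zero_iff, norm_smul, norm_inv, Real.norm_of_nonneg hR.le]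
  exact (inv_mul_le_one₀ hR).2 hx

theorem cutoff_eq_zero (hR : 0 < R) {x : EuclideanSpace ℝ (Fin N)} (hx : 2 * R ≤ ‖x‖) :
    cutoff R x = 0 := by
  refine ContDiffBump.zero_of_le_dist _ ?_
  rw [dist_zero_right, norm_smul, norm_inv, Real.norm_of_nonneg hR.le]
  exact (le_inv_mul_iff₀ hR).2 (by linarith)

theorem hasCompactSupport_cutoff (hR : 0 < R) :
    HasCompactSupport (cutoff R : EuclideanSpace ℝ (Fin N) → ℝ) :=
  HasCompactSupport.intro (isCompact_closedBall 0 (2 * R)) fun x hx => cutoff_eq_zero hR <| by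
    rw [mem_closedBall_zero_iff, not_le] at hx
    exact hx.le

theorem pd_eventuallyConst {x : EuclideanSpace ℝ (Fin N)} {c : ℝ} (hg : ∀ᶠ y in 𝓝 x, g y = c)
    (i : Fin N) : pd g i x = 0 := by
  rw [pd, Filter.EventuallyEq.fderiv_eq (f := fun _ => c) hg]
  simp

theorem gradSq_cutoff_eq_zero (hR : 0 < R) {x : EuclideanSpace ℝ (Fin N)}
    (hx : ‖x‖ < R ∨ 2 * R < ‖x‖) : gradSq (cutoff R) x = 0 := by
  refine Finset.sum_eq_zero fun i _ => ?_
  rw [sq_eq_zero_iff]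
  rcases hx with hx | hx
  · refine pd_eventuallyConst (c := 1) ?_ i
    filter_upwards [(isOpen_lt continuous_norm continuous_const).mem_nhds hx] with y hy
    exact cutoff_eq_one hR (le_of_lt hy)
  · refine pd_eventuallyConst (c := 0) ?_ i
    filter_upwards [(isOpen_lt continuous_const continuous_norm).mem_nhds hx] with y hy
    exact cutoff_eq_zero hR (le_of_lt hy)

theorem pd_comp_smul (hg : ContDiff ℝ 1 g) (c : ℝ) (i : Fin N) (x : EuclideanSpace ℝ (Fin N)) :
    pd (fun y => g (c • y)) i x = c * pd g i (c • x) := by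
  unfold pd
  have h1 := (hg.differentiable one_ne_zero (c • x)).hasFDerivAt.comp x
    ((hasFDerivAt_id (𝕜 := ℝ) x).const_smul c)
  rw [show (fun y => g (c • y)) = g ∘ HSMul.hSMul c from rfl, h1.fderiv]
  simp

theorem exists_cutoff_bound (N : ℕ) : ∃ C > 0, ∀ R > 0, ∀ x : EuclideanSpace ℝ (Fin N),
    gradSq (cutoff R) x ≤ C / R ^ 2 ∧ ∑ i, |pd (pd (cutoff R) i) i x| ≤ C / R ^ 2 := by
  set b : ContDiffBump (0 : EuclideanSpace ℝ (Fin N)) := ⟨1, 2, one_pos, one_lt_two⟩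
  have hb : ContDiff ℝ 2 b := ContDiffBump.contDiff _ (n := 2)
  have hb1 : ContDiff ℝ 1 b := hb.of_le (by norm_num)
  have hb' (i : Fin N) : ContDiff ℝ 1 (pd b i) := hb.pd le_rfl i
  have hc : HasCompactSupport b := b.hasCompactSupport
  obtain ⟨C₁, hC₁⟩ := hc.gradSq.exists_bound_of_continuous (continuous_gradSq hb1)
  choose C₂ hC₂ using fun i : Fin N =>
    ((hc.pd i).pd i).exists_bound_of_continuous (continuous_pd (hb' i) i)
  refine ⟨max C₁ (∑ i, C₂ i) + 1, ?_, fun R hR x => ?_⟩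
  · have : 0 ≤ C₁ := (norm_nonneg _).trans (hC₁ 0)
    have := le_max_left C₁ (∑ i, C₂ i)
    linarith
  have e1 (i : Fin N) : pd (cutoff R) i = fun y => R⁻¹ * pd b i (R⁻¹ • y) :=
    funext fun y => pd_comp_smul hb1 R⁻¹ i y
  constructor
  · have : gradSq (cutoff R) x = gradSq b (R⁻¹ • x) / R ^ 2 := by
      simp only [gradSq, e1, mul_pow, ← Finset.mul_sum]
      field_simp
    rw [this]
    gcongr
    linarith [le_max_left C₁ (∑ i, C₂ i), hC₁ (R⁻¹ • x), Real.le_norm_self (gradSq b (R⁻¹ • x))]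
  · have e2 (i : Fin N) : pd (pd (cutoff R) i) i x = pd (pd b i) i (R⁻¹ • x) / R ^ 2 := by
      rw [e1, pd_const_mul, pd_comp_smul (hb' i)]
      · field_simp
      · exact (hb' i).comp (contDiff_const_smul _)
    simp only [e2, abs_div, ← Finset.sum_div]
    rw [abs_of_pos (by positivity : 0 < R ^ 2)]
    gcongr
    have : ∑ i, |pd (pd b i) i (R⁻¹ • x)| ≤ ∑ i, C₂ i :=
      Finset.sum_le_sum fun i _ => hC₂ i _
    linarith [le_max_right C₁ (∑ i, C₂ i)]

theorem lap_pow (hg : ContDiff ℝ 2 g) (k : ℕ) (x : EuclideanSpace ℝ (Fin N)) :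
    lap (fun y => g y ^ (k + 2)) x =
      g x ^ k * ((k + 2) * (k + 1) * gradSq g x + (k + 2) * g x * lap g x) := by
  have hg1 : ContDiff ℝ 1 g := hg.of_le (by norm_num)
  have hd (i : Fin N) : ContDiff ℝ 1 (pd g i) := hg.pd le_rfl i
  have e1 (m : ℕ) (i : Fin N) (y : EuclideanSpace ℝ (Fin N)) :
      pd (fun z => g z ^ (m + 1)) i y = (m + 1) * g y ^ m * pd g i y := by
    rw [pd_comp (F := fun t => t ^ (m + 1)) hg1 i y (hasDerivAt_pow (m + 1) (g y))]
    simp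
  rw [lap_eq_sum_pd (hg.pow _), lap_eq_sum_pd hg, gradSq, Finset.mul_sum, Finset.mul_sum,
    ← Finset.sum_add_distrib, Finset.mul_sum]
  refine Finset.sum_congr rfl fun i _ => ?_
  rw [show pd (fun z => g z ^ (k + 2)) i = fun y => ((k + 1 : ℕ) + 1) * g y ^ (k + 1) * pd g i y
    from funext (e1 (k + 1) i), pd_mul (contDiff_const.mul (hg1.pow _)) (hd i),
    pd_const_mul _ (hg1.pow _), e1]
  push_cast
  ring

theorem exists_lap_cutoff_pow_bound (N k : ℕ) : ∃ C > 0, ∀ R > 0,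
    ∀ x : EuclideanSpace ℝ (Fin N),
      |lap (fun y => cutoff R y ^ (k + 2)) x| ≤ C / R ^ 2 * cutoff R x ^ k := by
  obtain ⟨C, hC, hb⟩ := exists_cutoff_bound N
  refine ⟨(k + 2) * (k + 2) * C, by positivity, fun R hR x => ?_⟩
  obtain ⟨h1, h2⟩ := hb R hR x
  have hz := cutoff_nonneg (R := R) x
  have hz1 := cutoff_le_one (R := R) x
  have hl : |lap (cutoff R) x| ≤ C / R ^ 2 := by
    rw [lap_eq_sum_pd (contDiff_cutoff (n := 2))]
    exact (Finset.abs_sum_le_sum_abs _ _).trans h2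
  rw [lap_pow (contDiff_cutoff (n := 2)), abs_mul, abs_of_nonneg (pow_nonneg hz k), mul_comm]
  refine mul_le_mul_of_nonneg_right ?_ (pow_nonneg hz k)
  calc _ ≤ |(k + 2) * (k + 1) * gradSq (cutoff R) x| + |(k + 2) * cutoff R x * lap (cutoff R) x| :=
        abs_add_le _ _
    _ = (k + 2) * (k + 1) * gradSq (cutoff R) x + (k + 2) * cutoff R x * |lap (cutoff R) x| := by
        rw [abs_of_nonneg (mul_nonneg (by positivity) (gradSq_nonneg x)), abs_mul,
          abs_of_nonneg (by positivity)]
    _ ≤ (k + 2) * (k + 1) * (C / R ^ 2) + (k + 2) * 1 * (C / R ^ 2) := by gcongr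
    _ = _ := by ring

theorem integral_le_setIntegral {h : EuclideanSpace ℝ (Fin N) → ℝ} (hh : Integrable h)
    (hg : Continuous g) (h1 : ∀ x, ‖x‖ ≤ R → h x ≤ g x) (h2 : ∀ x, R < ‖x‖ → h x ≤ 0) :
    ∫ x, h x ≤ ∫ x in Metric.closedBall 0 R, g x := by
  have hi : IntegrableOn g (Metric.closedBall 0 R) :=
    hg.continuousOn.integrableOn_compact (isCompact_closedBall 0 R)
  rw [← integral_indicator measurableSet_closedBall]
  refine integral_mono hh (hi.integrable_indicator measurableSet_closedBall) fun x => ?_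
  by_cases hx : x ∈ Metric.closedBall 0 R
  · rw [Set.indicator_of_mem hx]
    exact h1 x (mem_closedBall_zero_iff.1 hx)
  · rw [Set.indicator_of_notMem hx]
    exact h2 x (by simpa using hx)

theorem setIntegral_le_integral_of_le (hh : Integrable h) (h0 : ∀ x, 0 ≤ h x)
    (hg : Continuous g) (h1 : ∀ x, ‖x‖ ≤ R → g x ≤ h x) :
    ∫ x in Metric.closedBall 0 R, g x ≤ ∫ x, h x := by
  have hi : IntegrableOn g (Metric.closedBall 0 R) :=
    hg.continuousOn.integrableOn_compact (isCompact_closedBall 0 R)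
  rw [← integral_indicator measurableSet_closedBall]
  refine integral_mono (hi.integrable_indicator measurableSet_closedBall) hh fun x => ?_
  by_cases hx : x ∈ Metric.closedBall 0 R
  · rw [Set.indicator_of_mem hx]
    exact h1 x (mem_closedBall_zero_iff.1 hx)
  · rw [Set.indicator_of_notMem hx]
    exact h0 x

theorem setIntegral_ball_mono (hg : Continuous g) (hg0 : ∀ x, 0 ≤ g x) {R' : ℝ} (hR : R ≤ R') :
    ∫ x in Metric.closedBall 0 R, g x ≤ ∫ x in Metric.closedBall 0 R', g x :=
  setIntegral_mono_set (hg.continuousOn.integrableOn_compact (isCompact_closedBall 0 R'))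
    (.of_forall hg0) (Metric.closedBall_subset_closedBall hR).eventuallyLE

theorem setIntegral_ball_le (hg : Continuous g) (hh : Continuous h)
    (hgh : ∀ x, ‖x‖ ≤ R → g x ≤ h x) :
    ∫ x in Metric.closedBall 0 R, g x ≤ ∫ x in Metric.closedBall 0 R, h x :=
  setIntegral_mono_on (hg.continuousOn.integrableOn_compact (isCompact_closedBall 0 R))
    (hh.continuousOn.integrableOn_compact (isCompact_closedBall 0 R)) measurableSet_closedBall
    fun x hx => hgh x (mem_closedBall_zero_iff.1 hx)

theorem exists_setIntegral_const (N : ℕ) : ∃ c > 0, ∀ R ≥ 0, ∀ a : ℝ,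
    ∫ _ in Metric.closedBall (0 : EuclideanSpace ℝ (Fin N)) R, a = c * R ^ N * a := by
  refine ⟨(volume (Metric.ball (0 : EuclideanSpace ℝ (Fin N)) 1)).toReal,
    ENNReal.toReal_pos (Metric.measure_ball_pos _ _ one_pos).ne' measure_ball_lt_top.ne,
    fun R hR a => ?_⟩
  rw [setIntegral_const, smul_eq_mul, Measure.real, Measure.addHaar_closedBall _ _ hR,
    ENNReal.toReal_mul, ENNReal.toReal_ofReal (by positivity), finrank_euclideanSpace_fin]
  ring

end Cutoff

section Energy

variable {N : ℕ} {u F P g : EuclideanSpace ℝ (Fin N) → ℝ} {M : ℝ}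

/-- The integral of `u` over the ball of radius `R`. -/
noncomputable def massBall (u : EuclideanSpace ℝ (Fin N) → ℝ) (R : ℝ) : ℝ :=
  ∫ x in Metric.closedBall 0 R, u x

/-- The scaled `H¹` energy of `u` on the ball of radius `R`. -/
noncomputable def energyBall (u : EuclideanSpace ℝ (Fin N) → ℝ) (R : ℝ) : ℝ :=
  ∫ x in Metric.closedBall 0 R, (gradSq u x + (R ^ 2)⁻¹ * u x ^ 2)

theorem norm_fderiv_sq (hg : ContDiff ℝ 1 g) (x : EuclideanSpace ℝ (Fin N)) :
    ‖fderiv ℝ g x‖ ^ 2 = gradSq g x := by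
  rw [gradSq, ← norm_gradient_sq hg, gradient, LinearIsometryEquiv.norm_map]

theorem exists_sobolev (hN : 3 ≤ N) : ∃ C > 0, ∀ g : EuclideanSpace ℝ (Fin N) → ℝ,
    ContDiff ℝ 1 g → HasCompactSupport g →
      ∫ x, |g x| ^ (2 * N / (N - 2) : ℝ) ≤ C * (∫ x, gradSq g x) ^ (N / (N - 2) : ℝ) := by
  have hN' : (3 : ℝ) ≤ N := by exact_mod_cast hN
  have hn : (0 : ℝ) < N - 2 := by linarith
  set C₀ := eLpNormLESNormFDerivOfEqInnerConst (volume : Measure (EuclideanSpace ℝ (Fin N)))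
    ((2 : NNReal) : ℝ)
    with hC₀
  have hp0 : (0 : ℝ) < 2 * N / (N - 2) := by positivity
  refine ⟨(C₀ : ℝ) ^ (2 * N / (N - 2) : ℝ) + 1, by positivity, fun g hg hc => ?_⟩
  set q : NNReal := ⟨2 * N / (N - 2), hp0.le⟩ with hq
  have hs := eLpNorm_le_eLpNorm_fderiv_of_eq_inner (μ := volume) hg hc (p := 2) (p' := q)
    (by norm_num) (by rw [finrank_euclideanSpace_fin]; omega) (by
      rw [finrank_euclideanSpace_fin]
      rw [show (q : ℝ) = 2 * N / (N - 2) from rfl, NNReal.coe_inv, NNReal.coe_ofNat]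
      field_simp)
  have hm1 : MemLp g q := hg.continuous.memLp_of_hasCompactSupport hc
  have hm2 : MemLp (fderiv ℝ g) 2 :=
    (hg.continuous_fderiv one_ne_zero).memLp_of_hasCompactSupport (hc.fderiv (𝕜 := ℝ))
  have hq0 : (q : ℝ≥0∞) ≠ 0 := by
    rw [ENNReal.coe_ne_zero]
    exact fun h => hp0.ne' (congrArg NNReal.toReal h)
  rw [hm1.eLpNorm_eq_integral_rpow_norm hq0 ENNReal.coe_ne_top] at hs
  rw [show ((2 : NNReal) : ℝ≥0∞) = 2 from rfl, hm2.eLpNorm_eq_integral_rpow_norm two_ne_zero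
    ENNReal.ofNat_ne_top, ← ENNReal.ofReal_coe_nnreal (p := eLpNormLESNormFDerivOfEqInnerConst _ _),
    ← ENNReal.ofReal_mul (by positivity),
    ENNReal.ofReal_le_ofReal_iff (by positivity)] at hs
  simp only [ENNReal.coe_toReal, ENNReal.toReal_ofNat, Real.rpow_two, norm_fderiv_sq hg,
    Real.norm_eq_abs] at hs
  rw [show (q : ℝ) = 2 * N / (N - 2) from rfl] at hs
  set A := ∫ x, |g x| ^ (2 * N / (N - 2) : ℝ) with hA
  have hA0 : 0 ≤ A := integral_nonneg fun x => by positivity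
  set B := ∫ x, gradSq g x with hB
  have hB0 : 0 ≤ B := integral_nonneg fun x => gradSq_nonneg x
  have := Real.rpow_le_rpow (by positivity) hs hp0.le
  rw [Real.rpow_inv_rpow hA0 hp0.ne', Real.mul_rpow (by positivity) (by positivity),
    ← Real.rpow_mul hB0] at this
  rw [show (2 : ℝ)⁻¹ * (2 * N / (N - 2)) = N / (N - 2) by field_simp] at this
  refine this.trans ?_
  gcongr
  linarith

theorem gradSq_mul_le (hg : ContDiff ℝ 1 g) (hu : ContDiff ℝ 1 u) (x : EuclideanSpace ℝ (Fin N)) :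
    gradSq (fun y => g y * u y) x ≤ 2 * (u x ^ 2 * gradSq g x) + 2 * (g x ^ 2 * gradSq u x) := by
  simp only [gradSq, pd_mul hg hu, Finset.mul_sum]
  rw [← Finset.sum_add_distrib]
  refine Finset.sum_le_sum fun i _ => ?_
  nlinarith [sq_nonneg (pd g i x * u x - g x * pd u i x)]

theorem energyBall_nonneg (R : ℝ) : 0 ≤ energyBall u R :=
  integral_nonneg fun x => by
    have := gradSq_nonneg (u := u) x
    positivity

theorem continuous_energy (hu : ContDiff ℝ 1 u) (R : ℝ) :
    Continuous fun x => gradSq u x + (R ^ 2)⁻¹ * u x ^ 2 :=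
  (continuous_gradSq hu).add (continuous_const.mul (hu.continuous.pow 2))

theorem exists_sobolev_ball (hN : 3 ≤ N) (hu : ContDiff ℝ 1 u) (hu0 : ∀ x, 0 ≤ u x) :
    ∃ C > 0, ∀ R > 0, ∫ x in Metric.closedBall 0 R, u x ^ (2 * N / (N - 2) : ℝ) ≤
      C * energyBall u (2 * R) ^ (N / (N - 2) : ℝ) := by
  have hN' : (3 : ℝ) ≤ N := by exact_mod_cast hN
  have hn : (0 : ℝ) < N - 2 := by linarith
  have hp0 : (0 : ℝ) < 2 * N / (N - 2) := by positivity
  obtain ⟨C, hC, hS⟩ := exists_sobolev hN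
  obtain ⟨D, hD, hb⟩ := exists_cutoff_bound N
  refine ⟨C * (2 + 8 * D) ^ (N / (N - 2) : ℝ), by positivity, fun R hR => ?_⟩
  have hz : ContDiff ℝ 1 (cutoff R : EuclideanSpace ℝ (Fin N) → ℝ) := contDiff_cutoff (n := 1)
  have hzc := hasCompactSupport_cutoff (N := N) hR
  have h1 := hS (fun y => cutoff R y * u y) (hz.mul hu) hzc.mul_right
  have hl : ∫ x in Metric.closedBall 0 R, u x ^ (2 * N / (N - 2) : ℝ) ≤
      ∫ x, |cutoff R x * u x| ^ (2 * N / (N - 2) : ℝ) := by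
    refine setIntegral_le_integral_of_le (integrable_of_cc ?_ ?_) (fun x => by positivity) ?_ ?_
    · exact (hz.mul hu).continuous.abs.rpow_const fun x => Or.inr hp0.le
    · exact (hzc.mul_right (f' := u)).comp_left (g := fun t : ℝ => |t| ^ (2 * N / (N - 2) : ℝ))
        (by rw [abs_zero, Real.zero_rpow hp0.ne'])
    · exact hu.continuous.rpow_const fun x => Or.inr hp0.le
    · intro x hx
      rw [cutoff_eq_one hR hx, one_mul, abs_of_nonneg (hu0 x)]
  have hr : ∫ x, gradSq (fun y => cutoff R y * u y) x ≤ (2 + 8 * D) * energyBall u (2 * R) := by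
    rw [energyBall, ← integral_const_mul]
    refine integral_le_setIntegral (integrable_of_cc (continuous_gradSq (hz.mul hu))
      (HasCompactSupport.gradSq hzc.mul_right)) (continuous_const.mul (continuous_energy hu _))
      (fun x _ => ?_) fun x hx => ?_
    · refine (gradSq_mul_le hz hu x).trans ?_
      have hg := gradSq_nonneg (u := u) x
      have e0 := (hb R hR x).1
      have e1 := mul_le_mul_of_nonneg_left e0 (sq_nonneg (u x))
      have e2 : cutoff R x ^ 2 * gradSq u x ≤ 1 * gradSq u x := by
        gcongr
        exact pow_le_one₀ (cutoff_nonneg x) (cutoff_le_one x)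
      have e3 : (2 + 8 * D) * (gradSq u x + ((2 * R) ^ 2)⁻¹ * u x ^ 2) =
          2 * (u x ^ 2 * (D / R ^ 2)) + 2 * gradSq u x + 8 * D * gradSq u x
            + (2 * (((2 * R) ^ 2)⁻¹ * u x ^ 2)) := by
        field_simp
        ring
      have e4 : 0 ≤ 8 * D * gradSq u x + (2 * (((2 * R) ^ 2)⁻¹ * u x ^ 2)) := by positivity
      linarith
    · refine (gradSq_mul_le hz hu x).trans ?_
      rw [gradSq_cutoff_eq_zero hR (Or.inr hx), cutoff_eq_zero hR hx.le]
      simp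
  calc _ ≤ _ := hl
    _ ≤ _ := h1
    _ ≤ C * ((2 + 8 * D) * energyBall u (2 * R)) ^ (N / (N - 2) : ℝ) := by
      have : 0 ≤ ∫ x, gradSq (fun y => cutoff R y * u y) x :=
        integral_nonneg fun x => gradSq_nonneg x
      gcongr
    _ = _ := by
      rw [Real.mul_rpow (by positivity) (energyBall_nonneg _)]
      ring

theorem exists_integral_source_cutoff_le (hu : ContDiff ℝ 2 u) (hu0 : ∀ x, 0 ≤ u x) (k : ℕ) :
    ∃ C > 0, ∀ R > 0, ∫ x, -lap u x * cutoff R x ^ (k + 2) ≤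
      C / R ^ 2 * ∫ x in Metric.closedBall 0 (2 * R), u x * cutoff R x ^ k := by
  obtain ⟨C, hC, hb⟩ := exists_lap_cutoff_pow_bound N k
  refine ⟨C, hC, fun R hR => ?_⟩
  have hz : ContDiff ℝ 2 (cutoff R : EuclideanSpace ℝ (Fin N) → ℝ) := contDiff_cutoff (n := 2)
  have hzc : HasCompactSupport fun y : EuclideanSpace ℝ (Fin N) => cutoff R y ^ (k + 2) :=
    (hasCompactSupport_cutoff hR).comp_left (g := fun t : ℝ => t ^ (k + 2)) (by simp)
  have hlc : ∀ x : EuclideanSpace ℝ (Fin N), 2 * R < ‖x‖ →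
      lap (fun y => cutoff R y ^ (k + 2)) x = 0 := fun x hx => by
    rw [lap_pow hz, gradSq_cutoff_eq_zero hR (Or.inr hx), cutoff_eq_zero hR hx.le]
    simp
  rw [integral_lap_mul hu (hz.pow _) hzc, ← integral_neg, ← integral_const_mul]
  refine integral_le_setIntegral ((integrable_of_cc (hu.continuous.mul
    (continuous_lap (hz.pow _))) ?_).neg) ?_ ?_ ?_
  · refine HasCompactSupport.intro (isCompact_closedBall 0 (2 * R)) fun x hx => ?_
    rw [mem_closedBall_zero_iff, not_le] at hx
    rw [Pi.mul_apply, hlc x hx, mul_zero]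
  · exact continuous_const.mul (hu.continuous.mul (hz.continuous.pow k))
  · intro x _
    have := mul_le_mul_of_nonneg_left ((neg_le_abs _).trans (hb R hR x)) (hu0 x)
    linarith
  · intro x hx
    rw [hlc x hx]
    simp

theorem exists_integral_source_le (hu : ContDiff ℝ 2 u) (hu0 : ∀ x, 0 ≤ u x) :
    ∃ C > 0, ∀ R > 0, ∫ x, -lap u x * cutoff R x ^ 2 ≤ C / R ^ 2 * massBall u (2 * R) := by
  obtain ⟨C, hC, h⟩ := exists_integral_source_cutoff_le hu hu0 0
  refine ⟨C, hC, fun R hR => ?_⟩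
  simpa [massBall] using h R hR

theorem massBall_le (hu : Continuous u) (hM : ∀ x, u x ≤ M) :
    ∃ c > 0, ∀ R ≥ 0, massBall u R ≤ c * R ^ N * M := by
  obtain ⟨c, hc, h⟩ := exists_setIntegral_const N
  refine ⟨c, hc, fun R hR => ?_⟩
  rw [← h R hR]
  exact setIntegral_ball_le hu continuous_const fun x _ => hM x

/-- Caccioppoli-type growth bound for the energy of a bounded superharmonic function. -/
theorem exists_energyBall_le (hu : ContDiff ℝ 2 u) (hu0 : ∀ x, 0 ≤ u x) (hM : ∀ x, u x ≤ M)
    (hl : ∀ x, 0 ≤ -lap u x) : ∃ C > 0, ∀ R > 0, R ^ 2 * energyBall u R ≤ C * R ^ N := by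
  have hM0 : 0 ≤ M := (hu0 0).trans (hM 0)
  have hu1 : ContDiff ℝ 1 u := hu.of_le (by norm_num)
  obtain ⟨C, hC, h1⟩ := exists_integral_source_le hu hu0
  obtain ⟨c, hc, h2⟩ := massBall_le hu.continuous hM
  obtain ⟨D, hD, hb⟩ := exists_cutoff_bound N
  obtain ⟨c', hc', h3⟩ := exists_setIntegral_const N
  refine ⟨2 * M * (C * (c * 2 ^ N * M)) + 4 * M ^ 2 * (c' * 2 ^ N * D) + c' * M ^ 2 + 1,
    by positivity, fun R hR => ?_⟩
  have hz : ContDiff ℝ 1 (cutoff R : EuclideanSpace ℝ (Fin N) → ℝ) := contDiff_cutoff (n := 1)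
  have hzc := hasCompactSupport_cutoff (N := N) hR
  have hg := continuous_gradSq hu1
  have i1 : Integrable fun x => gradSq u x * cutoff R x ^ 2 :=
    integrable_of_cc (hg.mul (hz.continuous.pow 2)) hzc.fun_sq.mul_left
  have i2 : Integrable fun x => -lap u x * cutoff R x ^ 2 :=
    integrable_of_cc ((continuous_lap hu).neg.mul (hz.continuous.pow 2)) hzc.fun_sq.mul_left
  have i3 : Integrable fun x : EuclideanSpace ℝ (Fin N) => gradSq (cutoff R) x :=
    integrable_of_cc (continuous_gradSq hz) hzc.gradSq
  have hφ : ContDiff ℝ 1 fun y => u y * cutoff R y ^ 2 := hu1.mul (hz.pow 2)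
  have hφc : HasCompactSupport fun y => u y * cutoff R y ^ 2 := hzc.fun_sq.mul_left
  have hw := integral_grad_mul_grad hu hφ hφc
  have i4 : Integrable fun x => ∑ j, pd u j x * pd (fun y => u y * cutoff R y ^ 2) j x :=
    integrable_finsetSum _ fun j _ => integrable_of_cc
      ((continuous_pd hu1 j).mul (continuous_pd hφ j)) (hφc.pd j).mul_left
  have i5 : Integrable fun x => -lap u x * (u x * cutoff R x ^ 2) :=
    integrable_of_cc ((continuous_lap hu).neg.mul hφ.continuous) hφc.mul_left
  have e1 : (1 / 2) * ∫ x, gradSq u x * cutoff R x ^ 2 ≤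
      (∫ x, ∑ j, pd u j x * pd (fun y => u y * cutoff R y ^ 2) j x)
        + 2 * M ^ 2 * ∫ x : EuclideanSpace ℝ (Fin N), gradSq (cutoff R) x := by
    rw [← integral_const_mul, ← integral_const_mul, ← integral_add i4 (i3.const_mul _)]
    refine integral_mono (i1.const_mul _) (i4.add (i3.const_mul _)) fun x => ?_
    have hu2 : u x ^ 2 ≤ M ^ 2 := by
      have := hu0 x
      gcongr
      exact hM x
    have h5 := mul_le_mul_of_nonneg_right hu2 (gradSq_nonneg (u := cutoff R) x)
    simp only [pd_mul hu1 (hz.pow 2), pd_sq hz]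
    have : 1 / 2 * (gradSq u x * cutoff R x ^ 2) ≤ ∑ j, pd u j x * (pd u j x * cutoff R x ^ 2
        + u x * (2 * cutoff R x * pd (cutoff R) j x)) + 2 * (u x ^ 2 * gradSq (cutoff R) x) := by
      simp only [gradSq, Finset.sum_mul, Finset.mul_sum, ← Finset.sum_add_distrib]
      refine Finset.sum_le_sum fun j _ => ?_
      nlinarith [sq_nonneg (pd u j x * cutoff R x + 2 * u x * pd (cutoff R) j x)]
    linarith
  have e2 : ∫ x, -lap u x * (u x * cutoff R x ^ 2) ≤ M * ∫ x, -lap u x * cutoff R x ^ 2 := by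
    rw [← integral_const_mul]
    refine integral_mono i5 (i2.const_mul _) fun x => ?_
    have := mul_le_mul_of_nonneg_right (hM x) (mul_nonneg (hl x) (sq_nonneg (cutoff R x)))
    linarith
  have e3 : ∫ x : EuclideanSpace ℝ (Fin N), gradSq (cutoff R) x ≤
      c' * (2 * R) ^ N * (D / R ^ 2) := by
    rw [← h3 (2 * R) (by positivity)]
    refine integral_le_setIntegral i3 continuous_const (fun x _ => (hb R hR x).1) fun x hx => ?_
    rw [gradSq_cutoff_eq_zero hR (Or.inr hx)]
  have e4 : ∫ x in Metric.closedBall 0 R, gradSq u x ≤ ∫ x, gradSq u x * cutoff R x ^ 2 := by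
    refine setIntegral_le_integral_of_le i1 (fun x => ?_) hg fun x hx => ?_
    · exact mul_nonneg (gradSq_nonneg x) (sq_nonneg _)
    · rw [cutoff_eq_one hR hx]
      simp
  have e5 : energyBall u R ≤ (∫ x in Metric.closedBall 0 R, gradSq u x)
      + c' * R ^ N * ((R ^ 2)⁻¹ * M ^ 2) := by
    have i6 : IntegrableOn (fun x => gradSq u x) (Metric.closedBall 0 R) :=
      hg.continuousOn.integrableOn_compact (isCompact_closedBall 0 R)
    have i7 : IntegrableOn (fun x => (R ^ 2)⁻¹ * u x ^ 2) (Metric.closedBall 0 R) :=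
      (continuous_const.mul (hu.continuous.pow 2)).continuousOn.integrableOn_compact
        (isCompact_closedBall 0 R)
    rw [energyBall, integral_add i6 i7, ← h3 R hR.le]
    refine add_le_add_right (setIntegral_ball_le (continuous_const.mul (hu.continuous.pow 2))
      continuous_const fun x _ => ?_) _
    have := hu0 x
    show (R ^ 2)⁻¹ * u x ^ 2 ≤ _
    gcongr
    exact hM x
  have e6 := (h1 R hR).trans (mul_le_mul_of_nonneg_left (h2 (2 * R) (by positivity))
    (by positivity))
  have e7 := mul_le_mul_of_nonneg_left e6 hM0
  have e8 := mul_le_mul_of_nonneg_left e3 (by positivity : 0 ≤ 2 * M ^ 2)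
  have e9 : energyBall u R ≤ 2 * (M * (C / R ^ 2 * (c * (2 * R) ^ N * M)))
      + 2 * (2 * M ^ 2 * (c' * (2 * R) ^ N * (D / R ^ 2))) + c' * R ^ N * ((R ^ 2)⁻¹ * M ^ 2) := by
    linarith
  calc R ^ 2 * energyBall u R ≤ R ^ 2 * (2 * (M * (C / R ^ 2 * (c * (2 * R) ^ N * M)))
      + 2 * (2 * M ^ 2 * (c' * (2 * R) ^ N * (D / R ^ 2)))
      + c' * R ^ N * ((R ^ 2)⁻¹ * M ^ 2)) := by gcongr
    _ = (2 * M * (C * (c * 2 ^ N * M)) + 4 * M ^ 2 * (c' * 2 ^ N * D) + c' * M ^ 2) * R ^ N := by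
      rw [mul_pow]
      field_simp
      ring
    _ ≤ _ := mul_le_mul_of_nonneg_right (by linarith) (by positivity)

end Energy

section Profile

variable {k γ t : ℝ}

theorem le_mul_sqrt_cube_add {S a : ℝ} (hS : 0 ≤ S) (ha : 0 < a) :
    S ≤ a * √S ^ 3 + (a ^ 2)⁻¹ := by
  have h0 := Real.sqrt_nonneg S
  have h1 := Real.sq_sqrt hS
  rcases le_total 1 (a * √S) with h | h
  · have : 0 ≤ (a ^ 2)⁻¹ := by positivity
    nlinarith [mul_le_mul_of_nonneg_right h hS]
  · have h2 : S ≤ (a ^ 2)⁻¹ := by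
      rw [← one_div, le_div_iff₀ (by positivity)]
      nlinarith [mul_nonneg ha.le h0]
    have : 0 ≤ a * √S ^ 3 := by positivity
    linarith

theorem sq_le_add_rpow (hk : 0 < k) (hγ : 0 < γ) (ht : 0 ≤ t) :
    t ^ 2 ≤ k ^ 2 * t + t ^ 2 * (t / k ^ 2) ^ γ := by
  rcases le_total t (k ^ 2) with h | h
  · have : 0 ≤ t ^ 2 * (t / k ^ 2) ^ γ := by positivity
    nlinarith
  · have h1 : 1 ≤ (t / k ^ 2) ^ γ :=
      Real.one_le_rpow ((one_le_div (by positivity)).2 h) hγ.le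
    nlinarith [mul_nonneg (sq_nonneg k) ht, mul_le_mul_of_nonneg_left h1 (sq_nonneg t)]

theorem rpow_weight_eq (hk : 0 < k) (hγ : 0 < γ) (ht : 0 ≤ t) :
    t ^ 2 * (t / k ^ 2) ^ γ = k ^ (-(2 * γ)) * t ^ (γ + 2) := by
  rw [Real.div_rpow ht (by positivity), ← Real.rpow_natCast k 2, ← Real.rpow_mul hk.le,
    Real.rpow_add_of_nonneg ht hγ.le (by norm_num), Real.rpow_neg hk.le]
  norm_num
  ring

/-- The derivative of the bounded profile `t ↦ -(1 + √t / k) ^ (-γ)`. -/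
noncomputable def profileDeriv (k γ t : ℝ) : ℝ :=
  γ * (1 + √t / k) ^ (-γ - 1) / (2 * k * √t)

theorem profileDeriv_pos (hk : 0 < k) (hγ : 0 < γ) (ht : 0 < t) : 0 < profileDeriv k γ t := by
  have := Real.sqrt_pos.2 ht
  unfold profileDeriv
  positivity

theorem hasDerivAt_profile (hk : 0 < k) (ht : 0 < t) :
    HasDerivAt (fun s => -(1 + √s / k) ^ (-γ)) (profileDeriv k γ t) t := by
  have h0 := Real.sqrt_pos.2 ht
  have h1 : HasDerivAt (fun s => 1 + √s / k) (1 / (2 * √t) / k) t :=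
    ((Real.hasDerivAt_sqrt ht.ne').div_const k).const_add 1
  have h2 := (h1.rpow_const (p := -γ) (Or.inl (by positivity))).neg
  refine h2.congr_deriv ?_
  unfold profileDeriv
  field_simp

theorem inv_profileDeriv_sq_le (hk : 0 < k) (hγ : 0 < γ) (ht : 0 < t) :
    (profileDeriv k γ t ^ 2)⁻¹ ≤
      4 / γ ^ 2 * 2 ^ (2 * γ + 2) * (k ^ 2 * t + t ^ 2 * (t / k ^ 2) ^ γ) := by
  have h0 := Real.sqrt_pos.2 ht
  set s := √t / k with hs
  have hs0 : 0 < s := by positivity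
  have hs2 : s ^ 2 = t / k ^ 2 := by rw [hs, div_pow, Real.sq_sqrt ht.le]
  have h1 : (profileDeriv k γ t ^ 2)⁻¹ = 4 / γ ^ 2 * (k ^ 2 * t * (1 + s) ^ (2 * γ + 2)) := by
    have e : (1 + s) ^ (2 * γ + 2) = (((1 + s) ^ (-γ - 1)) ^ 2)⁻¹ := by
      rw [← Real.rpow_natCast, ← Real.rpow_mul (by positivity), ← Real.rpow_neg (by positivity)]
      congr 1
      push_cast
      ring
    have h3 : (0 : ℝ) < (1 + s) ^ (-γ - 1) := by positivity
    rw [e, profileDeriv, ← hs]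
    have := Real.sq_sqrt ht.le
    field_simp
    rw [this]
    ring
  have h2 : (1 + s) ^ (2 * γ + 2) ≤ 2 ^ (2 * γ + 2) * (1 + s ^ (2 * γ + 2)) := by
    rcases le_total s 1 with h | h
    · have h4 : (1 + s) ^ (2 * γ + 2) ≤ 2 ^ (2 * γ + 2) := by
        gcongr
        linarith
      have h5 : (0 : ℝ) < 2 ^ (2 * γ + 2) * s ^ (2 * γ + 2) := by positivity
      linarith
    · have h4 : (1 + s) ^ (2 * γ + 2) ≤ (2 * s) ^ (2 * γ + 2) := by
        gcongr
        linarith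
      rw [Real.mul_rpow (by norm_num) hs0.le] at h4
      have h5 : (0 : ℝ) < 2 ^ (2 * γ + 2) := by positivity
      linarith
  have h6 : k ^ 2 * t * s ^ (2 * γ + 2) = t ^ 2 * (t / k ^ 2) ^ γ := by
    rw [show 2 * γ + 2 = 2 * (γ + 1) by ring, Real.rpow_mul hs0.le, Real.rpow_two, hs2,
      Real.rpow_add (by positivity), Real.rpow_one]
    field_simp
  rw [h1]
  calc 4 / γ ^ 2 * (k ^ 2 * t * (1 + s) ^ (2 * γ + 2))
      ≤ 4 / γ ^ 2 * (k ^ 2 * t * (2 ^ (2 * γ + 2) * (1 + s ^ (2 * γ + 2)))) := by gcongr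
    _ = 4 / γ ^ 2 * 2 ^ (2 * γ + 2) * (k ^ 2 * t + k ^ 2 * t * s ^ (2 * γ + 2)) := by ring
    _ = _ := by rw [h6]

end Profile

section EnergyMass

variable {N : ℕ} {u F P : EuclideanSpace ℝ (Fin N) → ℝ} {M : ℝ}

/-- The cubic estimate applied to the bounded profile of a positive solution. -/
theorem IsStableSolution.exists_profile_le (h : IsStableSolution u F P)
    (hF0 : ∀ x, 0 ≤ F x) (hu0 : ∀ x, 0 < u x) : ∃ C > 0, ∀ R > 0, ∀ k > 0, ∀ γ > 0,
    ∫ x in Metric.closedBall 0 R, profileDeriv k γ (u x) * √(gradSq u x) ^ 3 ≤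
      C / R * energyBall u (2 * R) := by
  obtain ⟨C, hC, hb⟩ := exists_cutoff_bound N
  refine ⟨3 / 2 + (N / 2 + 1) * C, by positivity, fun R hR k hk γ hγ => ?_⟩
  have hu1 : ContDiff ℝ 1 u := h.contDiff.of_le (by norm_num)
  have hsq : ContDiff ℝ 1 fun x => √(u x) := hu1.sqrt fun x => (hu0 x).ne'
  have h1s : ∀ x, 1 + √(u x) / k ≠ 0 := fun x => by positivity
  have hD0 : ∀ x, 0 < profileDeriv k γ (u x) := fun x => profileDeriv_pos hk hγ (hu0 x)
  have hG : ContDiff ℝ 1 fun x => -(1 + √(u x) / k) ^ (-γ) :=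
    ((contDiff_const.add (hsq.div_const k)).rpow_const_of_ne h1s).neg
  have hD : Continuous fun x => profileDeriv k γ (u x) := by
    unfold profileDeriv
    refine Continuous.div (continuous_const.mul
      ((continuous_const.add (hsq.continuous.div_const k)).rpow_const fun x => Or.inl (h1s x)))
      (continuous_const.mul hsq.continuous) fun x => ?_
    have := Real.sqrt_pos.2 (hu0 x)
    positivity
  have hz : ContDiff ℝ 1 (cutoff (N := N) R) := contDiff_cutoff (n := 1)
  have hzc := hasCompactSupport_cutoff (N := N) hR
  have hcub := h.integral_cubic_le hF0 hG hD (fun x => (hD0 x).le)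
    (fun j x => pd_comp hu1 j x (hasDerivAt_profile hk (hu0 x)))
    (fun x => by rw [neg_nonpos]; positivity)
    (fun x => by
      rw [neg_le_neg_iff]
      refine Real.rpow_le_one_of_one_le_of_nonpos ?_ (by linarith)
      have : 0 ≤ √(u x) / k := by positivity
      linarith) hR hz hzc
  have hg := continuous_gradSq hu1
  have hgs : Continuous fun x => √(gradSq u x) ^ 3 := (Real.continuous_sqrt.comp hg).pow 3
  have e1 : ∫ x in Metric.closedBall 0 R, profileDeriv k γ (u x) * √(gradSq u x) ^ 3 ≤
      ∫ x, profileDeriv k γ (u x) * √(gradSq u x) ^ 3 * cutoff R x ^ 2 := by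
    refine setIntegral_le_integral_of_le
      (integrable_of_cc ((hD.mul hgs).mul (hz.continuous.pow 2)) hzc.fun_sq.mul_left)
      (fun x => ?_) (hD.mul hgs) fun x hx => ?_
    · have := (hD0 x).le
      positivity
    · rw [cutoff_eq_one hR hx]
      simp
  have e2 : ∫ x in Metric.closedBall 0 (2 * R), gradSq u x ≤ energyBall u (2 * R) :=
    setIntegral_ball_le hg (continuous_energy hu1 _) fun x _ =>
      le_add_of_nonneg_right (by positivity)
  have e3 : ∫ x, gradSq u x * cutoff R x ^ 2 ≤ ∫ x in Metric.closedBall 0 (2 * R), gradSq u x := by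
    refine integral_le_setIntegral
      (integrable_of_cc (hg.mul (hz.continuous.pow 2)) hzc.fun_sq.mul_left) hg
      (fun x _ => ?_) fun x hx => ?_
    · exact mul_le_of_le_one_right (gradSq_nonneg x)
        (pow_le_one₀ (cutoff_nonneg x) (cutoff_le_one x))
    · rw [cutoff_eq_zero hR hx.le]
      simp
  have e4 : ∫ x, gradSq u x * gradSq (cutoff R) x ≤
      ∫ x in Metric.closedBall 0 (2 * R), C / R ^ 2 * gradSq u x := by
    refine integral_le_setIntegral
      (integrable_of_cc (hg.mul (continuous_gradSq hz)) hzc.gradSq.mul_left)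
      (continuous_const.mul hg) (fun x _ => ?_) fun x hx => ?_
    · rw [mul_comm]
      exact mul_le_mul_of_nonneg_right (hb R hR x).1 (gradSq_nonneg x)
    · rw [gradSq_cutoff_eq_zero hR (Or.inr hx), mul_zero]
  rw [integral_const_mul] at e4
  calc _ ≤ 3 / (2 * R) * energyBall u (2 * R)
        + (N / 2 + 1) * R * (C / R ^ 2 * energyBall u (2 * R)) := by
        refine e1.trans (hcub.trans ?_)
        gcongr
        · exact e3.trans e2
        · refine e4.trans ?_
          gcongr
    _ = _ := by
      field_simp

theorem IsStableSolution.exists_energyBall_le_add (h : IsStableSolution u F P) (hN : 3 ≤ N)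
    (hF0 : ∀ x, 0 ≤ F x) (hu0 : ∀ x, 0 < u x) : ∃ C > 0, ∀ R > 0, ∀ k > 0, ∀ θ > 0, θ ≤ 1 →
    energyBall u R ≤ C * θ * energyBall u (2 * R) + C / θ ^ 2 / R ^ 2 * (k ^ 2 * massBall u R
      + k ^ (-(2 * (4 / (N - 2) : ℝ))) * energyBall u (2 * R) ^ (N / (N - 2) : ℝ)) := by
  have hN' : (3 : ℝ) ≤ N := by exact_mod_cast hN
  have hn : (0 : ℝ) < N - 2 := by linarith
  have hu1 : ContDiff ℝ 1 u := h.contDiff.of_le (by norm_num)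
  obtain ⟨C₁, hC₁, h1⟩ := h.exists_profile_le hF0 hu0
  obtain ⟨C₂, hC₂, h2⟩ := exists_sobolev_ball hN hu1 fun x => (hu0 x).le
  set γ : ℝ := 4 / (N - 2) with hγ
  have hγ0 : 0 < γ := by positivity
  set c : ℝ := 4 / γ ^ 2 * 2 ^ (2 * γ + 2) with hc
  have hc0 : 0 < c := by positivity
  have hexp : (2 * N / (N - 2) : ℝ) = γ + 2 := by
    rw [hγ]
    field_simp
    ring
  refine ⟨C₁ + (c + 1) * (1 + C₂), by positivity, fun R hR k hk θ hθ hθ1 => ?_⟩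
  have hD0 : ∀ x, 0 < profileDeriv k γ (u x) := fun x => profileDeriv_pos hk hγ0 (hu0 x)
  have hD : Continuous fun x => profileDeriv k γ (u x) := by
    have hsq : Continuous fun x => √(u x) := Real.continuous_sqrt.comp hu1.continuous
    have h1s : ∀ x, 1 + √(u x) / k ≠ 0 := fun x => by positivity
    unfold profileDeriv
    refine Continuous.div (continuous_const.mul
      ((continuous_const.add (hsq.div_const k)).rpow_const fun x => Or.inl (h1s x)))
      (continuous_const.mul hsq) fun x => ?_
    have := Real.sqrt_pos.2 (hu0 x)
    positivity
  have hg := continuous_gradSq hu1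
  have hgs : Continuous fun x => √(gradSq u x) ^ 3 := (Real.continuous_sqrt.comp hg).pow 3
  have hpc : Continuous fun x => u x ^ (γ + 2) :=
    hu1.continuous.rpow_const fun x => Or.inl (hu0 x).ne'
  have c1 : Continuous fun x => θ * R * (profileDeriv k γ (u x) * √(gradSq u x) ^ 3) :=
    continuous_const.mul (hD.mul hgs)
  have c2 : Continuous fun x => (c + 1) / θ ^ 2 / R ^ 2 * (k ^ 2 * u x) :=
    continuous_const.mul (continuous_const.mul hu1.continuous)
  have c3 : Continuous fun x => (c + 1) / θ ^ 2 / R ^ 2 * (k ^ (-(2 * γ)) * u x ^ (γ + 2)) :=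
    continuous_const.mul (continuous_const.mul hpc)
  have c12 : Continuous fun x => θ * R * (profileDeriv k γ (u x) * √(gradSq u x) ^ 3)
      + (c + 1) / θ ^ 2 / R ^ 2 * (k ^ 2 * u x) := c1.add c2
  have key : energyBall u R ≤ ∫ x in Metric.closedBall 0 R,
      (θ * R * (profileDeriv k γ (u x) * √(gradSq u x) ^ 3)
        + (c + 1) / θ ^ 2 / R ^ 2 * (k ^ 2 * u x)
        + (c + 1) / θ ^ 2 / R ^ 2 * (k ^ (-(2 * γ)) * u x ^ (γ + 2))) := by
    refine setIntegral_ball_le (continuous_energy hu1 R) (c12.add c3) fun x _ => ?_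
    have e1 := le_mul_sqrt_cube_add (gradSq_nonneg (u := u) x)
      (mul_pos (mul_pos hθ hR) (hD0 x))
    have e2 := inv_profileDeriv_sq_le hk hγ0 (hu0 x)
    have e3 := sq_le_add_rpow hk hγ0 (hu0 x).le
    rw [rpow_weight_eq hk hγ0 (hu0 x).le] at e2 e3
    set T := k ^ 2 * u x + k ^ (-(2 * γ)) * u x ^ (γ + 2) with hT
    have hT0 : 0 ≤ T := (sq_nonneg _).trans e3
    have e4 : ((θ * R * profileDeriv k γ (u x)) ^ 2)⁻¹ ≤ c / θ ^ 2 / R ^ 2 * T := by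
      rw [mul_pow, mul_pow, mul_inv, mul_inv]
      calc _ ≤ (θ ^ 2)⁻¹ * (R ^ 2)⁻¹ * (c * T) := by gcongr
        _ = _ := by ring
    have e5 : (R ^ 2)⁻¹ * u x ^ 2 ≤ 1 / θ ^ 2 / R ^ 2 * T := by
      rw [div_eq_inv_mul (1 / θ ^ 2), mul_assoc]
      gcongr
      have : 1 ≤ 1 / θ ^ 2 := by
        rw [one_le_div (by positivity)]
        exact pow_le_one₀ hθ.le hθ1
      nlinarith
    have e6 : c / θ ^ 2 / R ^ 2 * T + 1 / θ ^ 2 / R ^ 2 * T =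
        (c + 1) / θ ^ 2 / R ^ 2 * (k ^ 2 * u x)
          + (c + 1) / θ ^ 2 / R ^ 2 * (k ^ (-(2 * γ)) * u x ^ (γ + 2)) := by
      rw [hT]
      ring
    linarith
  have io : ∀ {g : EuclideanSpace ℝ (Fin N) → ℝ}, Continuous g →
      IntegrableOn g (Metric.closedBall 0 R) := fun hg =>
    hg.continuousOn.integrableOn_compact (isCompact_closedBall 0 R)
  rw [integral_add (io c12) (io c3), integral_add (io c1) (io c2),
    integral_const_mul, integral_const_mul, integral_const_mul, integral_const_mul,
    integral_const_mul] at key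
  have f1 := h1 R hR k hk γ hγ0
  have f2 := h2 R hR
  rw [hexp] at f2
  have hW := energyBall_nonneg (u := u) (2 * R)
  have hI : 0 ≤ massBall u R := integral_nonneg fun x => (hu0 x).le
  set W := energyBall u (2 * R) with hWd
  set X := W ^ (N / (N - 2) : ℝ) with hX
  have hX0 : 0 ≤ X := by positivity
  have hcC : 0 < (c + 1) * C₂ := by positivity
  have k1 : C₁ ≤ C₁ + (c + 1) * (1 + C₂) := by linarith
  have k2 : c + 1 ≤ C₁ + (c + 1) * (1 + C₂) := by linarith
  have k3 : (c + 1) * C₂ ≤ C₁ + (c + 1) * (1 + C₂) := by linarith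
  set K := C₁ + (c + 1) * (1 + C₂) with hK
  calc energyBall u R ≤ θ * R * (C₁ / R * W) + (c + 1) / θ ^ 2 / R ^ 2 * (k ^ 2 * massBall u R)
        + (c + 1) / θ ^ 2 / R ^ 2 * (k ^ (-(2 * γ)) * (C₂ * X)) := by
        refine key.trans ?_
        unfold massBall
        gcongr
    _ = C₁ * θ * W + (c + 1) / θ ^ 2 / R ^ 2 * (k ^ 2 * massBall u R)
        + (c + 1) * C₂ / θ ^ 2 / R ^ 2 * (k ^ (-(2 * γ)) * X) := by
        field_simp
    _ ≤ K * θ * W + K / θ ^ 2 / R ^ 2 * (k ^ 2 * massBall u R)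
        + K / θ ^ 2 / R ^ 2 * (k ^ (-(2 * γ)) * X) := by gcongr
    _ = _ := by ring

end EnergyMass

section Doubling

variable {N : ℕ} {u F P : EuclideanSpace ℝ (Fin N) → ℝ} {M : ℝ}

theorem setIntegral_ball_pos {g : EuclideanSpace ℝ (Fin N) → ℝ} (hg : Continuous g)
    (h0 : ∀ x, 0 < g x) {R : ℝ} (hR : 0 < R) : 0 < ∫ x in Metric.closedBall 0 R, g x := by
  obtain ⟨c, hc, h3⟩ := exists_setIntegral_const N
  obtain ⟨y, -, hy⟩ := (isCompact_closedBall (0 : EuclideanSpace ℝ (Fin N)) R).exists_isMinOn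
    ⟨0, Metric.mem_closedBall_self hR.le⟩ hg.continuousOn
  have h1 : ∫ _ in Metric.closedBall (0 : EuclideanSpace ℝ (Fin N)) R, g y ≤
      ∫ x in Metric.closedBall 0 R, g x :=
    setIntegral_ball_le continuous_const hg fun x hx => hy (mem_closedBall_zero_iff.2 hx)
  rw [h3 R hR.le] at h1
  have := h0 y
  exact lt_of_lt_of_le (by positivity) h1

theorem energyBall_pos (hu : ContDiff ℝ 1 u) (hu0 : ∀ x, 0 < u x) {R : ℝ} (hR : 0 < R) :
    0 < energyBall u R :=
  setIntegral_ball_pos (continuous_energy hu R) (fun x => by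
    have := hu0 x
    have := gradSq_nonneg (u := u) x
    positivity) hR

theorem IsStableSolution.exists_energyBall_le_massBall_sq (h : IsStableSolution u F P)
    (hN : 3 ≤ N) (hF0 : ∀ x, 0 ≤ F x) (hu0 : ∀ x, 0 < u x) {Δ : ℝ} (hΔ : 0 < Δ) :
    ∃ C > 0, ∀ R > 0, energyBall u (2 * R) ≤ Δ * energyBall u R →
      R ^ (N + 2) * energyBall u R ≤ C * massBall u R ^ 2 := by
  have hN' : (3 : ℝ) ≤ N := by exact_mod_cast hN
  have hn : (0 : ℝ) < N - 2 := by linarith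
  obtain ⟨C, hC, hW⟩ := h.exists_energyBall_le_add hN hF0 hu0
  set γ : ℝ := 4 / (N - 2) with hγ
  have hγ0 : 0 < γ := by positivity
  set θ : ℝ := 1 / (4 * C * Δ + 1) with hθ
  have hθ0 : 0 < θ := by positivity
  have hCΔ : 0 < C * Δ := by positivity
  have hθ1 : θ ≤ 1 := by
    rw [hθ, div_le_one (by positivity)]
    linarith
  have hθ2 : C * θ * Δ ≤ 1 / 4 := by
    rw [hθ, mul_one_div, div_mul_eq_mul_div, div_le_iff₀ (by positivity)]
    linarith
  set L : ℝ := (4 * C * Δ / θ ^ 2) ^ γ⁻¹ with hL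
  have hL0 : 0 < L := by positivity
  have hLγ : L ^ (-γ) = (4 * C * Δ / θ ^ 2)⁻¹ := by
    rw [Real.rpow_neg hL0.le, hL, Real.rpow_inv_rpow (by positivity) hγ0.ne']
  refine ⟨(2 * C / θ ^ 2 * L) ^ 2 * Δ, by positivity, fun R hR hd => ?_⟩
  have hE : 0 < energyBall u R := energyBall_pos (h.contDiff.of_le (by norm_num)) hu0 hR
  set W := energyBall u R with hWd
  have hI : 0 ≤ massBall u R := integral_nonneg fun x => (hu0 x).le
  set V := Δ * W with hV
  have hV0 : 0 < V := by positivity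
  set Y := √(V * R ^ 2 / R ^ N) with hY
  have hY0 : 0 < Y := Real.sqrt_pos.2 (by positivity)
  have hY2 : Y ^ 2 = V * R ^ 2 / R ^ N := Real.sq_sqrt (by positivity)
  obtain ⟨k, hk0, hk2⟩ : ∃ k > 0, k ^ 2 = L * Y :=
    ⟨√(L * Y), Real.sqrt_pos.2 (by positivity), Real.sq_sqrt (by positivity)⟩
  have hYγ : Y ^ (-γ) * V ^ (N / (N - 2) : ℝ) = R ^ 2 * V := by
    have e1 : Y ^ (-γ) = (Y ^ 2) ^ (-(2 / (N - 2)) : ℝ) := by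
      rw [← Real.rpow_natCast, ← Real.rpow_mul hY0.le, hγ]
      congr 1
      push_cast
      ring
    have e2 : R ^ 2 / R ^ N = R ^ (-(N - 2) : ℝ) := by
      rw [← Real.rpow_natCast, ← Real.rpow_natCast, ← Real.rpow_sub hR]
      congr 1
      push_cast
      ring
    rw [e1, hY2, mul_div_assoc, e2, Real.mul_rpow hV0.le (by positivity), ← Real.rpow_mul hR.le,
      show (-(N - 2) * -(2 / (N - 2)) : ℝ) = 2 by field_simp, Real.rpow_two, mul_right_comm,
      ← Real.rpow_add hV0, show (-(2 / (N - 2)) + N / (N - 2) : ℝ) = 1 by field_simp; ring,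
      Real.rpow_one, mul_comm]
  have e3 : k ^ (-(2 * γ)) * V ^ (N / (N - 2) : ℝ) =
      (4 * C * Δ / θ ^ 2)⁻¹ * (R ^ 2 * V) := by
    rw [show -(2 * γ) = 2 * -γ by ring, Real.rpow_mul hk0.le, Real.rpow_two, hk2,
      Real.mul_rpow hL0.le hY0.le, mul_assoc, hYγ, hLγ]
  have e4 := hW R hR k hk0 θ hθ0 hθ1
  have e5 : W ≤ C * θ * V + C / θ ^ 2 / R ^ 2 * (L * Y * massBall u R
      + (4 * C * Δ / θ ^ 2)⁻¹ * (R ^ 2 * V)) := by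
    rw [← e3, ← hk2]
    have := energyBall_nonneg (u := u) (2 * R)
    refine e4.trans ?_
    gcongr
  have e6 : C / θ ^ 2 / R ^ 2 * ((4 * C * Δ / θ ^ 2)⁻¹ * (R ^ 2 * V)) = W / 4 := by
    rw [hV]
    field_simp
  have e7 : C * θ * V ≤ W / 4 := by
    have := mul_le_mul_of_nonneg_right hθ2 hE.le
    rw [hV]
    linarith
  have e8 : W ≤ 2 * C / θ ^ 2 * L * (Y * massBall u R / R ^ 2) := by
    have : C / θ ^ 2 / R ^ 2 * (L * Y * massBall u R) * 2 =
      2 * C / θ ^ 2 * L * (Y * massBall u R / R ^ 2) := by ring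
    linarith
  have e9 : W ^ 2 ≤ (2 * C / θ ^ 2 * L) ^ 2 * (V * R ^ 2 / R ^ N * massBall u R ^ 2 / R ^ 4) := by
    calc W ^ 2 ≤ (2 * C / θ ^ 2 * L * (Y * massBall u R / R ^ 2)) ^ 2 := by gcongr
      _ = (2 * C / θ ^ 2 * L) ^ 2 * (Y ^ 2 * massBall u R ^ 2 / R ^ 4) := by ring
      _ = _ := by rw [hY2]
  have e10 : W * (R ^ (N + 2) * W) ≤ W * ((2 * C / θ ^ 2 * L) ^ 2 * Δ * massBall u R ^ 2) := by
    calc W * (R ^ (N + 2) * W) = R ^ (N + 2) * W ^ 2 := by ring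
      _ ≤ R ^ (N + 2) * ((2 * C / θ ^ 2 * L) ^ 2
          * (V * R ^ 2 / R ^ N * massBall u R ^ 2 / R ^ 4)) := by gcongr
      _ = _ := by
        rw [hV, pow_add]
        field_simp
  exact le_of_mul_le_mul_left e10 hE

theorem exists_energyBall_doubling (hN : 1 ≤ N) (hu : ContDiff ℝ 2 u) (hu0 : ∀ x, 0 < u x)
    (hM : ∀ x, u x ≤ M) (hl : ∀ x, 0 ≤ -lap u x) (R₀ : ℝ) :
    ∃ R ≥ R₀, 0 < R ∧ energyBall u (2 * R) ≤ 2 ^ (N - 1) * energyBall u R := by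
  obtain ⟨C, hC, hb⟩ := exists_energyBall_le hu (fun x => (hu0 x).le) hM hl
  by_contra! hcon
  set r := max R₀ 1 with hr
  have hr1 : 1 ≤ r := le_max_right _ _
  have hr0 : 0 < r := by linarith
  have hW := energyBall_pos (hu.of_le (by norm_num : (1 : WithTop ℕ∞) ≤ 2)) hu0 hr0
  have hj : ∀ j : ℕ, (2 ^ (N - 1)) ^ j * energyBall u r ≤ energyBall u (2 ^ j * r) := by
    intro j
    induction j with
    | zero => simp
    | succ j ih =>
      have h1 : r ≤ 2 ^ j * r := le_mul_of_one_le_left hr0.le (one_le_pow₀ (by norm_num))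
      have h2 := hcon (2 ^ j * r) ((le_max_left _ _).trans h1) (by positivity)
      rw [pow_succ' 2 j, mul_assoc 2, pow_succ']
      refine le_trans ?_ h2.le
      rw [mul_assoc]
      gcongr
  obtain ⟨j, hj'⟩ := pow_unbounded_of_one_lt (C * r ^ N / (r ^ 2 * energyBall u r))
    (one_lt_two : (1 : ℝ) < 2)
  rw [div_lt_iff₀ (by positivity)] at hj'
  have h1 := hb (2 ^ j * r) (by positivity)
  have h2 : (2 ^ j * r) ^ 2 * ((2 ^ (N - 1)) ^ j * energyBall u r) ≤ C * (2 ^ j * r) ^ N :=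
    le_trans (by gcongr; exact hj j) h1
  have h3 : (2 ^ j * r) ^ 2 * ((2 ^ (N - 1)) ^ j * energyBall u r) =
      (2 ^ j) ^ N * (2 ^ j * (r ^ 2 * energyBall u r)) := by
    obtain ⟨m, rfl⟩ : ∃ m, N = m + 1 := ⟨N - 1, by omega⟩
    rw [Nat.add_sub_cancel, ← pow_mul, ← pow_mul]
    ring
  rw [h3, mul_pow (2 ^ j) r N, mul_left_comm C] at h2
  have := le_of_mul_le_mul_left h2 (by positivity)
  linarith

end Doubling

section Weighted

variable {N : ℕ} {u F P : EuclideanSpace ℝ (Fin N) → ℝ}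

theorem contDiff_one_add_norm_sq {n : WithTop ℕ∞} :
    ContDiff ℝ n fun x : EuclideanSpace ℝ (Fin N) => 1 + ‖x‖ ^ 2 :=
  contDiff_const.add (contDiff_norm_sq ℝ)

theorem pd_one_add_norm_sq (j : Fin N) (x : EuclideanSpace ℝ (Fin N)) :
    pd (fun y => 1 + ‖y‖ ^ 2) j x = 2 * x j := by
  unfold pd
  rw [fderiv_const_add, fderiv_norm_sq_apply]
  simp [EuclideanSpace.inner_single_right]

theorem pd_rpow_one_add_norm_sq (b : ℝ) (j : Fin N) (x : EuclideanSpace ℝ (Fin N)) :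
    pd (fun y => (1 + ‖y‖ ^ 2) ^ b) j x =
      2 * b * ((1 + ‖x‖ ^ 2) ^ b / (1 + ‖x‖ ^ 2)) * x j := by
  have hQ : 0 < 1 + ‖x‖ ^ 2 := by positivity
  rw [pd_comp contDiff_one_add_norm_sq j x (Real.hasDerivAt_rpow_const (Or.inl hQ.ne')),
    pd_one_add_norm_sq, Real.rpow_sub hQ, Real.rpow_one]
  ring

theorem sq_sum_mul_le (c d : Fin N → ℝ) : (∑ j, c j * d j) ^ 2 ≤ (∑ j, c j ^ 2) * ∑ j, d j ^ 2 :=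
  Finset.sum_mul_sq_le_sq_mul_sq _ _ _

/-- The pointwise inequality behind the weighted gradient estimate: `a` is the decay rate of the
weight, `r` the squared radius, `w` the radial derivative, `S` the squared gradient. -/
theorem weighted_main_le {n a r w S : ℝ} (han : a ≤ n) (ha2 : a ^ 2 ≤ 4 * (n + a))
    (hr : 0 ≤ r) (hw : w ^ 2 ≤ r * S) (hS : 0 ≤ S) :
    n * S / (1 + r) ≤ n * S + 2 * a * w ^ 2 / (1 + r) - a * S * r / (1 + r)
      - a ^ 2 / 4 * r * w ^ 2 / (1 + r) ^ 2 := by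
  have hQ : 0 < 1 + r := by linarith
  set ρ := r / (1 + r) with hρ
  have hρ0 : 0 ≤ ρ := by positivity
  have hρ1 : ρ ≤ 1 := by
    rw [hρ, div_le_one hQ]
    linarith
  set y := w ^ 2 / (1 + r) with hy
  have hy0 : 0 ≤ y := by positivity
  have hyS : y ≤ ρ * S := by
    rw [hy, hρ, div_mul_eq_mul_div]
    gcongr
  have e1 : n * S / (1 + r) = n * S * (1 - ρ) := by
    rw [hρ]
    field_simp
    ring
  have e2 : n * S + 2 * a * w ^ 2 / (1 + r) - a * S * r / (1 + r)
      - a ^ 2 / 4 * r * w ^ 2 / (1 + r) ^ 2 =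
      n * S + 2 * a * y - a * S * ρ - a ^ 2 / 4 * ρ * y := by
    rw [hρ, hy]
    field_simp
  rw [e1, e2]
  have hnρ : 0 ≤ ρ * S * (n - a) := mul_nonneg (by positivity) (by linarith)
  rcases le_total 0 (2 * a - a ^ 2 / 4 * ρ) with h | h
  · nlinarith [mul_nonneg h hy0]
  · have h1 : (2 * a - a ^ 2 / 4 * ρ) * (ρ * S) ≤ (2 * a - a ^ 2 / 4 * ρ) * y :=
      mul_le_mul_of_nonpos_left hyS h
    have h2 : 0 ≤ ρ * S * (n + a - a ^ 2 / 4 * ρ) := by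
      refine mul_nonneg (by positivity) ?_
      nlinarith [mul_le_mul_of_nonneg_left hρ1 (sq_nonneg a)]
    nlinarith

theorem weighted_error_le {a r w S z A B Z C : ℝ} (ha : 0 ≤ a) (hr : 0 ≤ r) (hw : w ^ 2 ≤ r * S)
    (hS : 0 ≤ S) (hz0 : 0 ≤ z) (hz1 : z ≤ 1) (hZ : 0 ≤ Z) (hA : A ^ 2 ≤ S * Z)
    (hB : B ^ 2 ≤ r * Z) (hC : r * Z ≤ C) :
    w ^ 2 * Z - a * z * w ^ 2 * B / (1 + r) + 4 * w * z * A - 2 * S * z * B ≤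
      (a + 7) * (1 + C) * S := by
  have hQ : 0 < 1 + r := by linarith
  have hC0 : 0 ≤ C := (mul_nonneg hr hZ).trans hC
  have hb : |B| ≤ 1 + C := by
    rw [abs_le]
    constructor <;> nlinarith
  have hb2 : -B ≤ 1 + C := (neg_le_abs B).trans hb
  have e1 : w ^ 2 * Z ≤ C * S := by
    calc w ^ 2 * Z ≤ r * S * Z := by gcongr
      _ = r * Z * S := by ring
      _ ≤ _ := by gcongr
  have hwQ : w ^ 2 / (1 + r) ≤ S := by
    rw [div_le_iff₀ hQ]
    nlinarith
  have e2 : -(a * z * w ^ 2 * B / (1 + r)) ≤ a * ((1 + C) * S) := by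
    calc -(a * z * w ^ 2 * B / (1 + r)) = a * (z * (w ^ 2 / (1 + r)) * -B) := by ring
      _ ≤ a * (z * (w ^ 2 / (1 + r)) * (1 + C)) := by gcongr
      _ ≤ a * (1 * S * (1 + C)) := by gcongr
      _ = _ := by ring
  have e3 : w * A ≤ (1 + C) / 2 * S + C / 2 * S := by
    have h1 : (w * A) ^ 2 ≤ C * S ^ 2 := by
      calc (w * A) ^ 2 = w ^ 2 * A ^ 2 := by ring
        _ ≤ (r * S) * (S * Z) := by gcongr
        _ = r * Z * S ^ 2 := by ring
        _ ≤ _ := by gcongr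
    refine abs_le_of_sq_le_sq' ?_ (by positivity) |>.2
    nlinarith [mul_nonneg hC0 (sq_nonneg S), sq_nonneg S, mul_nonneg (sq_nonneg C) (sq_nonneg S)]
  have e4 : 4 * w * z * A ≤ 4 * ((1 + C) * S) := by
    have h2 : w * A ≤ (1 + C) * S := by nlinarith
    have h3 : 0 ≤ (1 + C) * S := by positivity
    nlinarith [mul_le_mul_of_nonneg_left h2 hz0, mul_le_mul_of_nonneg_right hz1 h3]
  have e5 : -(2 * S * z * B) ≤ 2 * ((1 + C) * S) := by
    calc -(2 * S * z * B) = 2 * S * z * -B := by ring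
      _ ≤ 2 * S * z * (1 + C) := by gcongr
      _ ≤ 2 * S * 1 * (1 + C) := by gcongr
      _ = _ := by ring
  linarith

theorem IsStableSolution.exists_weighted_le (h : IsStableSolution u F P) {a : ℝ} (ha : 0 ≤ a)
    (han : a ≤ N - 2) (ha2 : a ^ 2 ≤ 4 * (N - 2 + a)) : ∃ C > 0, ∀ R > 0,
    ∫ x in Metric.closedBall 0 R,
        ((1 + ‖x‖ ^ 2) ^ (-(a / 4))) ^ 2 * ((N - 2) * gradSq u x / (1 + ‖x‖ ^ 2)) ≤
      C * R ^ (-a) * energyBall u (2 * R) := by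
  obtain ⟨C, hC, hb⟩ := exists_cutoff_bound N
  refine ⟨(a + 7) * (1 + 4 * C), by positivity, fun R hR => ?_⟩
  have hu1 : ContDiff ℝ 1 u := h.contDiff.of_le (by norm_num)
  set X : EuclideanSpace ℝ (Fin N) → ℝ := fun x => (1 + ‖x‖ ^ 2) ^ (-(a / 4)) with hXd
  have hX : ContDiff ℝ 1 X :=
    contDiff_one_add_norm_sq.rpow_const_of_ne fun x => by positivity
  have hX0 : ∀ x, 0 ≤ X x := fun x => by positivity
  have hz : ContDiff ℝ 1 (cutoff (N := N) R) := contDiff_cutoff (n := 1)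
  have hzc := hasCompactSupport_cutoff (N := N) hR
  have hη : ContDiff ℝ 1 fun x => X x * cutoff R x := hX.mul hz
  have hηc : HasCompactSupport fun x => X x * cutoff R x := hzc.mul_left
  have hJ := h.radial_inequality hη hηc
  set J : EuclideanSpace ℝ (Fin N) → ℝ := fun x =>
    radial u x ^ 2 * ∑ j, pd (fun x => X x * cutoff R x) j x ^ 2
      - (N - 2) * gradSq u x * (X x * cutoff R x) ^ 2
      + 4 * radial u x * (X x * cutoff R x) * ∑ j, pd u j x * pd (fun x => X x * cutoff R x) j x
      - 2 * gradSq u x * (X x * cutoff R x) * ∑ j, x j * pd (fun x => X x * cutoff R x) j x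
    with hJd
  have hg := continuous_gradSq hu1
  have hw : Continuous (radial u) := h.contDiff.radial.continuous
  have hJc : Continuous J := by
    have c1 : Continuous fun x => ∑ j, pd (fun x => X x * cutoff R x) j x ^ 2 :=
      continuous_finsetSum _ fun j _ => (continuous_pd hη j).pow 2
    have c2 : Continuous fun x => ∑ j, pd u j x * pd (fun x => X x * cutoff R x) j x :=
      continuous_finsetSum _ fun j _ => (continuous_pd hu1 j).mul (continuous_pd hη j)
    have c3 : Continuous fun x : EuclideanSpace ℝ (Fin N) =>
        ∑ j, x j * pd (fun x => X x * cutoff R x) j x :=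
      continuous_finsetSum _ fun j _ =>
        (contDiff_coord (n := 1) j).continuous.mul (continuous_pd hη j)
    have c4 : Continuous fun x => X x * cutoff R x := hη.continuous
    exact ((((hw.pow 2).mul c1).sub ((continuous_const.mul hg).mul (c4.pow 2))).add
      (((continuous_const.mul hw).mul c4).mul c2)).sub (((continuous_const.mul hg).mul c4).mul c3)
  have hpz : ∀ x : EuclideanSpace ℝ (Fin N), gradSq (cutoff R) x = 0 → ∀ j, pd (cutoff R) j x = 0 := fun x hx j => by
    have := (Finset.sum_eq_zero_iff_of_nonneg fun i _ => sq_nonneg (pd (cutoff R) i x)).1 hx j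
      (Finset.mem_univ j)
    exact pow_eq_zero_iff two_ne_zero |>.1 this
  have hJ0 : ∀ x, 2 * R < ‖x‖ → J x = 0 := fun x hx => by
    have h1 := hpz x (gradSq_cutoff_eq_zero hR (Or.inr hx))
    have h2 : ∀ j, pd (fun x => X x * cutoff R x) j x = 0 := fun j => by
      rw [pd_mul hX hz, h1, cutoff_eq_zero hR hx.le]
      simp
    simp [hJd, h2, cutoff_eq_zero hR hx.le]
  have hJi : Integrable J := integrable_of_cc hJc <|
    HasCompactSupport.intro (isCompact_closedBall 0 (2 * R)) fun x hx => hJ0 x <| by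
      rwa [mem_closedBall_zero_iff, not_le] at hx
  set T : EuclideanSpace ℝ (Fin N) → ℝ := fun x =>
    X x ^ 2 * ((N - 2) * gradSq u x / (1 + ‖x‖ ^ 2)) with hTd
  have hT0 : ∀ x, 0 ≤ T x := fun x => by
    have h1 := gradSq_nonneg (u := u) x
    have h2 : (0 : ℝ) ≤ N - 2 := ha.trans han
    positivity
  have hTc : Continuous T := (hX.continuous.pow 2).mul ((continuous_const.mul hg).div
    (contDiff_one_add_norm_sq (n := 0)).continuous fun x => by positivity)
  have hTi : Integrable fun x => T x * cutoff R x ^ 2 :=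
    integrable_of_cc (hTc.mul (hz.continuous.pow 2)) hzc.fun_sq.mul_left
  have hJT : ∀ x, J x + T x * cutoff R x ^ 2 ≤ (a + 7) * (1 + 4 * C) * R ^ (-a) * gradSq u x := by
    intro x
    have hpd : ∀ j, pd (fun x => X x * cutoff R x) j x =
        X x * pd (cutoff R) j x - a / 2 * (X x / (1 + ‖x‖ ^ 2) * cutoff R x) * x j := fun j => by
      rw [pd_mul hX hz, hXd, pd_rpow_one_add_norm_sq]
      ring
    set S := gradSq u x with hS
    have hS0 : 0 ≤ S := gradSq_nonneg x
    set Z := gradSq (cutoff R) x with hZ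
    set A := ∑ j, pd u j x * pd (cutoff R) j x with hA
    set B := ∑ j, x j * pd (cutoff R) j x with hB
    set w := radial u x with hwd
    set z := cutoff R x with hzd
    set q := 1 + ‖x‖ ^ 2 with hq
    have hq0 : 0 < q := by positivity
    have s1 : ∑ j, pd u j x * pd (fun x => X x * cutoff R x) j x =
        X x * A - a / 2 * (X x / q * z) * w := by
      rw [hA, hwd, radial, Finset.mul_sum, Finset.mul_sum, ← Finset.sum_sub_distrib]
      refine Finset.sum_congr rfl fun j _ => ?_
      rw [hpd]
      ring
    have s2 : ∑ j, x j * pd (fun x => X x * cutoff R x) j x =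
        X x * B - a / 2 * (X x / q * z) * ‖x‖ ^ 2 := by
      rw [hB, norm_sq_eq_sum, Finset.mul_sum, Finset.mul_sum, ← Finset.sum_sub_distrib]
      refine Finset.sum_congr rfl fun j _ => ?_
      rw [hpd]
      ring
    have s3 : ∑ j, pd (fun x => X x * cutoff R x) j x ^ 2 =
        X x ^ 2 * Z - 2 * X x * (a / 2 * (X x / q * z)) * B
          + (a / 2 * (X x / q * z)) ^ 2 * ‖x‖ ^ 2 := by
      rw [hB, hZ, gradSq, norm_sq_eq_sum, Finset.mul_sum, Finset.mul_sum, Finset.mul_sum,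
        ← Finset.sum_sub_distrib, ← Finset.sum_add_distrib]
      refine Finset.sum_congr rfl fun j _ => ?_
      rw [hpd]
      ring
    have hw2 : w ^ 2 ≤ ‖x‖ ^ 2 * S := by
      rw [norm_sq_eq_sum]
      exact sq_sum_mul_le _ _
    have hA2 : A ^ 2 ≤ S * Z := sq_sum_mul_le _ _
    have hB2 : B ^ 2 ≤ ‖x‖ ^ 2 * Z := by
      rw [norm_sq_eq_sum]
      exact sq_sum_mul_le _ _
    have hmain := weighted_main_le han ha2 (sq_nonneg ‖x‖) hw2 hS0
    have e1 : J x + T x * z ^ 2 = (X x * z) ^ 2 * ((N - 2) * S / q - ((N - 2) * S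
        + 2 * a * w ^ 2 / q - a * S * ‖x‖ ^ 2 / q - a ^ 2 / 4 * ‖x‖ ^ 2 * w ^ 2 / q ^ 2))
        + X x ^ 2 * (w ^ 2 * Z - a * z * w ^ 2 * B / q + 4 * w * z * A - 2 * S * z * B) := by
      have hJx : J x = w ^ 2 * ∑ j, pd (fun x => X x * cutoff R x) j x ^ 2
          - (N - 2) * S * (X x * z) ^ 2
          + 4 * w * (X x * z) * ∑ j, pd u j x * pd (fun x => X x * cutoff R x) j x
          - 2 * S * (X x * z) * ∑ j, x j * pd (fun x => X x * cutoff R x) j x := rfl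
      have hTx : T x = X x ^ 2 * ((N - 2) * S / q) := rfl
      rw [hJx, hTx, s1, s2, s3]
      ring_nf
    have e2 : J x + T x * z ^ 2 ≤
        X x ^ 2 * (w ^ 2 * Z - a * z * w ^ 2 * B / q + 4 * w * z * A - 2 * S * z * B) := by
      rw [e1]
      have := mul_nonneg (sq_nonneg (X x * z)) (sub_nonneg.2 hmain)
      linarith
    refine e2.trans ?_
    by_cases hx : ‖x‖ < R ∨ 2 * R < ‖x‖
    · have hZ0 := gradSq_cutoff_eq_zero hR hx
      have hA0 : A = 0 := Finset.sum_eq_zero fun j _ => by rw [hpz x hZ0, mul_zero]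
      have hB0 : B = 0 := Finset.sum_eq_zero fun j _ => by rw [hpz x hZ0, mul_zero]
      rw [hZ, hZ0, hA0, hB0]
      simp only [mul_zero, sub_zero, add_zero, zero_div]
      positivity
    · push Not at hx
      have hXR : X x ^ 2 ≤ R ^ (-a) := by
        have e3 : X x ^ 2 = (1 + ‖x‖ ^ 2) ^ (-(a / 2)) := by
          rw [hXd, ← Real.rpow_natCast, ← Real.rpow_mul (by positivity)]
          congr 1
          push_cast
          ring
        have e4 : R ^ (-a) = (R ^ 2) ^ (-(a / 2)) := by
          rw [← Real.rpow_natCast, ← Real.rpow_mul hR.le]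
          congr 1
          push_cast
          ring
        rw [e3, e4]
        refine Real.rpow_le_rpow_of_nonpos (by positivity) ?_ (by linarith)
        have : R ^ 2 ≤ ‖x‖ ^ 2 := by gcongr; exact hx.1
        linarith
      have hC4 : ‖x‖ ^ 2 * Z ≤ 4 * C := by
        calc ‖x‖ ^ 2 * Z ≤ (2 * R) ^ 2 * (C / R ^ 2) := by
              gcongr
              · exact gradSq_nonneg x
              · exact hx.2
              · exact (hb R hR x).1
          _ = _ := by
            field_simp
            ring
      have herr := weighted_error_le ha (sq_nonneg ‖x‖) hw2 hS0 (cutoff_nonneg (R := R) x)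
        (cutoff_le_one x) (gradSq_nonneg x) hA2 hB2 hC4
      calc _ ≤ X x ^ 2 * ((a + 7) * (1 + 4 * C) * S) := by gcongr
        _ ≤ R ^ (-a) * ((a + 7) * (1 + 4 * C) * S) := by gcongr
        _ = _ := by ring
  have f1 : ∫ x in Metric.closedBall 0 R, T x ≤ ∫ x, T x * cutoff R x ^ 2 := by
    refine setIntegral_le_integral_of_le hTi (fun x => ?_) hTc fun x hx => ?_
    · have := hT0 x
      positivity
    · rw [cutoff_eq_one hR hx]
      simp
  have f2 : ∫ x, (J x + T x * cutoff R x ^ 2) ≤ ∫ x in Metric.closedBall 0 (2 * R),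
      (a + 7) * (1 + 4 * C) * R ^ (-a) * gradSq u x := by
    refine integral_le_setIntegral (hJi.add hTi) (continuous_const.mul hg)
      (fun x _ => hJT x) fun x hx => ?_
    rw [hJ0 x hx, cutoff_eq_zero hR hx.le]
    simp
  have f3 : ∫ x in Metric.closedBall 0 (2 * R), gradSq u x ≤ energyBall u (2 * R) :=
    setIntegral_ball_le hg (continuous_energy hu1 _) fun x _ =>
      le_add_of_nonneg_right (by positivity)
  rw [integral_add hJi hTi, integral_const_mul] at f2
  have f4 : (a + 7) * (1 + 4 * C) * R ^ (-a) * ∫ x in Metric.closedBall 0 (2 * R), gradSq u x ≤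
      (a + 7) * (1 + 4 * C) * R ^ (-a) * energyBall u (2 * R) := by gcongr
  linarith

end Weighted

section Conclusion

variable {N : ℕ} {u F P : EuclideanSpace ℝ (Fin N) → ℝ} {M : ℝ}

theorem setIntegral_ball_pos_of_mem {g : EuclideanSpace ℝ (Fin N) → ℝ} (hg : Continuous g)
    (h0 : ∀ x, 0 ≤ g x) {R : ℝ} {y : EuclideanSpace ℝ (Fin N)} (hy : ‖y‖ < R) (hgy : g y ≠ 0) :
    0 < ∫ x in Metric.closedBall 0 R, g x := by
  rw [setIntegral_pos_iff_support_of_nonneg_ae (.of_forall h0)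
    (hg.continuousOn.integrableOn_compact (isCompact_closedBall 0 R))]
  have ho : IsOpen (Function.support g ∩ Metric.ball 0 R) :=
    (hg.isOpen_support).inter Metric.isOpen_ball
  exact (ho.measure_pos volume ⟨y, hgy, mem_ball_zero_iff.2 hy⟩).trans_le
    (measure_mono (Set.inter_subset_inter_right _ Metric.ball_subset_closedBall))

/-- A positive bounded stable solution with positive source cannot have a mass that decays too
fast. -/
theorem IsStableSolution.not_tendsto_massBall (h : IsStableSolution u F P) (hN : 3 ≤ N)
    (hF0 : ∀ x, 0 < F x) (hu0 : ∀ x, 0 < u x) (hM : ∀ x, u x ≤ M) {a : ℝ} (ha : 0 ≤ a)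
    (han : a ≤ N - 2) (ha2 : a ^ 2 ≤ 4 * (N - 2 + a)) :
    ¬ Tendsto (fun R : ℝ => massBall u R ^ 2 / (R ^ (N + 2) * R ^ a)) atTop (𝓝 0) := by
  intro hdec
  have hN' : (3 : ℝ) ≤ N := by exact_mod_cast hN
  have hn : (0 : ℝ) < N - 2 := by linarith
  have hu1 : ContDiff ℝ 1 u := h.contDiff.of_le (by norm_num)
  have hl : ∀ x, 0 ≤ -lap u x := fun x => by
    rw [h.neg_lap_eq]
    exact (hF0 x).le
  obtain ⟨C₁, hC₁, h1⟩ := h.exists_energyBall_le_massBall_sq hN (fun x => (hF0 x).le) hu0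
    (Δ := 2 ^ (N - 1)) (by positivity)
  obtain ⟨C₂, hC₂, h2⟩ := h.exists_weighted_le ha han ha2
  set T : EuclideanSpace ℝ (Fin N) → ℝ := fun x =>
    ((1 + ‖x‖ ^ 2) ^ (-(a / 4))) ^ 2 * ((N - 2) * gradSq u x / (1 + ‖x‖ ^ 2)) with hTd
  have hT0 : ∀ x, 0 ≤ T x := fun x => by
    have h1 := gradSq_nonneg (u := u) x
    positivity
  have hX : ContDiff ℝ 1 fun x : EuclideanSpace ℝ (Fin N) => (1 + ‖x‖ ^ 2) ^ (-(a / 4)) :=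
    contDiff_one_add_norm_sq.rpow_const_of_ne fun x => by positivity
  have hTc : Continuous T := (hX.continuous.pow 2).mul
    ((continuous_const.mul (continuous_gradSq hu1)).div
      (contDiff_one_add_norm_sq (n := 0)).continuous fun x => by positivity)
  have hTz : ∀ y, T y = 0 := by
    intro y
    by_contra hy
    have hpos := setIntegral_ball_pos_of_mem hTc hT0 (lt_add_one ‖y‖) hy
    set m := ∫ x in Metric.closedBall 0 (‖y‖ + 1), T x with hm
    have hK : 0 < C₂ * 2 ^ a * C₁ := by positivity
    obtain ⟨R₁, hR₁⟩ := (hdec.eventually (gt_mem_nhds (div_pos hpos hK))).exists_forall_of_atTop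
    obtain ⟨R, hR, hR0, hd⟩ := exists_energyBall_doubling (by omega) h.contDiff hu0 hM hl
      (max R₁ (2 * (‖y‖ + 1)))
    have e1 := h1 R hR0 hd
    have e2 := h2 (R / 2) (by positivity)
    have e3 : m ≤ ∫ x in Metric.closedBall 0 (R / 2), T x :=
      setIntegral_ball_mono hTc hT0 (by linarith [le_max_right R₁ (2 * (‖y‖ + 1))])
    have e4 := hR₁ R ((le_max_left _ _).trans hR)
    rw [mul_div_cancel₀ R two_ne_zero] at e2
    have e5 : (R / 2) ^ (-a) = 2 ^ a / R ^ a := by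
      rw [Real.rpow_neg (by positivity), Real.div_rpow hR0.le (by norm_num), inv_div]
    have e6 : energyBall u R ≤ C₁ * massBall u R ^ 2 / R ^ (N + 2) := by
      rw [le_div_iff₀ (by positivity)]
      linarith
    have e7 : m ≤ C₂ * 2 ^ a * C₁ * (massBall u R ^ 2 / (R ^ (N + 2) * R ^ a)) := by
      calc m ≤ C₂ * (R / 2) ^ (-a) * energyBall u R := e3.trans e2
        _ ≤ C₂ * (2 ^ a / R ^ a) * (C₁ * massBall u R ^ 2 / R ^ (N + 2)) := by
          rw [e5]
          gcongr
        _ = _ := by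
          field_simp
    rw [lt_div_iff₀ hK] at e4
    linarith
  have hgz : ∀ y, gradSq u y = 0 := fun y => by
    have h3 := hTz y
    simp only [hTd, mul_eq_zero, div_eq_zero_iff, pow_eq_zero_iff two_ne_zero] at h3
    have h4 : ((1 : ℝ) + ‖y‖ ^ 2) ^ (-(a / 4)) ≠ 0 := by positivity
    have h5 : (1 : ℝ) + ‖y‖ ^ 2 ≠ 0 := by positivity
    have h6 := hn.ne'
    tauto
  have hpz : ∀ i, pd u i = fun _ => 0 := fun i => funext fun y => by
    have := (Finset.sum_eq_zero_iff_of_nonneg fun i _ => sq_nonneg (pd u i y)).1 (hgz y) i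
      (Finset.mem_univ i)
    exact (pow_eq_zero_iff two_ne_zero).1 this
  have hF := hF0 0
  rw [← h.neg_lap_eq, lap_eq_sum_pd h.contDiff] at hF
  simp [hpz, pd] at hF

end Conclusion

section MaximumPrinciple

variable {N : ℕ} {u v : EuclideanSpace ℝ (Fin N) → ℝ}

theorem deriv_deriv_nonneg_of_isLocalMin {g : ℝ → ℝ} {t : ℝ} (hg : ContinuousAt g t)
    (h : IsLocalMin g t) : 0 ≤ deriv (deriv g) t := by
  by_contra! hneg
  have hmax : IsLocalMax g t := isLocalMax_of_deriv_deriv_neg hneg h.deriv_eq_zero hg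
  have heq : g =ᶠ[𝓝 t] fun _ => g t := by
    filter_upwards [h, hmax] with s h1 h2 using le_antisymm h2 h1
  have := heq.deriv.deriv.eq_of_nhds
  simp at this
  linarith

theorem hasDerivAt_line (hv : ContDiff ℝ 1 v) (i : Fin N) (p : EuclideanSpace ℝ (Fin N)) (t : ℝ) :
    HasDerivAt (fun s : ℝ => v (p + s • EuclideanSpace.single i 1))
      (pd v i (p + t • EuclideanSpace.single i 1)) t := by
  have h1 : HasDerivAt (fun s : ℝ => p + s • (EuclideanSpace.single i 1 : EuclideanSpace ℝ (Fin N)))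
      (EuclideanSpace.single i 1) t := by
    simpa using ((hasDerivAt_id t).smul_const
      (EuclideanSpace.single i 1 : EuclideanSpace ℝ (Fin N))).const_add p
  exact (hv.differentiable one_ne_zero _).hasFDerivAt.comp_hasDerivAt t h1

theorem lap_nonneg_of_isLocalMin (hv : ContDiff ℝ 2 v) {p : EuclideanSpace ℝ (Fin N)}
    (hp : IsLocalMin v p) : 0 ≤ lap v p := by
  rw [lap_eq_sum_pd hv]
  refine Finset.sum_nonneg fun i _ => ?_
  have hv1 : ContDiff ℝ 1 v := hv.of_le (by norm_num)
  set g : ℝ → ℝ := fun s => v (p + s • EuclideanSpace.single i 1) with hg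
  have hd : deriv g = fun t => pd v i (p + t • EuclideanSpace.single i 1) :=
    funext fun t => (hasDerivAt_line hv1 i p t).deriv
  have hdd : deriv (deriv g) 0 = pd (pd v i) i p := by
    rw [hd, (hasDerivAt_line (hv.pd le_rfl i) i p 0).deriv]
    simp
  rw [← hdd]
  refine deriv_deriv_nonneg_of_isLocalMin (hasDerivAt_line hv1 i p 0).continuousAt ?_
  have hc : ContinuousAt (fun s : ℝ => p + s • (EuclideanSpace.single i 1 :
      EuclideanSpace ℝ (Fin N))) 0 := by fun_prop
  have ht : Tendsto (fun s : ℝ => p + s • (EuclideanSpace.single i 1 :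
      EuclideanSpace ℝ (Fin N))) (𝓝 0) (𝓝 p) := by simpa using hc.tendsto
  filter_upwards [ht.eventually hp] with s hs
  simpa [hg] using hs

/-- The Gaussian barrier centred at `c`. -/
noncomputable def barrier (κ : ℝ) (c x : EuclideanSpace ℝ (Fin N)) : ℝ :=
  Real.exp (-κ * ∑ j, (x j - c j) ^ 2)

theorem barrier_eq (κ : ℝ) (c x : EuclideanSpace ℝ (Fin N)) :
    barrier κ c x = Real.exp (-κ * ‖x - c‖ ^ 2) := by
  rw [barrier, norm_sq_eq_sum]
  rfl

theorem contDiff_barrier {n : WithTop ℕ∞} (κ : ℝ) (c : EuclideanSpace ℝ (Fin N)) :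
    ContDiff ℝ n (barrier κ c) :=
  (contDiff_const.mul (ContDiff.sum fun j _ => ((contDiff_coord j).sub contDiff_const).pow 2)).exp

theorem pd_coord_sub (c : EuclideanSpace ℝ (Fin N)) (j i : Fin N) (x : EuclideanSpace ℝ (Fin N)) :
    pd (fun y => y j - c j) i x = if j = i then 1 else 0 := by
  rw [← pd_coord j i x]
  unfold pd
  rw [fderiv_sub_const]

theorem pd_barrier (κ : ℝ) (c : EuclideanSpace ℝ (Fin N)) (i : Fin N)
    (x : EuclideanSpace ℝ (Fin N)) :
    pd (barrier κ c) i x = (-2 * κ) * ((x i - c i) * barrier κ c x) := by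
  have h1 : ∀ j : Fin N, ContDiff ℝ 1 fun y : EuclideanSpace ℝ (Fin N) => y j - c j :=
    fun j => (contDiff_coord j).sub contDiff_const
  have h2 : ContDiff ℝ 1 fun y : EuclideanSpace ℝ (Fin N) => ∑ j, (y j - c j) ^ 2 :=
    ContDiff.sum fun j _ => (h1 j).pow 2
  have h3 : HasDerivAt (fun t => Real.exp (-κ * t)) (barrier κ c x * -κ)
      (∑ j, (x j - c j) ^ 2) := by
    simpa [barrier] using ((hasDerivAt_id (∑ j, (x j - c j) ^ 2)).const_mul (-κ)).exp
  have h4 := pd_comp h2 i x h3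
  rw [pd_sum _ fun j => (h1 j).pow 2] at h4
  simp only [pd_sq (h1 _), pd_coord_sub, mul_ite, mul_one, mul_zero, Finset.sum_ite_eq',
    Finset.mem_univ, if_true] at h4
  calc _ = _ := h4
    _ = _ := by ring

theorem lap_barrier (κ : ℝ) (c x : EuclideanSpace ℝ (Fin N)) :
    lap (barrier κ c) x = (4 * κ ^ 2 * ‖x - c‖ ^ 2 - 2 * κ * N) * barrier κ c x := by
  have h1 : ∀ j : Fin N, ContDiff ℝ 1 fun y : EuclideanSpace ℝ (Fin N) => y j - c j :=
    fun j => (contDiff_coord j).sub contDiff_const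
  rw [lap_eq_sum_pd (contDiff_barrier κ c)]
  have h2 : ∀ i, pd (pd (barrier κ c) i) i x =
      4 * κ ^ 2 * barrier κ c x * (x - c) i ^ 2 - 2 * κ * barrier κ c x := fun i => by
    rw [show pd (barrier κ c) i = fun y => (-2 * κ) * ((y i - c i) * barrier κ c y) from
      funext (pd_barrier κ c i), pd_const_mul _ ((h1 i).mul (contDiff_barrier κ c)),
      pd_mul (h1 i) (contDiff_barrier κ c), pd_barrier, pd_coord_sub, if_pos rfl]
    simp only [PiLp.sub_apply]
    ring
  simp only [h2]
  rw [Finset.sum_sub_distrib, ← Finset.mul_sum, ← norm_sq_eq_sum]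
  simp
  ring

/-- The strong maximum principle for nonnegative superharmonic functions. -/
theorem pos_of_superharmonic (hu : ContDiff ℝ 2 u) (hu0 : ∀ x, 0 ≤ u x)
    (hl : ∀ x, lap u x ≤ 0) {x₁ : EuclideanSpace ℝ (Fin N)} (hx₁ : u x₁ ≠ 0) (x) : 0 < u x := by
  by_contra! hx
  have hZ : IsClosed {z | u z = 0} := isClosed_singleton.preimage hu.continuous
  obtain ⟨y, hy, hyd⟩ := hZ.exists_infDist_eq_dist ⟨x, le_antisymm hx (hu0 x)⟩ x₁
  have hyu : u y = 0 := hy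
  set d := x₁ - y with hd
  have hd0 : 0 < ‖d‖ := by
    rw [norm_pos_iff, hd, sub_ne_zero]
    rintro rfl
    exact hx₁ hyu
  have hpos : ∀ z, ‖z - x₁‖ < ‖d‖ → 0 < u z := fun z hz => by
    refine lt_of_le_of_ne (hu0 z) fun h0 => ?_
    have h1 := Metric.infDist_le_dist_of_mem (x := x₁) (show z ∈ {z | u z = 0} from h0.symm)
    rw [hyd, dist_eq_norm, dist_comm, dist_eq_norm] at h1
    linarith
  set c := y + (2⁻¹ : ℝ) • d with hc
  have hyc : ‖y - c‖ = ‖d‖ / 2 := by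
    rw [hc, sub_add_cancel_left, norm_neg, norm_smul]
    norm_num
    ring
  have hinner : ∀ z, z ≠ y → ‖z - c‖ ≤ ‖d‖ / 2 → 0 < u z := fun z hzy hz => by
    refine hpos z ?_
    have h1 : z - c = (z - y) - (2⁻¹ : ℝ) • d := by
      rw [hc]
      abel
    have h2 : z - x₁ = (z - y) - d := by
      rw [hd]
      abel
    have h3 : 0 < ‖z - y‖ := norm_pos_iff.2 (sub_ne_zero.2 hzy)
    have h4 : ‖z - c‖ ^ 2 ≤ (‖d‖ / 2) ^ 2 := by gcongr
    rw [h1, norm_sub_sq_real, inner_smul_right, norm_smul] at h4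
    norm_num at h4
    refine lt_of_pow_lt_pow_left₀ 2 hd0.le ?_
    rw [h2, norm_sub_sq_real]
    nlinarith
  set δ := ‖d‖ / 4 with hδ
  have hδ0 : 0 < δ := by positivity
  set K := Metric.sphere y δ ∩ Metric.closedBall c (‖d‖ / 2) with hK
  obtain ⟨m, hm0, hm⟩ : ∃ m > 0, ∀ z ∈ K, m ≤ u z := by
    have hKc : IsCompact K := (isCompact_sphere y δ).inter_right Metric.isClosed_closedBall
    rcases K.eq_empty_or_nonempty with hKe | hKn
    · exact ⟨1, one_pos, fun z hz => by simp [hKe] at hz⟩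
    · obtain ⟨q, hq, hqm⟩ := hKc.exists_isMinOn hKn hu.continuous.continuousOn
      refine ⟨u q, hinner q ?_ (by simpa [dist_eq_norm] using hq.2), fun z hz => hqm hz⟩
      rintro rfl
      have := hq.1
      simp at this
      linarith
  set κ : ℝ := (N + 1) / (2 * δ ^ 2) with hκ
  have hκ0 : 0 < κ := by positivity
  set w : EuclideanSpace ℝ (Fin N) → ℝ := fun z => u z + (-m) * barrier κ c z with hw
  have hw2 : ContDiff ℝ 2 w := hu.add (contDiff_const.mul (contDiff_barrier κ c))
  have hlapw : ∀ z ∈ Metric.ball y δ, lap w z < 0 := fun z hz => by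
    have e : lap w z = lap u z - m * lap (barrier κ c) z := by
      have hb : ContDiff ℝ 2 (barrier κ c) := contDiff_barrier κ c
      have h1 : ∀ i, pd w i = fun z => pd u i z + (-m) * pd (barrier κ c) i z := fun i =>
        funext fun z => by
          unfold pd
          rw [hw, fderiv_fun_add (hu.differentiable two_ne_zero z)
            ((hb.differentiable two_ne_zero z).const_mul _),
            fderiv_const_mul (hb.differentiable two_ne_zero z)]
          simp
      have h2 : ∀ i, pd (pd w i) i z = pd (pd u i) i z + (-m) * pd (pd (barrier κ c) i) i z :=
        fun i => by
          have d1 := (hu.pd (m := 1) le_rfl i).differentiable one_ne_zero z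
          have d2 := (hb.pd (m := 1) le_rfl i).differentiable one_ne_zero z
          rw [h1]
          unfold pd at d1 d2 ⊢
          rw [fderiv_fun_add d1 (d2.const_mul _), fderiv_const_mul d2]
          simp
      rw [lap_eq_sum_pd hw2, lap_eq_sum_pd hu, lap_eq_sum_pd hb]
      simp only [h2, Finset.sum_add_distrib, ← Finset.mul_sum]
      ring
    rw [e, lap_barrier]
    have h1 : δ ≤ ‖z - c‖ := by
      have h2 : ‖y - c‖ ≤ ‖z - y‖ + ‖z - c‖ := by
        rw [← norm_neg (z - y)]
        refine le_trans (le_of_eq ?_) (norm_add_le _ _)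
        congr 1
        abel
      rw [mem_ball_iff_norm] at hz
      rw [hyc] at h2
      linarith
    have h3 : δ ^ 2 ≤ ‖z - c‖ ^ 2 := by gcongr
    have h4 : 2 * κ * N < 4 * κ ^ 2 * ‖z - c‖ ^ 2 := by
      have h5 : κ * (2 * δ ^ 2) = N + 1 := by
        rw [hκ]
        field_simp
      nlinarith [mul_le_mul_of_nonneg_left h3 (by positivity : 0 ≤ 4 * κ ^ 2)]
    have h6 : 0 < barrier κ c z := Real.exp_pos _
    have h7 := mul_pos hm0 (mul_pos (sub_pos.2 h4) h6)
    linarith [hl z]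
  have hcontra : ∀ p ∈ Metric.ball y δ, ¬ IsMinOn w (Metric.closedBall y δ) p := fun p hp hmin => by
    have := lap_nonneg_of_isLocalMin hw2
      (hmin.isLocalMin (Filter.mem_of_superset (Metric.isOpen_ball.mem_nhds hp)
        Metric.ball_subset_closedBall))
    linarith [hlapw p hp]
  obtain ⟨p, hp, hpm⟩ := (isCompact_closedBall y δ).exists_isMinOn
    ⟨y, Metric.mem_closedBall_self hδ0.le⟩ hw2.continuous.continuousOn
  rcases lt_or_eq_of_le (Metric.mem_closedBall.1 hp) with hlt | heq
  · exact hcontra p hlt hpm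
  refine hcontra y (Metric.mem_ball_self hδ0) fun z hz =>
    show w y ≤ w z from le_trans ?_ (show w p ≤ w z from hpm hz)
  have hby : barrier κ c y = Real.exp (-κ * (‖d‖ / 2) ^ 2) := by rw [barrier_eq, hyc]
  have hby0 : 0 < barrier κ c y := Real.exp_pos _
  show w y ≤ w p
  simp only [hw, hyu]
  rcases le_total ‖p - c‖ (‖d‖ / 2) with h | h
  · have h1 := hm p ⟨heq, by simpa [dist_eq_norm] using h⟩
    have h2 : barrier κ c p ≤ 1 := by
      rw [barrier_eq, Real.exp_le_one_iff]
      have : 0 ≤ κ * ‖p - c‖ ^ 2 := by positivity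
      linarith
    nlinarith
  · have h1 : barrier κ c p ≤ barrier κ c y := by
      rw [hby, barrier_eq, Real.exp_le_exp]
      have : (‖d‖ / 2) ^ 2 ≤ ‖p - c‖ ^ 2 := by gcongr
      nlinarith
    nlinarith [hu0 p]

end MaximumPrinciple

section Nonlinearity

variable {f : ℝ → ℝ}

theorem nonneg_of_continuousOn_Ici (hcont : ContinuousOn f (Set.Ici 0))
    (hpos : ∀ t : ℝ, 0 < t → 0 < f t) {t : ℝ} (ht : 0 ≤ t) : 0 ≤ f t := by
  rcases ht.eq_or_lt with rfl | ht
  · exact ge_of_tendsto ((hcont 0 Set.self_mem_Ici).mono_left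
      (nhdsWithin_mono _ Set.Ioi_subset_Ici_self)) (eventually_mem_nhdsWithin.mono
        fun t ht => (hpos t ht).le)
  · exact (hpos t ht).le

theorem ConvexOn.le_mul_deriv (hcont : ContinuousOn f (Set.Ici 0))
    (hconv : ConvexOn ℝ (Set.Ioi 0) f) (h0 : f 0 = 0) {t : ℝ} (ht : 0 < t)
    (hd : DifferentiableAt ℝ f t) : f t ≤ t * deriv f t := by
  have hlim : Tendsto f (𝓝[>] 0) (𝓝 0) := by
    have := (hcont 0 Set.self_mem_Ici).mono_left (nhdsWithin_mono _ Set.Ioi_subset_Ici_self)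
    rwa [h0] at this
  have hid : Tendsto (fun s : ℝ => s) (𝓝[>] 0) (𝓝 0) := tendsto_nhdsWithin_of_tendsto_nhds tendsto_id
  have h1 : Tendsto (fun s => f t - f s) (𝓝[>] 0) (𝓝 (f t - 0)) := tendsto_const_nhds.sub hlim
  have h2 : Tendsto (fun s => (t - s) * deriv f t) (𝓝[>] 0) (𝓝 ((t - 0) * deriv f t)) :=
    (tendsto_const_nhds.sub hid).mul tendsto_const_nhds
  have := le_of_tendsto_of_tendsto h1 h2 (by
    filter_upwards [Ioo_mem_nhdsGT ht] with s hs
    have h3 := hconv.slope_le_deriv hs.1 ht hs.2 hd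
    rw [slope_def_field, div_le_iff₀ (sub_pos.2 hs.2)] at h3
    linarith)
  simpa using this

end Nonlinearity

section Solutions

variable {N : ℕ} {u : EuclideanSpace ℝ (Fin N) → ℝ} {M : ℝ}

theorem exists_setIntegral_source_le (hu : ContDiff ℝ 2 u) (hu0 : ∀ x, 0 ≤ u x)
    (hM : ∀ x, u x ≤ M) (hl : ∀ x, lap u x ≤ 0) :
    ∃ C, ∀ R > 0, ∫ x in Metric.closedBall 0 R, -lap u x ≤ C * R ^ N / R ^ 2 := by
  obtain ⟨C, hC, h1⟩ := exists_integral_source_le hu hu0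
  obtain ⟨c, hc, h2⟩ := massBall_le hu.continuous hM
  have hl' : Continuous fun x => -lap u x := (continuous_lap hu).neg
  refine ⟨C * (c * 2 ^ N * M), fun R hR => ?_⟩
  have hz : Continuous (cutoff R : EuclideanSpace ℝ (Fin N) → ℝ) :=
    (contDiff_cutoff (n := 1)).continuous
  have hi : Integrable fun x => -lap u x * cutoff R x ^ 2 :=
    integrable_of_cc (hl'.mul (hz.pow 2)) ((hasCompactSupport_cutoff hR).fun_sq.mul_left)
  have h3 : ∫ x in Metric.closedBall 0 R, -lap u x ≤ ∫ x, -lap u x * cutoff R x ^ 2 :=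
    setIntegral_le_integral_of_le hi (fun x => mul_nonneg (neg_nonneg.2 (hl x)) (sq_nonneg _)) hl'
      fun x hx => by rw [cutoff_eq_one hR hx]; simp
  refine h3.trans ((h1 R hR).trans ?_)
  have h4 : C / R ^ 2 * massBall u (2 * R) ≤ C / R ^ 2 * (c * (2 * R) ^ N * M) :=
    mul_le_mul_of_nonneg_left (h2 _ (by positivity)) (by positivity)
  refine h4.trans_eq ?_
  rw [mul_pow]
  ring

theorem source_zero_eq_zero {f : ℝ → ℝ} (hcont : ContinuousOn f (Set.Ici 0))
    (hmono : MonotoneOn f (Set.Ici 0)) (hpos : ∀ t : ℝ, 0 < t → 0 < f t)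
    (hu : ContDiff ℝ 2 u) (hu0 : ∀ x, 0 ≤ u x) (hM : ∀ x, u x ≤ M)
    (hsol : ∀ x, -lap u x = f (u x)) : f 0 = 0 := by
  by_contra hne
  have h0 : 0 < f 0 := (nonneg_of_continuousOn_Ici hcont hpos le_rfl).lt_of_ne' hne
  have hfx : ∀ x, f 0 ≤ -lap u x := fun x => by
    rw [hsol]
    exact hmono Set.self_mem_Ici (hu0 x) (hu0 x)
  obtain ⟨C, hC⟩ := exists_setIntegral_source_le hu hu0 hM fun x => by linarith [hfx x]
  obtain ⟨c, hc, h1⟩ := exists_setIntegral_const N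
  have h2 : ∀ R > 0, c * f 0 ≤ C / R ^ 2 := fun R hR => by
    have h3 := (h1 R hR.le (f 0)).symm.le.trans ((setIntegral_ball_le continuous_const
      (continuous_lap hu).neg fun x _ => hfx x).trans (hC R hR))
    refine le_of_mul_le_mul_right ?_ (pow_pos hR N)
    calc _ = c * R ^ N * f 0 := by ring
      _ ≤ _ := h3
      _ = _ := by ring
  have h3 : Tendsto (fun R : ℝ => C / R ^ 2) atTop (𝓝 0) :=
    tendsto_const_nhds.div_atTop (tendsto_pow_atTop two_ne_zero)
  have := ge_of_tendsto h3 ((eventually_gt_atTop 0).mono h2)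
  nlinarith [mul_pos hc h0]

theorem isStableSolution_comp {f : ℝ → ℝ} (hC2 : ContDiffOn ℝ 2 f (Set.Ioi 0))
    (hmono : MonotoneOn f (Set.Ici 0)) (hu : ContDiff ℝ 2 u) (hu0 : ∀ x, 0 < u x)
    (hsol : ∀ x, -lap u x = f (u x)) (hstab : Stable (deriv f) u) :
    IsStableSolution u (fun x => f (u x)) fun x => deriv f (u x) where
  contDiff := hu
  contDiff_source := contDiff_iff_contDiffAt.2 fun x =>
    ((hC2.contDiffAt (Ioi_mem_nhds (hu0 x))).of_le one_le_two).comp x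
      (hu.of_le one_le_two).contDiffAt
  continuous_weight := by
    have h1 : ContinuousOn (deriv f) (Set.Ioi 0) :=
      (hC2.deriv_of_isOpen isOpen_Ioi (m := 1) le_rfl).continuousOn
    exact h1.comp_continuous hu.continuous hu0
  weight_nonneg x := by
    rw [← derivWithin_of_mem_nhds (Ioi_mem_nhds (hu0 x))]
    exact (hmono.mono Set.Ioi_subset_Ici_self).derivWithin_nonneg
  neg_lap_eq := hsol
  pd_source i x := pd_comp (hu.of_le one_le_two) i x
    ((hC2.contDiffAt (Ioi_mem_nhds (hu0 x))).differentiableAt two_ne_zero).hasDerivAt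
  stable φ hφ hc := by
    simpa only [norm_gradient_sq hφ] using hstab φ hφ hc

end Solutions

section LowDimension

variable {N : ℕ} {u F P : EuclideanSpace ℝ (Fin N) → ℝ}

theorem sq_sum_eq_sum_sq_of_mul_eq_zero {a : ℕ → ℝ} (h : ∀ k l, k < l → a k * a l = 0) (K : ℕ) :
    (∑ k ∈ Finset.range K, a k) ^ 2 = ∑ k ∈ Finset.range K, a k ^ 2 := by
  induction K with
  | zero => simp
  | succ K ih =>
    rw [Finset.sum_range_succ, Finset.sum_range_succ, add_sq, ih, mul_assoc, Finset.sum_mul,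
      Finset.sum_eq_zero fun k hk => h k K (Finset.mem_range.1 hk)]
    ring

theorem pd_cutoff_eq_zero {R : ℝ} (hR : 0 < R) {x : EuclideanSpace ℝ (Fin N)}
    (hx : ‖x‖ < R ∨ 2 * R < ‖x‖) (i : Fin N) : pd (cutoff R) i x = 0 := by
  have := (Finset.sum_eq_zero_iff_of_nonneg fun i _ => sq_nonneg _).1
    (gradSq_cutoff_eq_zero hR hx) i (Finset.mem_univ i)
  exact pow_eq_zero_iff two_ne_zero |>.1 this

theorem pd_cutoff_mul_pd_cutoff {k l : ℕ} (hkl : k < l) (i : Fin N)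
    (x : EuclideanSpace ℝ (Fin N)) :
    pd (cutoff (4 ^ k : ℝ)) i x * pd (cutoff (4 ^ l : ℝ)) i x = 0 := by
  rcases lt_or_ge ‖x‖ (4 ^ l : ℝ) with h | h
  · rw [pd_cutoff_eq_zero (by positivity) (.inl h), mul_zero]
  · have h1 : (4 : ℝ) ^ (k + 1) ≤ 4 ^ l := pow_le_pow_right₀ (by norm_num) hkl
    have h2 : (0 : ℝ) < 4 ^ k := by positivity
    rw [pd_cutoff_eq_zero h2 (.inr (by rw [pow_succ] at h1; linarith)), zero_mul]

theorem exists_integral_gradSq_cutoff_le (hN : N ≤ 2) : ∃ D, ∀ R ≥ 1,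
    ∫ x, gradSq (cutoff R : EuclideanSpace ℝ (Fin N) → ℝ) x ≤ D := by
  obtain ⟨C, hC, h1⟩ := exists_cutoff_bound N
  obtain ⟨c, hc, h2⟩ := exists_setIntegral_const N
  refine ⟨4 * c * C, fun R hR => ?_⟩
  have hR0 : 0 < R := by linarith
  have h3 := integral_le_setIntegral (R := 2 * R)
    (integrable_of_cc (continuous_gradSq contDiff_cutoff) (hasCompactSupport_cutoff hR0).gradSq)
    (continuous_const (y := C / R ^ 2)) (fun x _ => (h1 R hR0 x).1)
    fun x hx => (gradSq_cutoff_eq_zero hR0 (.inr hx)).le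
  rw [h2 _ (by positivity)] at h3
  refine h3.trans ?_
  have h4 : (2 * R) ^ N ≤ (2 * R) ^ 2 := pow_le_pow_right₀ (by linarith) hN
  calc c * (2 * R) ^ N * (C / R ^ 2) ≤ c * (2 * R) ^ 2 * (C / R ^ 2) := by gcongr
    _ = _ := by field_simp; ring

theorem IsStableSolution.false_of_le_two (h : IsStableSolution u F P) (hN : N ≤ 2)
    (hP : ∀ x, 0 < P x) : False := by
  obtain ⟨D, hD⟩ := exists_integral_gradSq_cutoff_le hN
  have hm := setIntegral_ball_pos h.continuous_weight hP one_pos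
  set m := ∫ x in Metric.closedBall 0 1, P x
  have hz (k : ℕ) : ContDiff ℝ 1 (cutoff (4 ^ k : ℝ) : EuclideanSpace ℝ (Fin N) → ℝ) :=
    contDiff_cutoff (n := 1)
  have h4 (k : ℕ) : (0 : ℝ) < 4 ^ k := by positivity
  have h4' (k : ℕ) : (1 : ℝ) ≤ 4 ^ k := one_le_pow₀ (by norm_num)
  have key (K : ℕ) : K ^ 2 * m ≤ K * D := by
    set ψ : EuclideanSpace ℝ (Fin N) → ℝ := fun x => ∑ k ∈ Finset.range K, cutoff (4 ^ k : ℝ) x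
    have hψ : ContDiff ℝ 1 ψ := ContDiff.sum fun k _ => hz k
    have hψc : HasCompactSupport ψ := by
      refine HasCompactSupport.of_support_subset_isCompact
        (isCompact_closedBall 0 (2 * 4 ^ K)) fun x hx => ?_
      by_contra hx'
      rw [mem_closedBall_zero_iff, not_le] at hx'
      refine hx (Finset.sum_eq_zero fun k hk => cutoff_eq_zero (h4 k) ?_)
      have : (4 : ℝ) ^ k ≤ 4 ^ K :=
        pow_le_pow_right₀ (by norm_num) (Finset.mem_range.1 hk).le
      linarith
    have hg (x : EuclideanSpace ℝ (Fin N)) :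
        ∑ j, pd ψ j x ^ 2 = ∑ k ∈ Finset.range K, gradSq (cutoff (4 ^ k : ℝ)) x := by
      simp only [gradSq]
      rw [Finset.sum_comm]
      refine Finset.sum_congr rfl fun j _ => ?_
      rw [pd_sum _ fun k => hz k]
      exact sq_sum_eq_sum_sq_of_mul_eq_zero (fun k l hkl => pd_cutoff_mul_pd_cutoff hkl j x) K
    have h1 := h.stable ψ hψ hψc
    simp only [hg] at h1
    rw [integral_finsetSum _ fun k _ => integrable_of_cc (continuous_gradSq (hz k))
      (hasCompactSupport_cutoff (h4 k)).gradSq] at h1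
    have h2 : ∑ k ∈ Finset.range K, ∫ x, gradSq (cutoff (4 ^ k : ℝ) :
        EuclideanSpace ℝ (Fin N) → ℝ) x ≤ ∑ _k ∈ Finset.range K, D :=
      Finset.sum_le_sum fun k _ => hD _ (h4' k)
    rw [Finset.sum_const, Finset.card_range, nsmul_eq_mul] at h2
    have hi : Integrable fun x => P x * ψ x ^ 2 :=
      integrable_of_cc (h.continuous_weight.mul (hψ.continuous.pow 2)) hψc.fun_sq.mul_left
    have h3 : ∫ x in Metric.closedBall 0 1, K ^ 2 * P x ≤ ∫ x, P x * ψ x ^ 2 :=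
      setIntegral_le_integral_of_le hi (fun x => mul_nonneg (hP x).le (sq_nonneg _))
        (continuous_const.mul h.continuous_weight) fun x hx => by
          have : ψ x = K := by
            simp only [ψ]
            rw [Finset.sum_congr rfl fun k _ => cutoff_eq_one (h4 k) (hx.trans (h4' k))]
            simp
          rw [this, mul_comm]
    rw [integral_const_mul] at h3
    exact h3.trans (h1.trans h2)
  obtain ⟨K, hK⟩ := exists_nat_gt (max (D / m) 0)
  have hK0 : (0 : ℝ) < K := (le_max_right _ _).trans_lt hK
  have hKD := (div_lt_iff₀ hm).1 ((le_max_left _ _).trans_lt hK)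
  nlinarith [key K]

end LowDimension

section Decay

variable {N : ℕ} {u : EuclideanSpace ℝ (Fin N) → ℝ} {M : ℝ}

theorem massBall_nonneg (hu0 : ∀ x, 0 ≤ u x) (R : ℝ) : 0 ≤ massBall u R :=
  integral_nonneg hu0

theorem tendsto_massBall_div_pow {f : ℝ → ℝ} (hmono : MonotoneOn f (Set.Ici 0))
    (hpos : ∀ t : ℝ, 0 < t → 0 < f t) (hu : ContDiff ℝ 2 u) (hu0 : ∀ x, 0 < u x)
    (hM : ∀ x, u x ≤ M) (hsol : ∀ x, -lap u x = f (u x)) :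
    Tendsto (fun R : ℝ => massBall u R / R ^ N) atTop (𝓝 0) := by
  have hfx (x) : 0 < -lap u x := by rw [hsol]; exact hpos _ (hu0 x)
  obtain ⟨C, hC⟩ := exists_setIntegral_source_le hu (fun x => (hu0 x).le) hM
    fun x => by linarith [hfx x]
  obtain ⟨c, hc, h1⟩ := exists_setIntegral_const N
  have hM0 : 0 < M := (hu0 0).trans_le (hM 0)
  have hl' : Continuous fun x => -lap u x := (continuous_lap hu).neg
  have h2 (τ : ℝ) (hτ : 0 < τ) (R : ℝ) (hR : 0 < R) :
      massBall u R / R ^ N ≤ c * τ + M / f τ * C / R ^ 2 := by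
    have hfτ := hpos τ hτ
    have hx (x) : u x ≤ τ + M / f τ * -lap u x := by
      rcases le_total (u x) τ with h | h
      · have : 0 ≤ M / f τ * -lap u x := mul_nonneg (by positivity) (hfx x).le
        linarith
      · have : f τ ≤ -lap u x := by
          rw [hsol]
          exact hmono hτ.le (hτ.le.trans h) h
        have : M ≤ M / f τ * -lap u x := by
          rw [div_mul_eq_mul_div, le_div_iff₀ hfτ]
          gcongr
        linarith [hM x]
    have hi : IntegrableOn (fun x => M / f τ * -lap u x) (Metric.closedBall 0 R) :=
      (continuous_const.mul hl').continuousOn.integrableOn_compact (isCompact_closedBall 0 R)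
    have hi' : IntegrableOn (fun _ : EuclideanSpace ℝ (Fin N) => τ) (Metric.closedBall 0 R) :=
      continuous_const.continuousOn.integrableOn_compact (isCompact_closedBall 0 R)
    have h3 : massBall u R ≤ ∫ x in Metric.closedBall 0 R, (τ + M / f τ * -lap u x) :=
      setIntegral_ball_le hu.continuous (continuous_const.add (continuous_const.mul hl'))
        fun x _ => hx x
    rw [integral_add hi' hi, h1 R hR.le, integral_const_mul] at h3
    have h4 : M / f τ * ∫ x in Metric.closedBall 0 R, -lap u x ≤ M / f τ * (C * R ^ N / R ^ 2) :=
      mul_le_mul_of_nonneg_left (hC R hR) (by positivity)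
    rw [div_le_iff₀ (by positivity)]
    refine (h3.trans (add_le_add_right h4 _)).trans_eq ?_
    ring
  refine tendsto_order.2 ⟨fun b hb => ?_, fun b hb => ?_⟩
  · filter_upwards [eventually_gt_atTop 0] with R hR
    exact hb.trans_le (div_nonneg (massBall_nonneg (fun x => (hu0 x).le) R) (by positivity))
  · have hτ : 0 < b / (2 * c) := by positivity
    have h3 : Tendsto (fun R : ℝ => c * (b / (2 * c)) + M / f (b / (2 * c)) * C / R ^ 2) atTop
        (𝓝 (c * (b / (2 * c)) + 0)) :=
      tendsto_const_nhds.add (tendsto_const_nhds.div_atTop (tendsto_pow_atTop two_ne_zero))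
    have h4 : c * (b / (2 * c)) + 0 < b := by
      rw [show c * (b / (2 * c)) + 0 = b / 2 by field_simp; ring]
      linarith
    filter_upwards [h3.eventually_lt_const h4, eventually_gt_atTop 0] with R hR1 hR
    exact (h2 _ hτ R hR).trans_lt hR1

theorem exists_massBall_le_rpow {c θ : ℝ} (hc : 0 < c) (hθ : 0 < θ) (hu : ContDiff ℝ 2 u)
    (hu0 : ∀ x, 0 < u x) (hl : ∀ x, c * u x ^ (1 + θ⁻¹) ≤ -lap u x) :
    ∃ D, ∀ R > 0, massBall u R ≤ D * R ^ N / (R ^ 2) ^ θ := by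
  obtain ⟨k, hk⟩ := exists_nat_ge (2 * θ)
  obtain ⟨C, hC, h1⟩ := exists_integral_source_cutoff_le hu (fun x => (hu0 x).le) k
  obtain ⟨a, ha, h2⟩ := exists_setIntegral_const N
  have hl' : Continuous fun x => -lap u x := (continuous_lap hu).neg
  refine ⟨2 * a * 2 ^ N * (2 * C / c) ^ θ, fun R hR => ?_⟩
  have hz : Continuous (cutoff R : EuclideanSpace ℝ (Fin N) → ℝ) :=
    (contDiff_cutoff (n := 1)).continuous
  have hcu : Continuous fun x => u x ^ (1 + θ⁻¹) :=
    hu.continuous.rpow_const fun x => .inl (hu0 x).ne'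
  have hcY : Continuous fun x => u x * cutoff R x ^ k := hu.continuous.mul (hz.pow k)
  have hcX : Continuous fun x => u x ^ (1 + θ⁻¹) * cutoff R x ^ (k + 2) := hcu.mul (hz.pow _)
  set Y := ∫ x in Metric.closedBall 0 (2 * R), u x * cutoff R x ^ k with hY
  set X := ∫ x in Metric.closedBall 0 (2 * R), u x ^ (1 + θ⁻¹) * cutoff R x ^ (k + 2) with hX
  have h3 : c * X ≤ C / R ^ 2 * Y := by
    refine le_trans ?_ (h1 R hR)
    rw [hX, ← integral_const_mul]
    refine setIntegral_le_integral_of_le (integrable_of_cc (hl'.mul (hz.pow _)) ?_)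
      (fun x => ?_) (continuous_const.mul hcX) fun x _ => ?_
    · exact ((hasCompactSupport_cutoff hR).comp_left (g := fun t : ℝ => t ^ (k + 2))
        (by simp)).mul_left
    · exact mul_nonneg ((mul_nonneg hc.le (Real.rpow_nonneg (hu0 x).le _)).trans (hl x))
        (pow_nonneg (cutoff_nonneg x) _)
    · rw [← mul_assoc]
      exact mul_le_mul_of_nonneg_right (hl x) (pow_nonneg (cutoff_nonneg x) _)
  set A := C / (c * R ^ 2) with hA
  have hA0 : 0 < A := by positivity
  have h3' : X ≤ A * Y := by
    refine le_of_mul_le_mul_left (h3.trans_eq ?_) hc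
    rw [hA]
    field_simp
  set y₀ := (2 * A) ^ θ with hy₀
  have hy₀0 : 0 < y₀ := by positivity
  have h4 (x) : u x * cutoff R x ^ k ≤ y₀ + (2 * A)⁻¹ * (u x ^ (1 + θ⁻¹) * cutoff R x ^ (k + 2)) := by
    have hz0 : 0 ≤ cutoff R x := cutoff_nonneg x
    have hz1 : cutoff R x ≤ 1 := cutoff_le_one x
    have hup := Real.rpow_pos_of_pos (hu0 x) (1 + θ⁻¹)
    rcases le_or_gt (u x * cutoff R x ^ k) y₀ with h | h
    · have : 0 ≤ (2 * A)⁻¹ * (u x ^ (1 + θ⁻¹) * cutoff R x ^ (k + 2)) := by positivity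
      linarith
    · set y := u x * cutoff R x ^ k with hy
      have hy0 : 0 < y := hy₀0.trans h
      have h5 : 2 * A ≤ y ^ θ⁻¹ := by
        calc 2 * A = y₀ ^ θ⁻¹ := by rw [hy₀, Real.rpow_rpow_inv (by positivity) hθ.ne']
          _ ≤ _ := Real.rpow_le_rpow hy₀0.le h.le (by positivity)
      have h6 : y * (2 * A) ≤ u x ^ (1 + θ⁻¹) * cutoff R x ^ (k + 2) := by
        calc y * (2 * A) ≤ y * y ^ θ⁻¹ := by gcongr
          _ = y ^ (1 + θ⁻¹) := by rw [Real.rpow_add hy0, Real.rpow_one]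
          _ = u x ^ (1 + θ⁻¹) * (cutoff R x ^ k) ^ (1 + θ⁻¹) := by
            rw [hy, Real.mul_rpow (hu0 x).le (by positivity)]
          _ ≤ _ := by
            gcongr
            rcases hz0.eq_or_lt with hz0 | hz0
            · rw [← hz0] at hy
              rcases Nat.eq_zero_or_pos k with rfl | hk0
              · have : (0 : ℝ) < 2 * θ := by positivity
                simp at hk
                linarith
              · rw [zero_pow hk0.ne', mul_zero] at hy
                exact absurd hy hy0.ne'
            · rw [← Real.rpow_natCast, ← Real.rpow_natCast, ← Real.rpow_mul hz0.le]
              refine Real.rpow_le_rpow_of_exponent_ge hz0 hz1 ?_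
              have : 2 ≤ k * θ⁻¹ := by
                rw [← div_eq_mul_inv, le_div_iff₀ hθ]
                exact hk
              push_cast
              linarith
      have h7 : y ≤ (2 * A)⁻¹ * (u x ^ (1 + θ⁻¹) * cutoff R x ^ (k + 2)) := by
        rw [← div_eq_inv_mul, le_div_iff₀ (by positivity)]
        exact h6
      linarith
  have h5 : Y ≤ a * (2 * R) ^ N * y₀ + (2 * A)⁻¹ * X := by
    have hi : IntegrableOn (fun x => (2 * A)⁻¹ * (u x ^ (1 + θ⁻¹) * cutoff R x ^ (k + 2)))
        (Metric.closedBall 0 (2 * R)) :=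
      (continuous_const.mul hcX).continuousOn.integrableOn_compact (isCompact_closedBall _ _)
    have hi' : IntegrableOn (fun _ : EuclideanSpace ℝ (Fin N) => y₀)
        (Metric.closedBall 0 (2 * R)) :=
      continuous_const.continuousOn.integrableOn_compact (isCompact_closedBall _ _)
    have h6 : Y ≤ ∫ x in Metric.closedBall 0 (2 * R),
        (y₀ + (2 * A)⁻¹ * (u x ^ (1 + θ⁻¹) * cutoff R x ^ (k + 2))) :=
      setIntegral_ball_le hcY (continuous_const.add (continuous_const.mul hcX)) fun x _ => h4 x
    rwa [integral_add hi' hi, h2 _ (by positivity), integral_const_mul] at h6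
  have h6 : (2 * A)⁻¹ * X ≤ Y / 2 := by
    calc (2 * A)⁻¹ * X ≤ (2 * A)⁻¹ * (A * Y) := by gcongr
      _ = _ := by field_simp
  have h7 : massBall u R ≤ Y := by
    refine (setIntegral_ball_le hu.continuous hcY fun x hx => ?_).trans
      (setIntegral_ball_mono hcY (fun x => mul_nonneg (hu0 x).le
        (pow_nonneg (cutoff_nonneg x) _)) (by linarith))
    rw [cutoff_eq_one hR hx, one_pow, mul_one]
  have h8 : y₀ = (2 * C / c) ^ θ / (R ^ 2) ^ θ := by
    rw [hy₀, ← Real.div_rpow (by positivity) (by positivity), hA]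
    congr 1
    field_simp
  calc massBall u R ≤ 2 * (a * (2 * R) ^ N * y₀) := by linarith
    _ = _ := by rw [h8, mul_pow]; ring

theorem tendsto_massBall_of_rpow {c θ a : ℝ} (hc : 0 < c) (hθ : 0 < θ) (hu : ContDiff ℝ 2 u)
    (hu0 : ∀ x, 0 < u x) (hl : ∀ x, c * u x ^ (1 + θ⁻¹) ≤ -lap u x) (ha : N - 2 < a + 4 * θ) :
    Tendsto (fun R : ℝ => massBall u R ^ 2 / (R ^ (N + 2) * R ^ a)) atTop (𝓝 0) := by
  obtain ⟨D, hD⟩ := exists_massBall_le_rpow hc hθ hu hu0 hl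
  have h1 : Tendsto (fun R : ℝ => D ^ 2 * R ^ (-(a + 4 * θ - (N - 2)))) atTop (𝓝 (D ^ 2 * 0)) :=
    (tendsto_rpow_neg_atTop (by linarith)).const_mul _
  rw [mul_zero] at h1
  refine squeeze_zero' ?_ ?_ h1
  · filter_upwards [eventually_gt_atTop 0] with R hR
    positivity
  · filter_upwards [eventually_gt_atTop 0] with R hR
    have h2 : massBall u R ^ 2 ≤ (D * R ^ N / (R ^ 2) ^ θ) ^ 2 :=
      pow_le_pow_left₀ (massBall_nonneg (fun x => (hu0 x).le) R) (hD R hR) 2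
    rw [div_le_iff₀ (by positivity)]
    refine h2.trans_eq ?_
    have h3 : D * R ^ N / (R ^ 2) ^ θ = D * R ^ ((N : ℝ) - 2 * θ) := by
      rw [← Real.rpow_natCast R 2, ← Real.rpow_mul hR.le, Real.rpow_sub hR, Real.rpow_natCast]
      push_cast
      ring
    rw [h3, mul_pow, ← Real.rpow_natCast R (N + 2), ← Real.rpow_natCast (R ^ ((N : ℝ) - 2 * θ)) 2,
      ← Real.rpow_mul hR.le, ← Real.rpow_add hR, mul_assoc, ← Real.rpow_add hR]
    congr 2
    push_cast
    ring

theorem tendsto_massBall_of_div_pow (h : Tendsto (fun R : ℝ => massBall u R / R ^ N) atTop (𝓝 0)) :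
    Tendsto (fun R : ℝ => massBall u R ^ 2 / (R ^ (N + 2) * R ^ ((N : ℝ) - 2))) atTop (𝓝 0) := by
  have h1 := h.pow 2
  rw [zero_pow two_ne_zero] at h1
  refine h1.congr' ?_
  filter_upwards [eventually_gt_atTop 0] with R hR
  have h2 : R ^ (N + 2) * R ^ ((N : ℝ) - 2) = (R ^ N) ^ 2 := by
    rw [Real.rpow_sub hR, Real.rpow_natCast, ← Nat.cast_ofNat (R := ℝ), Real.rpow_natCast]
    field_simp
    ring
  rw [div_pow, h2]

end Decay

section PowerLowerBound

variable {f : ℝ → ℝ} {β : ℝ}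

theorem hasDerivAt_of_contDiffOn_Ioi (hC2 : ContDiffOn ℝ 2 f (Set.Ioi 0)) {t : ℝ} (ht : 0 < t) :
    HasDerivAt f (deriv f t) t ∧ HasDerivAt (deriv f) (deriv (deriv f) t) t :=
  ⟨((hC2.contDiffAt (Ioi_mem_nhds ht)).differentiableAt two_ne_zero).hasDerivAt,
    (((hC2.deriv_of_isOpen isOpen_Ioi (m := 1) le_rfl).contDiffAt
      (Ioi_mem_nhds ht)).differentiableAt one_ne_zero).hasDerivAt⟩

theorem mul_deriv_le_of_mul_deriv_deriv_le (hC2 : ContDiffOn ℝ 2 f (Set.Ioi 0))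
    (hpos : ∀ t : ℝ, 0 < t → 0 < f t) (hd : ∀ t : ℝ, 0 < t → 0 < deriv f t) {δ : ℝ}
    (h : ∀ t ∈ Set.Ioo 0 δ, f t * deriv (deriv f) t ≤ β * deriv f t ^ 2) {t : ℝ}
    (ht : t ∈ Set.Ioo 0 δ) : (1 - β) * t * deriv f t ≤ f t := by
  have hg (s : ℝ) (hs : 0 < s) : HasDerivAt (fun s => f s / deriv f s - (1 - β) * s)
      ((deriv f s * deriv f s - f s * deriv (deriv f) s) / deriv f s ^ 2 - (1 - β) * 1) s :=
    have := hasDerivAt_of_contDiffOn_Ioi hC2 hs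
    (this.1.div this.2 (hd s hs).ne').sub ((hasDerivAt_id s).const_mul _)
  have hm : MonotoneOn (fun s => f s / deriv f s - (1 - β) * s) (Set.Ioo 0 δ) := by
    refine monotoneOn_of_deriv_nonneg (convex_Ioo 0 δ)
      (fun s hs => (hg s hs.1).continuousAt.continuousWithinAt)
      (fun s hs => ?_) fun s hs => ?_
    · rw [interior_Ioo] at hs
      exact (hg s hs.1).differentiableAt.differentiableWithinAt
    · rw [interior_Ioo] at hs
      have h1 := pow_pos (hd s hs.1) 2
      rw [(hg s hs.1).deriv, mul_one, sub_nonneg, le_div_iff₀ h1]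
      nlinarith [h s hs]
  have hlim : Tendsto (fun s : ℝ => -((1 - β) * s)) (𝓝[>] 0) (𝓝 (-((1 - β) * 0))) :=
    tendsto_nhdsWithin_of_tendsto_nhds ((continuous_const.mul continuous_id).neg.tendsto 0)
  have h2 : -((1 - β) * 0) ≤ f t / deriv f t - (1 - β) * t := by
    refine le_of_tendsto hlim ?_
    filter_upwards [Ioo_mem_nhdsGT ht.1] with s hs
    refine le_trans ?_ (hm ⟨hs.1, hs.2.trans ht.2⟩ ht hs.2.le)
    have := div_pos (hpos s hs.1) (hd s hs.1)
    simp only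
    linarith
  rw [mul_zero, neg_zero, sub_nonneg, le_div_iff₀ (hd t ht.1)] at h2
  exact h2

theorem exists_rpow_le (hC2 : ContDiffOn ℝ 2 f (Set.Ioi 0)) (hmono : MonotoneOn f (Set.Ici 0))
    (hβ : β < 1) (hpos : ∀ t : ℝ, 0 < t → 0 < f t) (hd : ∀ t : ℝ, 0 < t → 0 < deriv f t)
    (h : ∀ᶠ t in 𝓝[>] 0, f t * deriv (deriv f) t ≤ β * deriv f t ^ 2) (M : ℝ) :
    ∃ c > 0, ∀ t, 0 < t → t ≤ M → c * t ^ (1 - β)⁻¹ ≤ f t := by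
  obtain ⟨δ, hδ, hsub⟩ := mem_nhdsGT_iff_exists_Ioo_subset.1 h
  have hδ : 0 < δ := hδ
  have hp : 0 < (1 - β)⁻¹ := inv_pos.2 (by linarith)
  set p := (1 - β)⁻¹ with hpdef
  have hg (s : ℝ) (hs : 0 < s) : HasDerivAt (fun s => Real.log (f s) - p * Real.log s)
      (deriv f s / f s - p * s⁻¹) s :=
    ((hasDerivAt_of_contDiffOn_Ioi hC2 hs).1.log (hpos s hs).ne').sub
      ((Real.hasDerivAt_log hs.ne').const_mul _)
  have hanti : AntitoneOn (fun s => Real.log (f s) - p * Real.log s) (Set.Ioo 0 δ) := by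
    refine antitoneOn_of_deriv_nonpos (convex_Ioo 0 δ)
      (fun s hs => (hg s hs.1).continuousAt.continuousWithinAt)
      (fun s hs => ?_) fun s hs => ?_
    · rw [interior_Ioo] at hs
      exact (hg s hs.1).differentiableAt.differentiableWithinAt
    · rw [interior_Ioo] at hs
      have h1 := mul_deriv_le_of_mul_deriv_deriv_le hC2 hpos hd hsub hs
      have h2 : 0 < 1 - β := by linarith
      rw [(hg s hs.1).deriv, sub_nonpos, div_le_iff₀ (hpos s hs.1), hpdef, ← mul_inv,
        ← div_eq_inv_mul, le_div_iff₀ (mul_pos h2 hs.1)]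
      linarith
  have hδ2 : 0 < δ / 2 := by positivity
  have hf2 := hpos _ hδ2
  set K := max (δ / 2) M
  have hK : 0 < K := hδ2.trans_le (le_max_left _ _)
  refine ⟨f (δ / 2) / K ^ p, by positivity, fun t ht htM => ?_⟩
  rw [div_mul_eq_mul_div, div_le_iff₀ (by positivity)]
  rcases le_total t (δ / 2) with htδ | htδ
  · have h1 := hanti ⟨ht, by linarith⟩ ⟨hδ2, by linarith⟩ htδ
    simp only at h1
    have h2 : Real.log (f (δ / 2) * t ^ p) ≤ Real.log (f t * (δ / 2) ^ p) := by
      rw [Real.log_mul hf2.ne' (by positivity), Real.log_mul (hpos t ht).ne' (by positivity),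
        Real.log_rpow ht, Real.log_rpow hδ2]
      linarith
    have hft := hpos t ht
    rw [Real.log_le_log_iff (by positivity) (by positivity)] at h2
    refine h2.trans ?_
    gcongr
    exact le_max_left _ _
  · have h1 : f (δ / 2) ≤ f t := hmono hδ2.le ht.le htδ
    have hft := hpos t ht
    gcongr
    exact htM.trans (le_max_right _ _)

end PowerLowerBound

section Liouville

variable {N : ℕ} {f : ℝ → ℝ} {u : EuclideanSpace ℝ (Fin N) → ℝ} {M : ℝ}

theorem IsStableSolution.false_of_source {P : EuclideanSpace ℝ (Fin N) → ℝ}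
    (h : IsStableSolution u (fun x => f (u x)) P)
    (hC2 : ContDiffOn ℝ 2 f (Set.Ioi 0)) (hmono : MonotoneOn f (Set.Ici 0))
    (hpos : ∀ t : ℝ, 0 < t → 0 < f t) (hd : ∀ t : ℝ, 0 < t → 0 < deriv f t)
    (hN : 3 ≤ N) (hu0 : ∀ x, 0 < u x) (hM : ∀ x, u x ≤ M)
    (hdim : N ≤ 10 ∨ ∃ s : ℝ, 0 < s ∧ s < 1 ∧ (N - 2) * s ^ 2 < 4 * (1 + s) ∧
      ∀ᶠ t in 𝓝[>] 0, f t * deriv (deriv f) t ≤ s ^ 2 * deriv f t ^ 2) : False := by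
  have hn : (3 : ℝ) ≤ N := by exact_mod_cast hN
  have hF (x) : 0 < f (u x) := hpos _ (hu0 x)
  rcases hdim with hdim | ⟨s, hs0, hs1, hs, hev⟩
  · have hn' : (N : ℝ) ≤ 10 := by exact_mod_cast hdim
    exact h.not_tendsto_massBall hN hF hu0 hM (a := N - 2) (by linarith) le_rfl (by nlinarith)
      (tendsto_massBall_of_div_pow
        (tendsto_massBall_div_pow hmono hpos h.contDiff hu0 hM h.neg_lap_eq))
  · have hs2 : s ^ 2 < 1 := by nlinarith
    obtain ⟨c, hc, hcf⟩ := exists_rpow_le hC2 hmono hs2 hpos hd hev M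
    have hθ : 0 < (1 - s ^ 2) / s ^ 2 := div_pos (by linarith) (by positivity)
    have hp : (1 - s ^ 2)⁻¹ = 1 + ((1 - s ^ 2) / s ^ 2)⁻¹ := by
      have : 1 - s ^ 2 ≠ 0 := by linarith
      field_simp
      ring
    rw [hp] at hcf
    refine h.not_tendsto_massBall hN hF hu0 hM (a := (N - 2) * s) ?_ ?_ ?_
      (tendsto_massBall_of_rpow hc hθ h.contDiff hu0 (fun x => ?_) ?_)
    · exact mul_nonneg (by linarith) hs0.le
    · exact mul_le_of_le_one_right (by linarith) hs1.le
    · nlinarith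
    · rw [h.neg_lap_eq]
      exact hcf _ (hu0 x) (hM x)
    · have h1 : (N - 2) * (1 - s) < 4 * ((1 - s ^ 2) / s ^ 2) := by
        rw [← mul_div_assoc, lt_div_iff₀ (by positivity)]
        nlinarith
      linarith

theorem eq_zero_of_stable (hcont : ContinuousOn f (Set.Ici 0))
    (hC2 : ContDiffOn ℝ 2 f (Set.Ioi 0)) (hconv : ConvexOn ℝ (Set.Ioi 0) f)
    (hmono : MonotoneOn f (Set.Ici 0)) (hpos : ∀ t : ℝ, 0 < t → 0 < f t)
    (hu : ContDiff ℝ 2 u) (hM : ∀ x, u x ≤ M) (hnonneg : ∀ x, 0 ≤ u x)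
    (hsol : ∀ x, -lap u x = f (u x)) (hstab : Stable (deriv f) u)
    (hdim : N ≤ 10 ∨ ∃ s : ℝ, 0 < s ∧ s < 1 ∧ (N - 2) * s ^ 2 < 4 * (1 + s) ∧
      ∀ᶠ t in 𝓝[>] 0, f t * deriv (deriv f) t ≤ s ^ 2 * deriv f t ^ 2) (x) : u x = 0 := by
  by_contra hx
  have hu0 : ∀ y, 0 < u y := pos_of_superharmonic hu hnonneg
    (fun y => by linarith [hsol y, nonneg_of_continuousOn_Ici hcont hpos (hnonneg y)]) hx
  have h0 := source_zero_eq_zero hcont hmono hpos hu hnonneg hM hsol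
  have hd (t : ℝ) (ht : 0 < t) : 0 < deriv f t := by
    have := hconv.le_mul_deriv hcont h0 ht (hasDerivAt_of_contDiffOn_Ioi hC2 ht).1.differentiableAt
    exact pos_of_mul_pos_right ((hpos t ht).trans_le this) ht.le
  have h := isStableSolution_comp hC2 hmono hu hu0 hsol hstab
  rcases le_or_gt N 2 with hN | hN
  · exact h.false_of_le_two hN fun y => hd _ (hu0 y)
  · exact h.false_of_source hC2 hmono hpos hd hN hu0 hM hdim

theorem eventually_mul_deriv_deriv_le {s : ℝ} (hs : 0 < s)
    (h : ENNReal.ofReal (1 / s ^ 2) < liminf (qfun f) (𝓝[>] (0 : ℝ))) :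
    ∀ᶠ t in 𝓝[>] 0, f t * deriv (deriv f) t ≤ s ^ 2 * deriv f t ^ 2 := by
  filter_upwards [eventually_lt_of_lt_liminf h] with t ht
  have h0 : 0 ≤ s ^ 2 * deriv f t ^ 2 := by positivity
  rcases le_or_gt (f t * deriv (deriv f) t) 0 with h1 | h1
  · exact h1.trans h0
  · rw [qfun, if_neg h1.ne', ENNReal.ofReal_lt_ofReal_iff_of_nonneg (by positivity),
      div_lt_div_iff₀ (by positivity) h1] at ht
    linarith

theorem exists_exponent_of_half_lt {q : ℝ≥0∞} (hN : 3 ≤ N) (h : (N : ℝ≥0∞) / 2 < q) :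
    ∃ s : ℝ, 0 < s ∧ s < 1 ∧ (N - 2) * s ^ 2 < 4 * (1 + s) ∧ ENNReal.ofReal (1 / s ^ 2) < q := by
  have hn : (3 : ℝ) ≤ N := by exact_mod_cast hN
  have h0 : (0 : ℝ) < 2 / N := by positivity
  have h1 : √(2 / N : ℝ) ^ 2 = 2 / N := Real.sq_sqrt h0.le
  have h2 : 0 < √(2 / N : ℝ) := Real.sqrt_pos.2 h0
  refine ⟨√(2 / N), h2, ?_, ?_, ?_⟩
  · rw [Real.sqrt_lt' one_pos, one_pow, div_lt_one (by positivity)]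
    linarith
  · rw [h1]
    have : (N - 2) * (2 / N : ℝ) ≤ 2 := by
      rw [← mul_div_assoc, div_le_iff₀ (by positivity)]
      linarith
    linarith
  · rwa [h1, one_div_div, ENNReal.ofReal_div_of_pos two_pos, ENNReal.ofReal_natCast,
      ENNReal.ofReal_ofNat]

theorem exists_exponent_of_inv_lt {qlo qhi : ℝ≥0∞} (hN : 11 ≤ N) (hq : qlo ≤ qhi)
    (h : 1 / qlo < 4 / ((N : ℝ≥0∞) - 2) * (1 + 1 / qhi ^ ((1 : ℝ) / 2))) :
    ∃ s : ℝ, 0 < s ∧ s < 1 ∧ (N - 2) * s ^ 2 < 4 * (1 + s) ∧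
      ENNReal.ofReal (1 / s ^ 2) < qlo := by
  obtain ⟨n, rfl⟩ := Nat.exists_eq_add_of_le' (by omega : 2 ≤ N)
  have hn : (9 : ℝ) ≤ n := by exact_mod_cast (by omega : 9 ≤ n)
  rcases eq_or_ne qlo ⊤ with rfl | htop
  · exact exists_exponent_of_half_lt (by omega)
      (ENNReal.div_lt_top (ENNReal.natCast_ne_top _) two_ne_zero)
  have h0 : qlo ≠ 0 := by
    rintro rfl
    simp at h
  have hq0 : 0 < qlo.toReal := ENNReal.toReal_pos h0 htop
  have hr0 : qlo ^ ((1 : ℝ) / 2) ≠ 0 := by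
    simp [ENNReal.rpow_eq_zero_iff, h0, htop]
  have h1 : 1 / qlo < 4 / (n : ℝ≥0∞) * (1 + 1 / qlo ^ ((1 : ℝ) / 2)) := by
    have h2 : ((n + 2 : ℕ) : ℝ≥0∞) - 2 = n := by
      push_cast
      exact ENNReal.add_sub_cancel_right (by simp)
    rw [h2] at h
    refine h.trans_le ?_
    gcongr
  have hfin : (1 : ℝ≥0∞) / qlo ^ ((1 : ℝ) / 2) ≠ ⊤ := ENNReal.div_ne_top ENNReal.one_ne_top hr0
  have hn0 : (n : ℝ≥0∞) ≠ 0 := by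
    have : 0 < n := by omega
    exact_mod_cast this.ne'
  have h3 := ENNReal.toReal_strict_mono (ENNReal.mul_ne_top (ENNReal.div_ne_top (by simp) hn0)
    (ENNReal.add_ne_top.2 ⟨ENNReal.one_ne_top, hfin⟩)) h1
  rw [ENNReal.toReal_mul, ENNReal.toReal_add ENNReal.one_ne_top hfin] at h3
  simp only [ENNReal.toReal_div, ENNReal.toReal_one, ← ENNReal.toReal_rpow, ENNReal.toReal_natCast,
    ENNReal.toReal_ofNat, ← Real.sqrt_eq_rpow] at h3
  set b := 1 / √qlo.toReal with hb
  have hb0 : 0 < b := by positivity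
  have hb2 : 1 / qlo.toReal = b ^ 2 := by rw [hb, div_pow, one_pow, Real.sq_sqrt hq0.le]
  rw [hb2, div_mul_eq_mul_div, lt_div_iff₀ (by linarith)] at h3
  have hb1 : b < 1 := by
    by_contra! hb1
    nlinarith
  have hc : Continuous fun s : ℝ => (((n + 2 : ℕ) : ℝ) - 2) * s ^ 2 - 4 * (1 + s) := by fun_prop
  have hlt : (((n + 2 : ℕ) : ℝ) - 2) * b ^ 2 - 4 * (1 + b) < 0 := by
    push_cast
    linarith
  obtain ⟨s, ⟨hs, hs1⟩, hbs⟩ := ((((hc.tendsto b).eventually_lt_const hlt).and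
    (eventually_lt_nhds hb1)).filter_mono nhdsWithin_le_nhds |>.and
      (self_mem_nhdsWithin (s := Set.Ioi b))).exists
  have hbs : b < s := hbs
  refine ⟨s, hb0.trans hbs, hs1, by linarith, ?_⟩
  rw [ENNReal.ofReal_lt_iff_lt_toReal (by positivity) htop,
    div_lt_iff₀ (pow_pos (hb0.trans hbs) 2), ← div_lt_iff₀' hq0, hb2]
  gcongr

end Liouville

/-- Theorem 1.11: Liouville theorem beyond power-type nonlinearities, in terms of
`q̄₀ = limsup_{u→0⁺} q(u)` and `q̲₀ = liminf_{u→0⁺} q(u)`. -/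
theorem stmt6 {N : ℕ} (hN : 1 ≤ N) (f : ℝ → ℝ)
    (hcont : ContinuousOn f (Set.Ici 0)) (hC2 : ContDiffOn ℝ 2 f (Set.Ioi 0))
    (hconv : ConvexOn ℝ (Set.Ioi 0) f) (hmono : MonotoneOn f (Set.Ici 0))
    (hpos : ∀ t : ℝ, 0 < t → 0 < f t)
    (qhi qlo : ℝ≥0∞)
    (hqhi : qhi = Filter.limsup (qfun f) (𝓝[>] (0:ℝ)))
    (hqlo : qlo = Filter.liminf (qfun f) (𝓝[>] (0:ℝ)))
    (u : EuclideanSpace ℝ (Fin N) → ℝ) (hu : ContDiff ℝ 2 u)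
    (hbd : ∃ M, ∀ x, |u x| ≤ M) (hnonneg : ∀ x, 0 ≤ u x)
    (hsol : ∀ x, -lap u x = f (u x)) (hstab : Stable (deriv f) u)
    (hdim : (3 ≤ N ∧ (N : ℝ≥0∞) / 2 < qlo) ∨
      (N ≤ 6 ∧ qhi < ⊤) ∨
      (1 / qlo < 4 / ((N : ℝ≥0∞) - 2) * (1 + 1 / qhi ^ ((1:ℝ)/2)))) :
    ∀ x, u x = 0 := by
  obtain ⟨M, hM⟩ := hbd
  refine eq_zero_of_stable hcont hC2 hconv hmono hpos hu (fun x => (le_abs_self _).trans (hM x))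
    hnonneg hsol hstab (or_iff_not_imp_left.2 fun hN10 => ?_)
  obtain ⟨s, hs0, hs1, hs, hsq⟩ : ∃ s : ℝ, 0 < s ∧ s < 1 ∧ (N - 2) * s ^ 2 < 4 * (1 + s) ∧
      ENNReal.ofReal (1 / s ^ 2) < qlo := by
    rcases hdim with ⟨h3, h⟩ | ⟨h6, -⟩ | h
    · exact exists_exponent_of_half_lt h3 h
    · omega
    · exact exists_exponent_of_inv_lt (by omega)
        (by rw [hqlo, hqhi]; exact liminf_le_limsup) h
  exact ⟨s, hs0, hs1, hs, eventually_mul_deriv_deriv_le hs0 (hqlo ▸ hsq)⟩
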